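/- arXiv:1701.05500 — 3 statements merged into one kernel-verified Lean document; each statement's English description precedes it below -/
import Mathlib

section
/- Let B=(G,H) be a pseudo-Laman bigraph with biedge set ℰ without self-loops, fix a biedge ē∈ℰ and a weight vector wt∈ℚ^{ℰ∖{ē}}. Assume that B has Laman number N with respect to ē, and that for every bidistance d on B compatible with wt the quotient bigraph B_d has a Laman number N_d with respect to the biedge corresponding to ē (with the convention that a bigraph containing a self-loop has Laman number 0). Then the set of bidistances d compatible with wt for which N_d ≠ 0 is finite, and N = Σ_d N_d, the sum ranging over all bidistances d on B compatible with wt. -/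
set_option maxHeartbeats 1000000

noncomputable section
open Classical

namespace LamanPaper

variable {V E : Type}

/-- The adjacency relation induced by an incidence map `ends`. -/
def adjRel (ends : E → Sym2 V) : V → V → Prop := fun u v => ∃ e : E, ends e = s(u, v)

/-- The setoid of connected components of the graph with incidence map `ends`. -/
def ccSetoid (ends : E → Sym2 V) : Setoid V :=
  ⟨Relation.EqvGen (adjRel ends), Relation.EqvGen.is_equivalence _⟩

/-- The number of connected components. -/
def numCC (ends : E → Sym2 V) : ℕ := Nat.card (Quotient (ccSetoid ends))

/-- The dimension of a graph: number of vertices minus number of connected components. -/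
def gDim (ends : E → Sym2 V) : ℕ := Nat.card V - numCC ends

/-- Restriction of a graph to a set of edges. -/
def restrictEnds (ends : E → Sym2 V) (S : Set E) : {e : E // e ∈ S} → Sym2 V :=
  fun e => ends e.1

/-- Deletion of a set of edges from a graph. -/
def deleteEnds (ends : E → Sym2 V) (S : Set E) : {e : E // e ∉ S} → Sym2 V :=
  fun e => ends e.1

/-- The setoid on vertices generated by contracting the edges in `S`. -/
def contrSetoid (ends : E → Sym2 V) (S : Set E) : Setoid V :=
  ⟨Relation.EqvGen fun u v => ∃ e ∈ S, ends e = s(u, v), Relation.EqvGen.is_equivalence _⟩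

/-- Contraction of the edges in `S`: the remaining edges join the equivalence classes of
their endpoints. -/
def contractEnds (ends : E → Sym2 V) (S : Set E) :
    {e : E // e ∉ S} → Sym2 (Quotient (contrSetoid ends S)) :=
  fun e => (ends e.1).map (Quotient.mk (contrSetoid ends S))

/-- An edge is a bridge if deleting it increases the number of connected components. -/
def IsBridge (ends : E → Sym2 V) (e : E) : Prop :=
  numCC ends < numCC (deleteEnds ends ({e} : Set E))

/-- The smaller endpoint of an (unordered) edge, with respect to a linear order. -/
def sMin [LinearOrder V] (s : Sym2 V) : V :=
  Sym2.lift ⟨fun a b => min a b, fun a b => min_comm a b⟩ s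

/-- The larger endpoint of an (unordered) edge, with respect to a linear order. -/
def sMax [LinearOrder V] (s : Sym2 V) : V :=
  Sym2.lift ⟨fun a b => max a b, fun a b => max_comm a b⟩ s

theorem sMin_mem [LinearOrder V] (s : Sym2 V) : sMin s ∈ s := by
  induction s using Sym2.ind with
  | _ x y => rcases min_choice x y with h | h <;> simp [sMin, Sym2.lift_mk, h, Sym2.mem_iff]

theorem sMax_mem [LinearOrder V] (s : Sym2 V) : sMax s ∈ s := by
  induction s using Sym2.ind with
  | _ x y => rcases max_choice x y with h | h <;> simp [sMax, Sym2.lift_mk, h, Sym2.mem_iff]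

/-- A bigraph: a pair of finite multigraphs `G = (V, ℰ)` and `H = (W, ℰ)` sharing the same
set of (bi)edges, together with fixed total orders on the two vertex sets. -/
structure Bigraph where
  ℰ : Type
  V : Type
  W : Type
  finE : Finite ℰ
  finV : Finite V
  finW : Finite W
  τG : ℰ → Sym2 V
  τH : ℰ → Sym2 W
  ordV : LinearOrder V
  ordW : LinearOrder W

namespace Bigraph

variable (B : Bigraph)

instance : Finite B.ℰ := B.finE
instance : Finite B.V := B.finV
instance : Finite B.W := B.finW

/-- The dimension of the first graph of a bigraph. -/
def dimG : ℕ := gDim B.τG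

/-- The dimension of the second graph of a bigraph. -/
def dimH : ℕ := gDim B.τH

/-- A bigraph is pseudo-Laman if `dim G + dim H = |ℰ| + 1`. -/
def PseudoLaman : Prop := B.dimG + B.dimH = Nat.card B.ℰ + 1

/-- A bigraph has a (self-)loop if some biedge is a self-loop in `G` or in `H`. -/
def HasLoop : Prop := (∃ e, (B.τG e).IsDiag) ∨ (∃ e, (B.τH e).IsDiag)

/-- The set `P` of ordered pairs of distinct vertices of `G` joined by some edge. -/
def Pset : Set (B.V × B.V) := {p | p.1 ≠ p.2 ∧ ∃ e, B.τG e = s(p.1, p.2)}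

/-- The set `Q` of ordered pairs of distinct vertices of `H` joined by some edge. -/
def Qset : Set (B.W × B.W) := {q | q.1 ≠ q.2 ∧ ∃ e, B.τH e = s(q.1, q.2)}

/-- The smaller endpoint (w.r.t. the fixed total order) of a biedge in `G`. -/
def eFstG (e : B.ℰ) : B.V := letI := B.ordV; sMin (B.τG e)

/-- The larger endpoint of a biedge in `G`. -/
def eSndG (e : B.ℰ) : B.V := letI := B.ordV; sMax (B.τG e)

/-- The smaller endpoint of a biedge in `H`. -/
def eFstH (e : B.ℰ) : B.W := letI := B.ordW; sMin (B.τH e)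

/-- The larger endpoint of a biedge in `H`. -/
def eSndH (e : B.ℰ) : B.W := letI := B.ordW; sMax (B.τH e)

theorem eFstG_mem (e : B.ℰ) : B.eFstG e ∈ B.τG e := by
  letI := B.ordV; exact sMin_mem _

theorem eSndG_mem (e : B.ℰ) : B.eSndG e ∈ B.τG e := by
  letI := B.ordV; exact sMax_mem _

theorem eFstH_mem (e : B.ℰ) : B.eFstH e ∈ B.τH e := by
  letI := B.ordW; exact sMin_mem _

theorem eSndH_mem (e : B.ℰ) : B.eSndH e ∈ B.τH e := by
  letI := B.ordW; exact sMax_mem _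

/-- The affine solution set `Z^B(λ)` of a bigraph with distinguished biedge `ebar` and
parameters `lam`. -/
def ZSet (ebar : B.ℰ) (lam : {e : B.ℰ // e ≠ ebar} → ℂ) :
    Set ((↥B.Pset → ℂ) × (↥B.Qset → ℂ)) :=
  {xy |
    (∀ p : ↥B.Pset, (p : B.V × B.V) = (B.eFstG ebar, B.eSndG ebar) → xy.1 p = 1) ∧
    (∀ q : ↥B.Qset, (q : B.W × B.W) = (B.eFstH ebar, B.eSndH ebar) → xy.2 q = 1) ∧
    (∀ e : {e : B.ℰ // e ≠ ebar}, ∀ p : ↥B.Pset, ∀ q : ↥B.Qset,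
      (p : B.V × B.V) = (B.eFstG e.1, B.eSndG e.1) →
      (q : B.W × B.W) = (B.eFstH e.1, B.eSndH e.1) →
      xy.1 p * xy.2 q = lam e) ∧
    (∀ (n : ℕ) (u : ℕ → B.V) (w : Fin n → ↥B.Pset),
      (∀ i : Fin n, (w i : B.V × B.V) = (u i.1, u (i.1 + 1))) → u n = u 0 →
      ∑ i, xy.1 (w i) = 0) ∧
    (∀ (n : ℕ) (u : ℕ → B.W) (w : Fin n → ↥B.Qset),
      (∀ i : Fin n, (w i : B.W × B.W) = (u i.1, u (i.1 + 1))) → u n = u 0 →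
      ∑ i, xy.2 (w i) = 0)}

/-- `B` has Laman number `N` with respect to the biedge `ebar`:  there is a nonzero
polynomial `p` in the parameters such that whenever `p` does not vanish, the solution set
`Z^B(λ)` has exactly `N` elements.  By convention a bigraph containing a self-loop has
Laman number `0`. -/
def HasLamanNumber (ebar : B.ℰ) (N : ℕ) : Prop :=
  (B.HasLoop ∧ N = 0) ∨
  (¬ B.HasLoop ∧ ∃ P : MvPolynomial {e : B.ℰ // e ≠ ebar} ℂ, P ≠ 0 ∧
    ∀ lam : {e : B.ℰ // e ≠ ebar} → ℂ, MvPolynomial.eval lam P ≠ 0 →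
      (B.ZSet ebar lam).Finite ∧ Nat.card ↥(B.ZSet ebar lam) = N)

/-- The bigraph obtained by restricting the biedges to a subset `S` (both in `G` and `H`). -/
def restrict (S : Set B.ℰ) : Bigraph where
  ℰ := {e : B.ℰ // e ∈ S}
  V := B.V
  W := B.W
  finE := Subtype.finite
  finV := B.finV
  finW := B.finW
  τG := fun e => B.τG e.1
  τH := fun e => B.τH e.1
  ordV := B.ordV
  ordW := B.ordW

/-- The bigraph `^M B = (G / M, H ∖ M)`: contract the biedges of `M` in `G` and delete them
in `H`. -/
def ctrG (M : Set B.ℰ) (ord : LinearOrder (Quotient (contrSetoid B.τG M))) : Bigraph where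
  ℰ := {e : B.ℰ // e ∉ M}
  V := Quotient (contrSetoid B.τG M)
  W := B.W
  finE := Subtype.finite
  finV := Quotient.finite _
  finW := B.finW
  τG := contractEnds B.τG M
  τH := fun e => B.τH e.1
  ordV := ord
  ordW := B.ordW

/-- The bigraph `B ^ M = (G ∖ M, H / M)`: delete the biedges of `M` in `G` and contract them
in `H`. -/
def ctrH (M : Set B.ℰ) (ord : LinearOrder (Quotient (contrSetoid B.τH M))) : Bigraph where
  ℰ := {e : B.ℰ // e ∉ M}
  V := B.V
  W := Quotient (contrSetoid B.τH M)
  finE := Subtype.finite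
  finV := B.finV
  finW := Quotient.finite _
  τG := fun e => B.τG e.1
  τH := contractEnds B.τH M
  ordV := B.ordV
  ordW := ord

/-! ### Bidistances -/

/-- Symmetry of a function on `P`: `d_V(u,v) = d_V(v,u)`. -/
def BidistSymmG (dV : ↥B.Pset → ℚ) : Prop :=
  ∀ p p' : ↥B.Pset, (p' : B.V × B.V) = ((p : B.V × B.V).2, (p : B.V × B.V).1) → dV p' = dV p

/-- Symmetry of a function on `Q`: `d_W(t,w) = d_W(w,t)`. -/
def BidistSymmH (dW : ↥B.Qset → ℚ) : Prop :=
  ∀ q q' : ↥B.Qset, (q' : B.W × B.W) = ((q : B.W × B.W).2, (q : B.W × B.W).1) → dW q' = dW q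

/-- The sum condition: `d_V(u,v) + d_W(t,w) = wt(e)` for every biedge `e ≠ ebar`. -/
def BidistSum (ebar : B.ℰ) (wt : {e : B.ℰ // e ≠ ebar} → ℚ)
    (dV : ↥B.Pset → ℚ) (dW : ↥B.Qset → ℚ) : Prop :=
  ∀ e : {e : B.ℰ // e ≠ ebar}, ∀ p : ↥B.Pset, ∀ q : ↥B.Qset,
    s((p : B.V × B.V).1, (p : B.V × B.V).2) = B.τG e.1 →
    s((q : B.W × B.W).1, (q : B.W × B.W).2) = B.τH e.1 →
    dV p + dW q = wt e

/-- The base condition: `d_V(ū,v̄) = d_W(t̄,w̄) = 0` on the distinguished biedge. -/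
def BidistBase (ebar : B.ℰ) (dV : ↥B.Pset → ℚ) (dW : ↥B.Qset → ℚ) : Prop :=
  (∀ p : ↥B.Pset, s((p : B.V × B.V).1, (p : B.V × B.V).2) = B.τG ebar → dV p = 0) ∧
  (∀ q : ↥B.Qset, s((q : B.W × B.W).1, (q : B.W × B.W).2) = B.τH ebar → dW q = 0)

/-- On every closed walk in `G`, the minimum of `d_V` over the consecutive vertex pairs is
attained at least twice. -/
def BidistMinG (dV : ↥B.Pset → ℚ) : Prop :=
  ∀ (n : ℕ) (u : ℕ → B.V) (w : Fin n → ↥B.Pset),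
    (∀ i : Fin n, (w i : B.V × B.V) = (u i.1, u (i.1 + 1))) → u n = u 0 →
    ∀ i : Fin n, (∀ k, dV (w i) ≤ dV (w k)) → ∃ j, j ≠ i ∧ dV (w j) = dV (w i)

/-- On every closed walk in `H`, the minimum of `d_W` over the consecutive vertex pairs is
attained at least twice. -/
def BidistMinH (dW : ↥B.Qset → ℚ) : Prop :=
  ∀ (n : ℕ) (u : ℕ → B.W) (w : Fin n → ↥B.Qset),
    (∀ i : Fin n, (w i : B.W × B.W) = (u i.1, u (i.1 + 1))) → u n = u 0 →
    ∀ i : Fin n, (∀ k, dW (w i) ≤ dW (w k)) → ∃ j, j ≠ i ∧ dW (w j) = dW (w i)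

/-- A bidistance on `B` compatible with the weight vector `wt`. -/
def IsBidistance (ebar : B.ℰ) (wt : {e : B.ℰ // e ≠ ebar} → ℚ)
    (dV : ↥B.Pset → ℚ) (dW : ↥B.Qset → ℚ) : Prop :=
  B.BidistSymmG dV ∧ B.BidistSymmH dW ∧ B.BidistSum ebar wt dV dW ∧
  B.BidistBase ebar dV dW ∧ B.BidistMinG dV ∧ B.BidistMinH dW

/-! ### The quotient bigraph `B_d` -/

/-- The value of `d_V` on (the endpoint pair of) a biedge. -/
def gvalG (dV : ↥B.Pset → ℚ) (e : B.ℰ) : ℚ :=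
  if h : ∃ p : ↥B.Pset, s((p : B.V × B.V).1, (p : B.V × B.V).2) = B.τG e then dV h.choose
  else 0

/-- The value of `d_W` on (the endpoint pair of) a biedge. -/
def gvalH (dW : ↥B.Qset → ℚ) (e : B.ℰ) : ℚ :=
  if h : ∃ q : ↥B.Qset, s((q : B.W × B.W).1, (q : B.W × B.W).2) = B.τH e then dW h.choose
  else 0

/-- Incidences of the graph `G`: pairs of a biedge and one of its endpoints. -/
def IncG := {q : B.ℰ × B.V // q.2 ∈ B.τG q.1}

/-- Incidences of the graph `H`. -/
def IncH := {q : B.ℰ × B.W // q.2 ∈ B.τH q.1}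

instance : Finite B.IncG := by unfold IncG; infer_instance
instance : Finite B.IncH := by unfold IncH; infer_instance

/-- Two incidences `(e,v)`, `(e',v')` of `G` are identified in `B_d` if the `d_V`-levels of
`e` and `e'` agree (say equal to `α`) and `v`, `v'` are connected by edges of level `> α`. -/
def relIncG (dV : ↥B.Pset → ℚ) : B.IncG → B.IncG → Prop := fun a b =>
  B.gvalG dV a.1.1 = B.gvalG dV b.1.1 ∧
  Relation.EqvGen (fun u v => ∃ e, B.gvalG dV a.1.1 < B.gvalG dV e ∧ B.τG e = s(u, v))
    a.1.2 b.1.2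

def relIncH (dW : ↥B.Qset → ℚ) : B.IncH → B.IncH → Prop := fun a b =>
  B.gvalH dW a.1.1 = B.gvalH dW b.1.1 ∧
  Relation.EqvGen (fun u v => ∃ e, B.gvalH dW a.1.1 < B.gvalH dW e ∧ B.τH e = s(u, v))
    a.1.2 b.1.2

def incSetoidG (dV : ↥B.Pset → ℚ) : Setoid B.IncG :=
  ⟨Relation.EqvGen (B.relIncG dV), Relation.EqvGen.is_equivalence _⟩

def incSetoidH (dW : ↥B.Qset → ℚ) : Setoid B.IncH :=
  ⟨Relation.EqvGen (B.relIncH dW), Relation.EqvGen.is_equivalence _⟩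

/-- The vertices of the first graph `G_{d_V}` of the quotient bigraph `B_d`:
classes of incidences.  This realizes the disjoint union of the contractions
`G_{≥α} / G_{>α}` (with isolated vertices discarded). -/
def QVertG (dV : ↥B.Pset → ℚ) := Quotient (B.incSetoidG dV)

def QVertH (dW : ↥B.Qset → ℚ) := Quotient (B.incSetoidH dW)

/-- The incidence map of `G_{d_V}`. -/
def quotEndsG (dV : ↥B.Pset → ℚ) : B.ℰ → Sym2 (B.QVertG dV) := fun e =>
  s(Quotient.mk (B.incSetoidG dV) ⟨(e, B.eFstG e), B.eFstG_mem e⟩,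
    Quotient.mk (B.incSetoidG dV) ⟨(e, B.eSndG e), B.eSndG_mem e⟩)

/-- The incidence map of `H_{d_W}`. -/
def quotEndsH (dW : ↥B.Qset → ℚ) : B.ℰ → Sym2 (B.QVertH dW) := fun e =>
  s(Quotient.mk (B.incSetoidH dW) ⟨(e, B.eFstH e), B.eFstH_mem e⟩,
    Quotient.mk (B.incSetoidH dW) ⟨(e, B.eSndH e), B.eSndH_mem e⟩)

/-- The quotient bigraph `B_d = (G_{d_V}, H_{d_W})` of a bigraph by a bidistance `(d_V, d_W)`,
with arbitrarily fixed total orders on the new vertex sets.  It has the same biedges as `B`. -/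
def quotBigraph (dV : ↥B.Pset → ℚ) (dW : ↥B.Qset → ℚ)
    (oV : LinearOrder (B.QVertG dV)) (oW : LinearOrder (B.QVertH dW)) : Bigraph where
  ℰ := B.ℰ
  V := B.QVertG dV
  W := B.QVertH dW
  finE := B.finE
  finV := Quotient.finite _
  finW := Quotient.finite _
  τG := B.quotEndsG dV
  τH := B.quotEndsH dW
  ordV := oV
  ordW := oW

/-! ### Untangling -/

/-- `B` untangles via the biedge `ebar` with respect to the decomposition
`ℰ = E1 ⊔ E2 ⊔ {ebar}`, `V = V1 ⊔ V2`, `W = W1 ⊔ W2`:  the graph `G` is the disjoint union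
of the subgraph on `V1` with edges `E1 ∪ {ebar}` and the subgraph on `V2` with edges `E2`,
while `H` is the disjoint union of the subgraph on `W1` with edges `E1` and the subgraph on
`W2` with edges `E2 ∪ {ebar}`.  The two bigraphs into which `B` untangles are then
`B₁ = B.restrict E1` and `B₂ = B.restrict E2`. -/
def Untangles (ebar : B.ℰ) (E1 E2 : Set B.ℰ) (V1 V2 : Set B.V) (W1 W2 : Set B.W) : Prop :=
  ebar ∉ E1 ∧ ebar ∉ E2 ∧ E1 ∩ E2 = ∅ ∧ (∀ e : B.ℰ, e = ebar ∨ e ∈ E1 ∨ e ∈ E2) ∧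
  V1 ∩ V2 = ∅ ∧ V1 ∪ V2 = Set.univ ∧
  (∀ e ∈ E1, ∀ v, v ∈ B.τG e → v ∈ V1) ∧ (∀ v, v ∈ B.τG ebar → v ∈ V1) ∧
  (∀ e ∈ E2, ∀ v, v ∈ B.τG e → v ∈ V2) ∧
  W1 ∩ W2 = ∅ ∧ W1 ∪ W2 = Set.univ ∧
  (∀ e ∈ E1, ∀ x, x ∈ B.τH e → x ∈ W1) ∧
  (∀ e ∈ E2, ∀ x, x ∈ B.τH e → x ∈ W2) ∧ (∀ x, x ∈ B.τH ebar → x ∈ W2)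

/-! ### The rational map `f_B` -/

/-- The vector of coordinates of the rational map `f_B`, evaluated on representatives
`x : V → ℂ` and `y : W → ℂ`:  the `e`-th coordinate is `(x_u - x_v)(y_t - y_w)` where
`{u,v} = τ_G(e)` with `u ≺ v` and `{t,w} = τ_H(e)` with `t ≺ w`.  (For a self-loop the
corresponding factor is `0`.) -/
def fVec (x : B.V → ℂ) (y : B.W → ℂ) : B.ℰ → ℂ :=
  fun e => (x (B.eFstG e) - x (B.eSndG e)) * (y (B.eFstH e) - y (B.eSndH e))

/-- The subspace `L_G` of vectors that are constant on each connected component of `G`. -/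
def LG : Submodule ℂ (B.V → ℂ) where
  carrier := {x | ∀ u v : B.V, Relation.EqvGen (adjRel B.τG) u v → x u = x v}
  add_mem' := by
    intro a b ha hb u v h
    simp only [Pi.add_apply, ha u v h, hb u v h]
  zero_mem' := by intro u v _; rfl
  smul_mem' := by
    intro c a ha u v h
    simp only [Pi.smul_apply, ha u v h]

/-- The subspace `L_H` of vectors that are constant on each connected component of `H`. -/
def LH : Submodule ℂ (B.W → ℂ) where
  carrier := {y | ∀ u v : B.W, Relation.EqvGen (adjRel B.τH) u v → y u = y v}
  add_mem' := by
    intro a b ha hb u v h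
    simp only [Pi.add_apply, ha u v h, hb u v h]
  zero_mem' := by intro u v _; rfl
  smul_mem' := by
    intro c a ha u v h
    simp only [Pi.smul_apply, ha u v h]

/-- Dominance of the rational map `f_B`:  the image of `f_B` is not contained in any
proper algebraic subset of `ℙ(ℂ^ℰ)`, equivalently in no zero set of a nonzero homogeneous
polynomial. -/
def FDominant : Prop :=
  ¬ ∃ (n : ℕ) (P : MvPolynomial B.ℰ ℂ), P ≠ 0 ∧ P.IsHomogeneous n ∧
      ∀ (x : B.V → ℂ) (y : B.W → ℂ), MvPolynomial.eval (B.fVec x y) P = 0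

end Bigraph


section Aux
open MeasureTheory Filter Topology

theorem poly_null_fin (n : ℕ) (P : MvPolynomial (Fin n) ℂ) (hP : P ≠ 0) :
    ∀ᵐ c : Fin n → ℂ, MvPolynomial.eval c P ≠ 0 := by
  induction n with
  | zero =>
    refine Filter.Eventually.of_forall fun c => ?_
    rw [MvPolynomial.eq_C_of_isEmpty P] at hP ⊢
    simpa using hP
  | succ n ih =>
    have mp := volume_preserving_piFinSuccAbove (fun _ : Fin (n+1) => ℂ) 0
    set Q := MvPolynomial.finSuccEquiv ℂ n P with hQ
    have hQ0 : Q ≠ 0 := by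
      rw [hQ]; simpa using hP
    have h1 : ∀ᵐ z : ℂ × (Fin n → ℂ), MvPolynomial.eval (Fin.cons z.1 z.2) P ≠ 0 := by
      have hm : MeasurableSet {z : ℂ × (Fin n → ℂ) | MvPolynomial.eval (Fin.cons z.1 z.2 : Fin (n+1) → ℂ) P ≠ 0} := by
        have hc : Continuous fun z : ℂ × (Fin n → ℂ) => MvPolynomial.eval (Fin.cons z.1 z.2 : Fin (n+1) → ℂ) P := by
          apply (MvPolynomial.continuous_eval P).comp
          fun_prop
        exact (isClosed_singleton.preimage hc).measurableSet.compl
      have hsw : ∀ᵐ z : (Fin n → ℂ) × ℂ, MvPolynomial.eval (Fin.cons z.2 z.1) P ≠ 0 := by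
        refine (Measure.ae_prod_iff_ae_ae ?_).2 ?_
        · exact measurable_swap hm
        · filter_upwards [ih (Q.leadingCoeff) (by simpa using hQ0)] with y hy
          have hfin : (((Q.map (MvPolynomial.eval y)).roots.toFinset : Set ℂ)).Finite := Finset.finite_toSet _
          have hne : Q.map (MvPolynomial.eval y) ≠ 0 := by
            intro h0
            apply hy
            have := congrArg (fun p => Polynomial.coeff p Q.natDegree) h0
            simpa [Polynomial.coeff_map] using this
          filter_upwards [hfin.countable.ae_notMem volume] with x hx
          intro h0
          apply hx
          rw [MvPolynomial.eval_eq_eval_mv_eval'] at h0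
          simpa [hne, Polynomial.IsRoot] using h0
      exact (Measure.measurePreserving_swap (μ := (volume : Measure ℂ)) (ν := (volume : Measure (Fin n → ℂ)))).quasiMeasurePreserving.ae hsw
    have := mp.quasiMeasurePreserving.ae h1
    filter_upwards [this] with c hc
    convert hc using 3
    simp [MeasurableEquiv.piFinSuccAbove, Fin.insertNthEquiv]

theorem poly_null {ι : Type} [Fintype ι] (P : MvPolynomial ι ℂ) (hP : P ≠ 0) :
    ∀ᵐ c : ι → ℂ, MvPolynomial.eval c P ≠ 0 := by
  let e := Fintype.equivFin ι
  have h := poly_null_fin _ (MvPolynomial.rename e P)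
    (fun h => hP (MvPolynomial.rename_injective _ e.injective (by rw [h, map_zero])))
  have mp := volume_measurePreserving_piCongrLeft (fun _ : Fin (Fintype.card ι) => ℂ) e
  have := mp.quasiMeasurePreserving.ae h
  filter_upwards [this] with c hc
  rw [MvPolynomial.eval_rename] at hc
  convert hc using 3
  ext i
  simp [Function.comp, MeasurableEquiv.piCongrLeft, Equiv.piCongrLeft_apply]

theorem ae_scale {ι : Type} [Fintype ι] (r : ι → ℝ) (hr : ∀ i, r i ≠ 0) {p : (ι → ℂ) → Prop}
    (hp : ∀ᵐ c : ι → ℂ, p c) : ∀ᵐ c : ι → ℂ, p (fun i => (r i : ℂ) * c i) := by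
  let f : (ι → ℂ) ≃ₗ[ℝ] (ι → ℂ) := LinearEquiv.piCongrRight fun i =>
    LinearEquiv.smulOfNeZero ℝ ℂ (r i) (hr i)
  have h := Measure.addHaar_preimage_linearEquiv (volume : Measure (ι → ℂ)) f {c | ¬ p c}
  rw [ae_iff] at hp ⊢
  rw [hp, mul_zero] at h
  convert h using 2
  ext c
  have : (fun i => (r i : ℂ) * c i) = f c := by ext i; simp [f]
  simp [this]

theorem sard_pi {ι : Type} [Fintype ι] (F : (ι → ℂ) → (ι → ℂ)) (hF : Differentiable ℝ F) :
    ∀ᵐ c : ι → ℂ, ∀ z, F z = c → (fderiv ℝ F z).det ≠ 0 := by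
  have := addHaar_image_eq_zero_of_det_fderivWithin_eq_zero (volume : Measure (ι → ℂ))
    (s := {z | (fderiv ℝ F z).det = 0}) (f := F) (f' := fun z => fderiv ℝ F z)
    (fun z _ => (hF z).hasFDerivAt.hasFDerivWithinAt) (fun z hz => hz)
  rw [ae_iff]
  refine measure_mono_null ?_ this
  intro c hc
  simp only [Set.mem_setOf_eq] at hc
  push Not at hc
  obtain ⟨z, hz, h0⟩ := hc
  exact ⟨z, h0, hz⟩



/-- initial space -/
def InSp {E : Type} (X : Submodule ℂ (E → ℂ)) (a : E → ℚ) : Set (E → ℂ) :=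
  {z | ∀ α : ℚ, ∃ x ∈ X, (∀ e, α < a e → x e = 0) ∧ ∀ e, a e = α → x e = z e}

def SubK {E : Type} [Fintype E] (K : E → E → ℂ) : Set (E → ℂ) :=
  {x | ∀ e, x e = ∑ f, K e f * x f}

def NormalK {E : Type} (T : Finset E) (K : E → E → ℂ) : Prop :=
  (∀ e f, K e f ≠ 0 → f ∈ T) ∧ ∀ e ∈ T, ∀ f, K e f = if f = e then 1 else 0

def SolS {E : Type} (A B : Set (E → ℂ)) (eb : E) (c : {e : E // e ≠ eb} → ℂ) :
    Set ((E → ℂ) × (E → ℂ)) :=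
  {z | z.1 ∈ A ∧ z.2 ∈ B ∧ z.1 eb = 1 ∧ z.2 eb = 1 ∧ ∀ e : {e : E // e ≠ eb}, z.1 e.1 * z.2 e.1 = c e}

theorem good_basis {E : Type} [Fintype E] (X : Submodule ℂ (E → ℂ)) (a : E → ℚ) (eb : E) :
    ∃ (T : Finset E) (M : E → E → ℂ), T.card = Module.finrank ℂ X ∧ NormalK T M ∧
      (∀ e f, M e f ≠ 0 → a e ≤ a f) ∧ (X : Set (E → ℂ)) = SubK M ∧
      (eb ∉ T → ∀ f, M eb f ≠ 0 → a eb < a f) := by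
  let φ : E → Module.Dual ℂ X := fun e => (LinearMap.proj e : (E → ℂ) →ₗ[ℂ] ℂ) ∘ₗ X.subtype
  have φa : ∀ e (x : X), φ e x = x.1 e := fun e x => rfl
  let r : E → ℚ ×ₗ (ℕ ×ₗ ℕ) := fun e =>
    toLex (a e, toLex (if e = eb then 1 else 0, (Fintype.equivFin E e : ℕ)))
  have rinj : Function.Injective r := by
    intro e f h
    simp only [r, EmbeddingLike.apply_eq_iff_eq, Prod.mk.injEq] at h
    exact (Fintype.equivFin E).injective (Fin.ext h.2.2)
  have rle : ∀ e f, r e ≤ r f → a e ≤ a f := by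
    intro e f h
    rcases (Prod.Lex.le_iff.1 h) with h | h
    · exact h.le
    · exact h.1.le
  have rlt : ∀ f, r eb < r f → a eb < a f := by
    intro f h
    rcases (Prod.Lex.lt_iff.1 h) with h1 | h1
    · exact h1
    · exfalso
      by_cases hf : f = eb
      · subst hf; exact lt_irrefl _ h
      · have h2 := h1.2
        simp only [r, ofLex_toLex, if_true, hf, if_false] at h2
        rcases (Prod.Lex.lt_iff.1 h2) with h3 | h3
        · simp at h3
        · simp at h3
  let T : Finset E := Finset.univ.filter fun e => φ e ∉ Submodule.span ℂ (φ '' {f | r e < r f})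
  have memT : ∀ e, e ∈ T ↔ φ e ∉ Submodule.span ℂ (φ '' {f | r e < r f}) := by
    intro e; simp [T]
  have hspan : ∀ e, φ e ∈ Submodule.span ℂ (φ '' {f | f ∈ T ∧ r e ≤ r f}) := by
    have wf : WellFounded (fun e f : E => r f < r e) := by
      have : IsStrictOrder E (fun e f : E => r f < r e) :=
        { irrefl := fun e => lt_irrefl _, trans := fun _ _ _ h1 h2 => lt_trans h2 h1 }
      exact Finite.wellFounded_of_trans_of_irrefl _
    intro e
    induction e using wf.induction with
    | _ e ih =>
      by_cases he : e ∈ T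
      · exact Submodule.subset_span ⟨e, ⟨he, le_rfl⟩, rfl⟩
      · rw [memT, not_not] at he
        refine Submodule.span_le.2 ?_ he
        rintro _ ⟨f, hf, rfl⟩
        refine Submodule.span_mono (Set.image_mono ?_) (ih f hf)
        rintro g ⟨hg, hg'⟩
        exact ⟨hg, (le_of_lt hf).trans hg'⟩
  have hM : ∀ e, ∃ m : E → ℂ, (∀ f, m f ≠ 0 → f ∈ T ∧ r e ≤ r f) ∧ φ e = ∑ f, m f • φ f := by
    intro e
    obtain ⟨l, hl, hl'⟩ := (Finsupp.mem_span_image_iff_linearCombination ℂ).1 (hspan e)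
    refine ⟨l, fun f hf => ?_, ?_⟩
    · exact hl (Finsupp.mem_support_iff.2 hf)
    · rw [← hl', Finsupp.linearCombination_apply, Finsupp.sum_fintype _ _ (by simp)]
  choose m hm1 hm2 using hM
  let M : E → E → ℂ := fun e => if e ∈ T then (fun f => if f = e then 1 else 0) else m e
  have M1 : ∀ e f, M e f ≠ 0 → f ∈ T ∧ r e ≤ r f := by
    intro e f h
    by_cases he : e ∈ T
    · simp only [M, he, if_true] at h
      have : f = e := by by_contra h'; simp [h'] at h
      subst this; exact ⟨he, le_rfl⟩
    · simp only [M, he, if_false] at h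
      exact hm1 e f h
  have M2 : ∀ e, φ e = ∑ f, M e f • φ f := by
    intro e
    by_cases he : e ∈ T
    · simp [M, he]
    · simp only [M, he, if_false]; exact hm2 e
  have hN : NormalK T M := ⟨fun e f h => (M1 e f h).1, fun e he f => by simp [M, he]⟩
  have hsub : (X : Set (E → ℂ)) ⊆ SubK M := by
    intro x hx e
    have := LinearMap.congr_fun (M2 e) ⟨x, hx⟩
    simpa [φa] using this
  let res : X →ₗ[ℂ] (T → ℂ) := LinearMap.pi fun f => φ f.1
  have key : ∀ x y, x ∈ SubK M → y ∈ SubK M → (∀ f ∈ T, x f = y f) → x = y := by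
    intro x y hx hy h
    ext e
    rw [hx e, hy e]
    refine Finset.sum_congr rfl fun f _ => ?_
    by_cases h0 : M e f = 0
    · simp [h0]
    · rw [h f (M1 e f h0).1]
  have hinj : Function.Injective res := by
    intro x y h
    apply Subtype.ext
    refine key _ _ (hsub x.2) (hsub y.2) fun f hf => ?_
    exact congrFun h ⟨f, hf⟩
  have hli : LinearIndependent ℂ (fun f : T => φ f.1) := by
    rw [Fintype.linearIndependent_iff]
    intro g hg
    by_contra hne
    push Not at hne
    obtain ⟨i0, hi0⟩ := hne
    obtain ⟨i, hi, hmin⟩ := Finset.exists_min_image (Finset.univ.filter fun i : T => g i ≠ 0)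
      (fun i => r i.1) ⟨i0, by simp [hi0]⟩
    have hgi : g i ≠ 0 := by simpa using hi
    apply (memT i.1).1 i.2
    rw [← Finset.add_sum_erase _ _ (Finset.mem_univ i)] at hg
    have h1 : φ i.1 = (-(g i)⁻¹) • ∑ x ∈ Finset.univ.erase i, g x • φ x.1 := by
      rw [add_comm] at hg
      rw [eq_neg_of_add_eq_zero_left hg, smul_neg, neg_smul, neg_neg, smul_smul,
        inv_mul_cancel₀ hgi, one_smul]
    rw [h1]
    refine Submodule.smul_mem _ _ (Submodule.sum_mem _ fun j hj => ?_)
    by_cases hgj : g j = 0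
    · simp [hgj]
    refine Submodule.smul_mem _ _ (Submodule.subset_span ⟨j.1, ?_, rfl⟩)
    have h2 := hmin j (by simp [hgj])
    refine lt_of_le_of_ne h2 fun h3 => ?_
    have := rinj h3
    exact (Finset.ne_of_mem_erase hj) (Subtype.ext this.symm)
  have hcard : T.card = Module.finrank ℂ X := by
    apply le_antisymm
    · have := hli.fintype_card_le_finrank
      rw [Subspace.dual_finrank_eq] at this
      simpa using this
    · have := LinearMap.finrank_le_finrank_of_injective hinj
      simpa using this
  refine ⟨T, M, hcard, hN, fun e f h => rle _ _ (M1 e f h).2, ?_, ?_⟩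
  · refine Set.Subset.antisymm hsub fun x hx => ?_
    have hsurj : Function.Surjective res :=
      (LinearMap.injective_iff_surjective_of_finrank_eq_finrank (by simp [← hcard])).1 hinj
    obtain ⟨y, hy⟩ := hsurj (fun f => x f.1)
    have : x = y.1 := key _ _ hx (hsub y.2) fun f hf => (congrFun hy ⟨f, hf⟩).symm
    rw [this]; exact y.2
  · intro hT f hf
    refine rlt f (lt_of_le_of_ne (M1 _ _ hf).2 fun h => hT ?_)
    rw [rinj h]; exact (M1 _ _ hf).1

def K0 {E : Type} (M : E → E → ℂ) (a : E → ℚ) : E → E → ℂ :=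
  fun e f => if a f = a e then M e f else 0

theorem normal_K0 {E : Type} {T : Finset E} {M : E → E → ℂ} (a : E → ℚ) (h : NormalK T M) :
    NormalK T (K0 M a) := by
  refine ⟨fun e f hf => h.1 e f ?_, fun e he f => ?_⟩
  · intro h0; simp [K0, h0] at hf
  · simp only [K0, h.2 e he f]
    split_ifs with h1 h2 h2 <;> simp_all

theorem InSp_eq {E : Type} [Fintype E] {X : Submodule ℂ (E → ℂ)} {a : E → ℚ} {T : Finset E}
    {M : E → E → ℂ} (hN : NormalK T M) (ha : ∀ e f, M e f ≠ 0 → a e ≤ a f)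
    (hX : (X : Set (E → ℂ)) = SubK M) : InSp X a = SubK (K0 M a) := by
  ext z
  constructor
  · intro hz e
    obtain ⟨x, hx, hx0, hx1⟩ := hz (a e)
    rw [← SetLike.mem_coe, hX] at hx
    rw [← hx1 e rfl, hx e]
    refine Finset.sum_congr rfl fun f _ => ?_
    by_cases h0 : M e f = 0
    · simp [K0, h0]
    · rcases (ha e f h0).lt_or_eq with h | h
      · simp [K0, hx0 f h, h.ne']
      · simp [K0, h.symm, hx1 f h.symm]
  · intro hz α
    let x : E → ℂ := fun e => ∑ f, M e f * (if a f = α then z f else 0)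
    have hxT : ∀ f ∈ T, x f = if a f = α then z f else 0 := by
      intro f hf
      simp only [x, hN.2 f hf, ite_mul, one_mul, zero_mul, Finset.sum_ite_eq', Finset.mem_univ, if_true]
    refine ⟨x, ?_, ?_, ?_⟩
    · rw [← SetLike.mem_coe, hX]
      intro e
      refine Finset.sum_congr rfl fun f _ => ?_
      by_cases h0 : M e f = 0
      · simp [h0]
      · rw [hxT f (hN.1 e f h0)]
    · intro e he
      refine Finset.sum_eq_zero fun f _ => ?_
      by_cases h0 : M e f = 0
      · simp [h0]
      · have : a f ≠ α := (he.trans_le (ha e f h0)).ne'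
        simp [this]
    · intro e he
      rw [hz e]
      refine Finset.sum_congr rfl fun f _ => ?_
      simp only [K0, he]
      split_ifs <;> simp



/-- regularity of the parameter `c` for a pair of limit matrices -/
def RegC {E : Type} [Fintype E] (eb : E) (T1 T2 : Finset E) (Ka La : E → E → ℂ)
    (c : {e : E // e ≠ eb} → ℂ) : Prop :=
  ∀ z0 ∈ SolS (SubK Ka) (SubK La) eb c, ∀ (l : Filter ℕ) (K L : ℕ → E → E → ℂ),
    Tendsto K l (𝓝 Ka) → Tendsto L l (𝓝 La) → (∀ k, NormalK T1 (K k)) → (∀ k, NormalK T2 (L k)) →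
    ∃ s : ℕ → (E → ℂ) × (E → ℂ), Tendsto s l (𝓝 z0) ∧
      (∀ᶠ k in l, s k ∈ SolS (SubK (K k)) (SubK (L k)) eb c) ∧
      ∀ (l' : Filter ℕ) (σ : ℕ → (E → ℂ) × (E → ℂ)), l' ≤ l → Tendsto σ l' (𝓝 z0) →
        (∀ᶠ k in l', σ k ∈ SolS (SubK (K k)) (SubK (L k)) eb c) → ∀ᶠ k in l', σ k = s k

section par
variable {E : Type} [Fintype E] {ι : Type} (eb : E) (T : Finset E)
  (j : {f // f ∈ T.erase eb} → ι)

def parX (K : E → E → ℂ) (w : ι → ℂ) : E → ℂ :=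
  fun e => ∑ f : {f // f ∈ T.erase eb}, K e f.1 * w (j f) + K e eb

theorem sum_split (hT : eb ∈ T) (g : E → ℂ) (hg : ∀ f, f ∉ T → g f = 0) :
    ∑ f, g f = ∑ f : {f // f ∈ T.erase eb}, g f.1 + g eb := by
  rw [← Finset.sum_subset (Finset.subset_univ T) (fun f _ hf => hg f hf),
    ← Finset.sum_erase_add _ _ hT, ← Finset.sum_coe_sort]

theorem parX_T {K : E → E → ℂ} (hK : NormalK T K) (w : ι → ℂ) (f : {f // f ∈ T.erase eb}) :
    parX eb T j K w f.1 = w (j f) := by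
  have hf := Finset.mem_erase.1 f.2
  simp only [parX, hK.2 f.1 hf.2, hf.1.symm, if_false, add_zero]
  rw [Finset.sum_eq_single f]
  · simp
  · intro b _ hb
    have : b.1 ≠ f.1 := fun h => hb (Subtype.ext h)
    simp [this]
  · simp

theorem parX_eb (hT : eb ∈ T) {K : E → E → ℂ} (hK : NormalK T K) (w : ι → ℂ) :
    parX eb T j K w eb = 1 := by
  simp only [parX, hK.2 eb hT, if_true]
  rw [Finset.sum_eq_zero]
  · simp
  · intro f _
    simp [(Finset.mem_erase.1 f.2).1]

theorem parX_mem (hT : eb ∈ T) {K : E → E → ℂ} (hK : NormalK T K) (w : ι → ℂ) :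
    parX eb T j K w ∈ SubK K := by
  intro e
  rw [sum_split eb T hT]
  · simp only [parX_T eb T j hK, parX_eb eb T j hT hK, mul_one]
    rfl
  · intro f hf
    have : K e f = 0 := by by_contra h; exact hf (hK.1 e f h)
    simp [this]

theorem parX_pr (hT : eb ∈ T) {K : E → E → ℂ} (hK : NormalK T K) (w : ι → ℂ) (x : E → ℂ)
    (hx : x ∈ SubK K) (h1 : x eb = 1) (hw : ∀ f, w (j f) = x f.1) : parX eb T j K w = x := by
  ext e
  rw [hx e, sum_split eb T hT]
  · simp only [parX, hw, h1, mul_one]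
  · intro f hf
    have : K e f = 0 := by by_contra h; exact hf (hK.1 e f h)
    simp [this]

end par

theorem regular_ae {E : Type} [Fintype E] (eb : E) (T1 T2 : Finset E) (h1 : eb ∈ T1) (h2 : eb ∈ T2)
    (hcard : T1.card + T2.card = Fintype.card E + 1) (Ka La : E → E → ℂ)
    (hKa : NormalK T1 Ka) (hLa : NormalK T2 La) :
    ∀ᵐ c : {e : E // e ≠ eb} → ℂ, RegC eb T1 T2 Ka La c := by
  have hc : Fintype.card ({f // f ∈ T1.erase eb} ⊕ {f // f ∈ T2.erase eb})
      = Fintype.card {e : E // e ≠ eb} := by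
    have p1 := Finset.card_pos.2 ⟨_, h1⟩
    have p2 := Finset.card_pos.2 ⟨_, h2⟩
    simp only [Fintype.card_sum, Fintype.card_coe, Finset.card_erase_of_mem h1,
      Finset.card_erase_of_mem h2, Fintype.card_subtype_compl, ne_eq, Fintype.card_subtype_eq]
    omega
  let ε := Fintype.equivOfCardEq hc
  let j1 := fun f => ε (Sum.inl f)
  let j2 := fun f => ε (Sum.inr f)
  let pr : (E → ℂ) × (E → ℂ) → ({e : E // e ≠ eb} → ℂ) := fun z i =>
    Sum.elim (fun f => z.1 f.1) (fun f => z.2 f.1) (ε.symm i)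
  have hpr : Continuous pr := by
    refine continuous_pi fun i => ?_
    simp only [pr]
    rcases ε.symm i with f | f <;> simp <;> fun_prop
  have pr1 : ∀ z f, pr z (j1 f) = z.1 f.1 := by intro z f; simp [pr, j1]
  have pr2 : ∀ z f, pr z (j2 f) = z.2 f.1 := by intro z f; simp [pr, j2]
  let par : ((E → E → ℂ) × (E → E → ℂ)) × ({e : E // e ≠ eb} → ℂ) → (E → ℂ) × (E → ℂ) := fun u =>
    (parX eb T1 j1 u.1.1 u.2, parX eb T2 j2 u.1.2 u.2)
  have hparc : Continuous par := by
    refine Continuous.prodMk (continuous_pi fun e => ?_) (continuous_pi fun e => ?_) <;>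
      simp only [parX] <;> fun_prop
  let G : ((E → E → ℂ) × (E → E → ℂ)) × ({e : E // e ≠ eb} → ℂ) → ({e : E // e ≠ eb} → ℂ) :=
    fun u e => parX eb T1 j1 u.1.1 u.2 e.1 * parX eb T2 j2 u.1.2 u.2 e.1
  have hG : ContDiff ℝ 1 G := by
    simp only [G, parX]; fun_prop
  have hsol : ∀ K L c w, NormalK T1 K → NormalK T2 L → G ((K, L), w) = c →
      par ((K, L), w) ∈ SolS (SubK K) (SubK L) eb c := by
    intro K L c w hK hL h
    refine ⟨parX_mem _ _ _ h1 hK _, parX_mem _ _ _ h2 hL _, parX_eb _ _ _ h1 hK _,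
      parX_eb _ _ _ h2 hL _, fun e => ?_⟩
    rw [← h]
  have hback : ∀ K L c z, NormalK T1 K → NormalK T2 L → z ∈ SolS (SubK K) (SubK L) eb c →
      par ((K, L), pr z) = z ∧ G ((K, L), pr z) = c := by
    intro K L c z hK hL hz
    have e1 := parX_pr eb T1 j1 h1 hK (pr z) z.1 hz.1 hz.2.2.1 (pr1 z)
    have e2 := parX_pr eb T2 j2 h2 hL (pr z) z.2 hz.2.1 hz.2.2.2.1 (pr2 z)
    refine ⟨Prod.ext e1 e2, ?_⟩
    ext e
    simp only [G, e1, e2]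
    exact hz.2.2.2.2 e
  have hprpar : ∀ K L w, NormalK T1 K → NormalK T2 L → pr (par ((K, L), w)) = w := by
    intro K L w hK hL
    ext i
    obtain ⟨f, rfl⟩ := ε.surjective i
    rcases f with f | f
    · exact (pr1 _ f).trans (parX_T eb T1 j1 hK w f)
    · exact (pr2 _ f).trans (parX_T eb T2 j2 hL w f)
  have hdiff : Differentiable ℝ (fun w => G ((Ka, La), w)) :=
    (hG.differentiable one_ne_zero).comp (by fun_prop)
  filter_upwards [sard_pi _ hdiff] with c hcs
  intro z0 hz0 l K L tK tL nK nL
  obtain ⟨hz1, hz2⟩ := hback Ka La c z0 hKa hLa hz0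
  let u := ((Ka, La), pr z0)
  have dfu : HasStrictFDerivAt G (fderiv ℝ G u) u :=
    hG.contDiffAt.hasStrictFDerivAt one_ne_zero
  have hcomp : fderiv ℝ (fun w => G ((Ka, La), w)) (pr z0) =
      (fderiv ℝ G u) ∘L .inr ℝ _ _ := by
    have := dfu.hasFDerivAt.comp (pr z0) (hasFDerivAt_prodMk_right (𝕜 := ℝ) (Ka, La) (pr z0))
    exact this.fderiv
  have hinv : ((fderiv ℝ G u) ∘L .inr ℝ _ _).IsInvertible := by
    rw [← hcomp]
    exact ⟨(fderiv ℝ (fun w => G ((Ka, La), w)) (pr z0)).toContinuousLinearEquivOfDetNeZero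
      (hcs _ hz2), by ext; simp⟩
  have ev1 := dfu.eventually_apply_eq_iff_implicitFunctionOfProdDomain hinv
  have ev2 := dfu.eventually_apply_implicitFunctionOfProdDomain hinv
  have ev3 := dfu.tendsto_implicitFunctionOfProdDomain hinv
  set ψ := dfu.implicitFunctionOfProdDomain hinv
  have hGu : G u = c := hz2
  have tκ : Tendsto (fun k => (K k, L k)) l (𝓝 (Ka, La)) := tK.prodMk_nhds tL
  have tψ : Tendsto (fun k => ψ (K k, L k)) l (𝓝 (pr z0)) := ev3.comp tκ
  refine ⟨fun k => par ((K k, L k), ψ (K k, L k)), ?_, ?_, ?_⟩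
  · have := (hparc.tendsto u).comp (tκ.prodMk_nhds tψ)
    rw [hz1] at this
    exact this
  · filter_upwards [tκ.eventually ev2] with k hk
    exact hsol _ _ _ _ (nK k) (nL k) (hk.trans hGu)
  · intro l' σ hl' hσ hev
    have t1 : Tendsto (fun k => ((K k, L k), pr (σ k))) l' (𝓝 u) :=
      (tκ.mono_left hl').prodMk_nhds ((hpr.tendsto z0).comp hσ)
    filter_upwards [t1.eventually ev1, hev] with k hk hk2
    obtain ⟨q1, q2⟩ := hback _ _ _ _ (nK k) (nL k) hk2
    have := hk.1 (q2.trans hGu.symm)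
    rw [this]; exact q1.symm



def Scales {E : Type} (l : Filter ℕ) (a : E → ℚ) (μ : ℕ → E → ℝ) : Prop :=
  (∀ k e, 0 < μ k e) ∧ (∀ e f, a e = a f → ∀ k, μ k e = μ k f) ∧
  ∀ e f, a e < a f → Tendsto (fun k => μ k f / μ k e) l (𝓝 0)

def scaleSet {E : Type} (X : Submodule ℂ (E → ℂ)) (m : E → ℝ) : Set (E → ℂ) :=
  {x | (fun e => (m e : ℂ) * x e) ∈ X}

def KS {E : Type} (M : E → E → ℂ) (m : E → ℝ) : E → E → ℂ :=
  fun e f => M e f * ((m f / m e : ℝ) : ℂ)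

theorem scaleSet_eq {E : Type} [Fintype E] {X : Submodule ℂ (E → ℂ)} {M : E → E → ℂ}
    (hX : (X : Set (E → ℂ)) = SubK M) {m : E → ℝ} (hm : ∀ e, 0 < m e) :
    scaleSet X m = SubK (KS M m) := by
  ext x
  have : x ∈ scaleSet X m ↔ (fun e => (m e : ℂ) * x e) ∈ SubK M := by
    rw [← hX]; rfl
  rw [this]
  refine forall_congr' fun e => ?_
  have h0 : (m e : ℂ) ≠ 0 := by exact_mod_cast (hm e).ne'
  have h1 : ∑ f, M e f * ((m f : ℂ) * x f) = (m e : ℂ) * ∑ f, KS M m e f * x f := by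
    rw [Finset.mul_sum]
    refine Finset.sum_congr rfl fun f _ => ?_
    simp only [KS]; push_cast; field_simp
  simp only [h1]
  exact mul_right_inj' h0

theorem normal_KS {E : Type} {T : Finset E} {M : E → E → ℂ} (h : NormalK T M) {m : E → ℝ}
    (hm : ∀ e, 0 < m e) : NormalK T (KS M m) := by
  refine ⟨fun e f hf => h.1 e f ?_, fun e he f => ?_⟩
  · intro h0; simp [KS, h0] at hf
  · simp only [KS, h.2 e he f]
    split_ifs with h1
    · subst h1; simp [(hm f).ne']
    · simp

theorem tendsto_KS {E : Type} [Fintype E] {M : E → E → ℂ} {a : E → ℚ}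
    (ha : ∀ e f, M e f ≠ 0 → a e ≤ a f) {l : Filter ℕ} {μ : ℕ → E → ℝ} (h : Scales l a μ) :
    Tendsto (fun k => KS M (μ k)) l (𝓝 (K0 M a)) := by
  refine tendsto_pi_nhds.2 fun e => tendsto_pi_nhds.2 fun f => ?_
  by_cases h0 : M e f = 0
  · simp only [KS, K0, h0, zero_mul, ite_self]; exact tendsto_const_nhds
  rcases (ha e f h0).lt_or_eq with h1 | h1
  · simp only [KS, K0, h1.ne', if_false]
    have := (Complex.continuous_ofReal.tendsto 0).comp (h.2.2 e f h1)
    have := this.const_mul (M e f)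
    simpa using this
  · have : ∀ k, KS M (μ k) e f = K0 M a e f := by
      intro k
      simp [KS, K0, h1.symm, h.2.1 e f h1 k, (h.1 k f).ne']
    simp only [this]; exact tendsto_const_nhds

def RegX {E : Type} [Fintype E] (X Y : Submodule ℂ (E → ℂ)) (eb : E) (a b : E → ℚ)
    (c : {e : E // e ≠ eb} → ℂ) : Prop :=
  ∀ z0 ∈ SolS (InSp X a) (InSp Y b) eb c,
    (∀ σ : ℕ → (E → ℂ) × (E → ℂ), Tendsto σ atTop (𝓝 z0) →
      (∀ᶠ k in atTop, σ k ∈ SolS (InSp X a) (InSp Y b) eb c) → ∀ᶠ k in atTop, σ k = z0) ∧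
    ∀ (l : Filter ℕ) (μ ν : ℕ → E → ℝ), Scales l a μ → Scales l b ν →
      ∃ s : ℕ → (E → ℂ) × (E → ℂ), Tendsto s l (𝓝 z0) ∧
      (∀ᶠ k in l, s k ∈ SolS (scaleSet X (μ k)) (scaleSet Y (ν k)) eb c) ∧
      ∀ (l' : Filter ℕ) (σ : ℕ → (E → ℂ) × (E → ℂ)), l' ≤ l → Tendsto σ l' (𝓝 z0) →
        (∀ᶠ k in l', σ k ∈ SolS (scaleSet X (μ k)) (scaleSet Y (ν k)) eb c) →
        ∀ᶠ k in l', σ k = s k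

theorem regX_ae {E : Type} [Fintype E] (X Y : Submodule ℂ (E → ℂ)) (eb : E)
    (hr : Module.finrank ℂ X + Module.finrank ℂ Y = Fintype.card E + 1) (a b : E → ℚ) :
    ∀ᵐ c : {e : E // e ≠ eb} → ℂ, RegX X Y eb a b c := by
  obtain ⟨T1, M, c1, n1, a1, x1, b1⟩ := good_basis X a eb
  obtain ⟨T2, L, c2, n2, a2, x2, b2⟩ := good_basis Y b eb
  have zero : ∀ (T : Finset E) (M : E → E → ℂ) (a : E → ℚ) (z : E → ℂ),
      (∀ f, M eb f ≠ 0 → a eb < a f) → z ∈ SubK (K0 M a) → z eb = 1 → False := by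
    intro T M a z h hz h1
    have := hz eb
    rw [h1, Finset.sum_eq_zero] at this
    · exact one_ne_zero this
    · intro f _
      by_cases h0 : M eb f = 0
      · simp [K0, h0]
      · simp [K0, (h f h0).ne']
  unfold RegX
  rw [InSp_eq n1 a1 x1, InSp_eq n2 a2 x2]
  by_cases h1 : eb ∈ T1
  swap
  · exact Eventually.of_forall fun c z hz => (zero T1 M a _ (b1 h1) hz.1 hz.2.2.1).elim
  by_cases h2 : eb ∈ T2
  swap
  · exact Eventually.of_forall fun c z hz => (zero T2 L b _ (b2 h2) hz.2.1 hz.2.2.2.1).elim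
  filter_upwards [regular_ae eb T1 T2 h1 h2 (by rw [c1, c2, hr]) (K0 M a) (K0 L b)
    (normal_K0 a n1) (normal_K0 b n2)] with c hc z0 hz0
  constructor
  · intro σ hσ hev
    obtain ⟨s, -, -, hs⟩ := hc z0 hz0 atTop (fun _ => K0 M a) (fun _ => K0 L b) tendsto_const_nhds
      tendsto_const_nhds (fun _ => normal_K0 a n1) (fun _ => normal_K0 b n2)
    filter_upwards [hs atTop σ le_rfl hσ hev, hs atTop (fun _ => z0) le_rfl tendsto_const_nhds
      (Eventually.of_forall fun _ => hz0)] with k h3 h4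
    rw [h3, ← h4]
  · intro l μ ν hμ hν
    have := hc z0 hz0 l (fun k => KS M (μ k)) (fun k => KS L (ν k)) (tendsto_KS a1 hμ)
      (tendsto_KS a2 hν) (fun k => normal_KS n1 (hμ.1 k)) (fun k => normal_KS n2 (hν.1 k))
    simp only [scaleSet_eq x1 (hμ.1 _), scaleSet_eq x2 (hν.1 _)]
    exact this

theorem limit_mem {E : Type} [Fintype E] (X : Submodule ℂ (E → ℂ)) (eb : E) (a : E → ℚ)
    (l : Filter ℕ) [l.NeBot] (μ : ℕ → E → ℝ) (hμ : Scales l a μ) (σ : ℕ → E → ℂ) (z : E → ℂ)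
    (hσ : Tendsto σ l (𝓝 z)) (hs : ∀ᶠ k in l, σ k ∈ scaleSet X (μ k)) : z ∈ InSp X a := by
  obtain ⟨T1, M, c1, n1, a1, x1, b1⟩ := good_basis X a eb
  rw [InSp_eq n1 a1 x1]
  intro e
  have t1 := tendsto_KS a1 hμ
  have t2 : Tendsto (fun k => ∑ f, KS M (μ k) e f * σ k f) l (𝓝 (∑ f, K0 M a e f * z f)) := by
    refine tendsto_finsetSum _ fun f _ => ?_
    exact (tendsto_pi_nhds.1 (tendsto_pi_nhds.1 t1 e) f).mul (tendsto_pi_nhds.1 hσ f)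
  refine tendsto_nhds_unique_of_eventuallyEq (tendsto_pi_nhds.1 hσ e) t2 ?_
  filter_upwards [hs] with k hk
  rw [scaleSet_eq x1 (hμ.1 k)] at hk
  exact hk e



def Bd (l : Filter ℕ) (f : ℕ → ℝ) : Prop := ∃ C, ∀ᶠ k in l, |f k| ≤ C

theorem Bd.add {l : Filter ℕ} {f g : ℕ → ℝ} (hf : Bd l f) (hg : Bd l g) :
    Bd l (fun k => f k + g k) := by
  obtain ⟨C, hC⟩ := hf
  obtain ⟨D, hD⟩ := hg
  refine ⟨C + D, ?_⟩
  filter_upwards [hC, hD] with k h1 h2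
  exact (abs_add_le _ _).trans (add_le_add h1 h2)

theorem Bd.neg {l : Filter ℕ} {f : ℕ → ℝ} (hf : Bd l f) : Bd l (fun k => - f k) := by
  obtain ⟨C, hC⟩ := hf
  exact ⟨C, by simpa using hC⟩

theorem Bd.sub {l : Filter ℕ} {f g : ℕ → ℝ} (hf : Bd l f) (hg : Bd l g) :
    Bd l (fun k => f k - g k) := by
  simpa [sub_eq_add_neg] using hf.add hg.neg

theorem bd_const (l : Filter ℕ) (r : ℝ) : Bd l (fun _ => r) := ⟨|r|, by simp⟩

theorem not_bd_top {l : Filter ℕ} [l.NeBot] {f g : ℕ → ℝ} (hf : Tendsto f l atTop)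
    (h : Bd l (fun k => g k - f k)) : Tendsto g l atTop := by
  obtain ⟨C, hC⟩ := h
  rw [tendsto_atTop] at hf ⊢
  intro b
  filter_upwards [hf (b + C), hC] with k h1 h2
  have := abs_le.1 h2
  linarith

theorem bd_tri (U : Ultrafilter ℕ) (f : ℕ → ℝ) :
    Bd U f ∨ Tendsto f U atTop ∨ Tendsto (fun k => - f k) U atTop := by
  by_cases hb : Bd U f
  · exact Or.inl hb
  right
  have h : ∀ C, ∀ᶠ k in (U : Filter ℕ), C < |f k| := by
    intro C
    have : ¬ ∀ᶠ k in (U : Filter ℕ), |f k| ≤ C := fun h => hb ⟨C, h⟩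
    rw [← Ultrafilter.eventually_not] at this
    simpa using this
  rcases (Ultrafilter.eventually_or (f := U) (p := fun k => 0 ≤ f k) (q := fun k => f k ≤ 0)).1
    (Eventually.of_forall fun k => le_total _ _) with h0 | h0
  · left
    rw [tendsto_atTop]
    intro b
    filter_upwards [h b, h0] with k h1 h2
    rw [abs_of_nonneg h2] at h1; exact h1.le
  · right
    rw [tendsto_atTop]
    intro b
    filter_upwards [h b, h0] with k h1 h2
    rw [abs_of_nonpos h2] at h1; exact h1.le

theorem exists_rank {E : Type} [Fintype E] (U : Ultrafilter ℕ) (p : ℕ → E → ℝ) :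
    ∃ a : E → ℚ, (∀ e f, a e = a f → Bd U (fun k => p k e - p k f)) ∧
      ∀ e f, a e < a f → Tendsto (fun k => p k f - p k e) U atTop := by
  let Lt : E → E → Prop := fun e f => Tendsto (fun k => p k f - p k e) U atTop
  have trans : ∀ e f g, Lt e f → Lt f g → Lt e g := by
    intro e f g h1 h2
    have := Tendsto.atTop_add_atTop h1 h2
    refine this.congr fun k => by ring
  have irr : ∀ e, ¬ Lt e e := by
    intro e h
    simp only [Lt, sub_self] at h
    have := (h.eventually (eventually_gt_atTop 0)).exists
    simpa using this
  let a : E → ℚ := fun e => ((Finset.univ.filter fun g => Lt g e).card : ℚ)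
  have mono : ∀ e f, Lt e f → a e < a f := by
    intro e f h
    simp only [a, Nat.cast_lt]
    apply Finset.card_lt_card
    rw [Finset.ssubset_iff_of_subset]
    · exact ⟨e, by simp [h], by simp [irr]⟩
    · intro g hg
      simp only [Finset.mem_filter, Finset.mem_univ, true_and] at hg ⊢
      exact trans _ _ _ hg h
  have mono' : ∀ e f, Bd U (fun k => p k e - p k f) → a e ≤ a f := by
    intro e f h
    simp only [a, Nat.cast_le]
    apply Finset.card_le_card
    intro g hg
    simp only [Finset.mem_filter, Finset.mem_univ, true_and] at hg ⊢
    refine not_bd_top hg ?_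
    convert h.neg using 2 with k
    ring
  refine ⟨a, ?_, ?_⟩
  · intro e f h
    rcases bd_tri U (fun k => p k e - p k f) with h1 | h1 | h1
    · exact h1
    · exact absurd (mono f e h1) (by simp [h])
    · refine absurd (mono e f (h1.congr fun k => by ring)) (by simp [h])
  · intro e f h
    rcases bd_tri U (fun k => p k f - p k e) with h1 | h1 | h1
    · exact absurd (mono' f e h1) (by simpa using h)
    · exact h1
    · exact absurd (mono f e (h1.congr fun k => by ring)) (by simpa using h.le)

theorem correction {A R : Type} [NormedAddCommGroup A] [NormedSpace ℝ A] [FiniteDimensional ℝ A]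
    [NormedAddCommGroup R] [NormedSpace ℝ R] [FiniteDimensional ℝ R] (Lin : A →ₗ[ℝ] R)
    (U : Filter ℕ) [U.NeBot] (hU : U ≤ atTop) (p : ℕ → A) (g : R) (C : ℝ)
    (hC : ∀ᶠ k in U, ‖Lin (p k) - (k : ℝ) • g‖ ≤ C) :
    ∃ p' : ℕ → A, (∀ k, Lin (p' k) = (k : ℝ) • g) ∧ ∃ D, ∀ᶠ k in U, ‖p' k - p k‖ ≤ D := by
  have hg : g ∈ LinearMap.range Lin := by
    have hcl : IsClosed (LinearMap.range Lin : Set R) := Submodule.closed_of_finiteDimensional _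
    have ht : Tendsto (fun k : ℕ => ((k : ℝ)⁻¹) • Lin (p k)) U (𝓝 g) := by
      rw [tendsto_iff_norm_sub_tendsto_zero]
      have h1 : Tendsto (fun k : ℕ => C * ((k : ℝ)⁻¹)) U (𝓝 0) := by
        have := (tendsto_inv_atTop_nhds_zero_nat (𝕜 := ℝ)).const_mul C
        rw [mul_zero] at this
        exact this.mono_left hU
      refine squeeze_zero' (Eventually.of_forall fun _ => norm_nonneg _) ?_ h1
      filter_upwards [hC, hU (eventually_gt_atTop 0)] with k hk hk0
      have hk0' : (0:ℝ) < k := by exact_mod_cast hk0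
      have : (k:ℝ)⁻¹ • Lin (p k) - g = (k:ℝ)⁻¹ • (Lin (p k) - (k:ℝ) • g) := by
        rw [smul_sub, smul_smul, inv_mul_cancel₀ hk0'.ne', one_smul]
      rw [this, norm_smul, Real.norm_of_nonneg (by positivity), mul_comm]
      exact mul_le_mul_of_nonneg_right hk (by positivity)
    exact hcl.mem_of_tendsto ht (Eventually.of_forall fun k =>
      Submodule.smul_mem _ _ (LinearMap.mem_range_self _ _))
  obtain ⟨g0, hg0⟩ := hg
  obtain ⟨S, hS⟩ := Lin.rangeRestrict.exists_rightInverse_of_surjective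
    (LinearMap.range_rangeRestrict _)
  have hS' : ∀ r, Lin (S r) = r.1 := fun r =>
    congrArg Subtype.val (LinearMap.congr_fun hS r)
  let Sc := LinearMap.toContinuousLinearMap S
  refine ⟨fun k => p k - S (Lin.rangeRestrict (p k - (k:ℝ) • g0)), fun k => ?_, ‖Sc‖ * C, ?_⟩
  · rw [map_sub, hS']
    simp [hg0]
  · filter_upwards [hC] with k hk
    have : p k - S (Lin.rangeRestrict (p k - (k:ℝ) • g0)) - p k
      = - Sc (Lin.rangeRestrict (p k - (k:ℝ) • g0)) := by simp [Sc]
    rw [this, norm_neg]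
    refine (Sc.le_opNorm _).trans (mul_le_mul_of_nonneg_left ?_ (norm_nonneg _))
    have : ‖Lin.rangeRestrict (p k - (k:ℝ) • g0)‖ = ‖Lin (p k) - (k:ℝ) • g‖ := by
      rw [← hg0, ← map_smul, ← map_sub]; rfl
    rw [this]; exact hk



theorem Bd.pi {ι : Type} [Fintype ι] {l : Filter ℕ} {f : ℕ → ι → ℝ} (h : ∀ i, Bd l (fun k => f k i)) :
    ∃ C, ∀ᶠ k in l, ‖f k‖ ≤ C := by
  choose C hC using h
  refine ⟨∑ i, |C i|, ?_⟩
  filter_upwards [eventually_all.2 hC] with k hk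
  rw [pi_norm_le_iff_of_nonneg (Finset.sum_nonneg fun i _ => abs_nonneg _)]
  intro i
  rw [Real.norm_eq_abs]
  refine (hk i).trans ((le_abs_self _).trans ?_)
  exact Finset.single_le_sum (f := fun i => |C i|) (fun i _ => abs_nonneg _) (Finset.mem_univ i)

theorem exists_ultra_lim {E : Type} [Fintype E] (U : Ultrafilter ℕ) (f : ℕ → E → ℂ)
    (h : ∃ C, ∀ᶠ k in (U : Filter ℕ), ∀ e, ‖f k e‖ ≤ C) : ∃ z, Tendsto f U (𝓝 z) := by
  obtain ⟨C, hC⟩ := h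
  have hc : IsCompact (Metric.closedBall (0 : E → ℂ) |C|) := isCompact_closedBall _ _
  obtain ⟨z, _, hz⟩ := hc.ultrafilter_le_nhds (U.map f) (by
    rw [le_principal_iff]
    change ∀ᶠ k in (U : Filter ℕ), f k ∈ Metric.closedBall (0 : E → ℂ) |C|
    filter_upwards [hC] with k hk
    rw [mem_closedBall_zero_iff, pi_norm_le_iff_of_nonneg (abs_nonneg _)]
    exact fun e => (hk e).trans (le_abs_self _))
  exact ⟨z, hz⟩

def LinK {E : Type} (eb : E) (a b : E → ℚ) : (E → ℝ) →ₗ[ℝ] (Unit ⊕ (Bool × E × E) → ℝ) where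
  toFun p := Sum.elim (fun _ => p eb) (fun i =>
    if (bif i.1 then a i.2.1 = a i.2.2 else b i.2.1 = b i.2.2) then p i.2.1 - p i.2.2 else 0)
  map_add' p q := by
    funext i
    rcases i with i | i
    · simp
    · simp only [Sum.elim_inr, Pi.add_apply]
      split_ifs
      · ring
      · ring
  map_smul' r p := by
    funext i
    rcases i with i | i
    · simp
    · simp only [Sum.elim_inr, Pi.smul_apply, smul_eq_mul, RingHom.id_apply]
      split_ifs
      · ring
      · ring

theorem scales_exp {E : Type} (l : Filter ℕ) (hl : l ≤ atTop) (a : E → ℚ) :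
    Scales l a (fun k e => Real.exp (-((k:ℝ) * a e))) := by
  refine ⟨fun k e => Real.exp_pos _, fun e f h k => by simp only [h], fun e f h => ?_⟩
  have h' : (0:ℝ) < (a f : ℝ) - a e := by
    have : (a e : ℝ) < a f := by exact_mod_cast h
    linarith
  have : Tendsto (fun k : ℕ => (k:ℝ) * ((a f : ℝ) - a e)) l atTop :=
    (tendsto_natCast_atTop_atTop.mono_left hl).atTop_mul_const h'
  have := Real.tendsto_exp_neg_atTop_nhds_zero.comp this
  refine this.congr fun k => ?_
  simp only [Function.comp]
  rw [← Real.exp_sub]; congr 1; ring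

theorem InSp_scale {E : Type} (X : Submodule ℂ (E → ℂ)) (a : E → ℚ) (s : E → ℂ)
    (hs : ∀ e f, a e = a f → s e = s f) {z : E → ℂ} (hz : z ∈ InSp X a) :
    (fun e => s e * z e) ∈ InSp X a := by
  intro α
  obtain ⟨x, hx, h1, h2⟩ := hz α
  by_cases h : ∃ e, a e = α
  · obtain ⟨e, he⟩ := h
    refine ⟨s e • x, X.smul_mem _ hx, fun f hf => by simp [h1 f hf], fun f hf => ?_⟩
    simp [h2 f hf, hs e f (he.trans hf.symm)]
  · exact ⟨x, hx, h1, fun f hf => absurd ⟨f, hf⟩ h⟩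

theorem compactness {E : Type} [Fintype E] (X Y : Submodule ℂ (E → ℂ)) (eb : E)
    (c : {e : E // e ≠ eb} → ℂ) (hc : ∀ e, c e ≠ 0) (hreg : ∀ a b, RegX X Y eb a b c)
    (w : E → ℚ) (hw : w eb = 0) (U : Ultrafilter ℕ) (hU : (U : Filter ℕ) ≤ atTop)
    (σ : ℕ → (E → ℂ) × (E → ℂ))
    (hσ : ∀ k : ℕ, σ k ∈ SolS (X : Set (E → ℂ)) (Y : Set (E → ℂ)) eb
      (fun e => ((Real.exp (-((k:ℝ) * w e.1)) : ℝ) : ℂ) * c e)) :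
    ∃ a b : E → ℚ, a eb = 0 ∧ b eb = 0 ∧ (∀ e, a e + b e = w e) ∧
      ∃ z0 ∈ SolS (InSp X a) (InSp Y b) eb c,
        Tendsto (fun k : ℕ => ((fun e => ((Real.exp ((k:ℝ) * a e) : ℝ) : ℂ) * (σ k).1 e,
          fun e => ((Real.exp ((k:ℝ) * b e) : ℝ) : ℂ) * (σ k).2 e) : (E → ℂ) × (E → ℂ)))
          U (𝓝 z0) := by
  let ch : E → ℂ := fun e => if h : e = eb then 1 else c ⟨e, h⟩
  have chn : ∀ e, ch e ≠ 0 := by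
    intro e; simp only [ch]; split_ifs
    · exact one_ne_zero
    · exact hc _
  have cheb : ch eb = 1 := by simp [ch]
  have chc : ∀ e : {e // e ≠ eb}, ch e.1 = c e := by
    intro e; simp [ch, e.2]
  have prod : ∀ k e, (σ k).1 e * (σ k).2 e = ((Real.exp (-((k:ℝ) * w e)) : ℝ) : ℂ) * ch e := by
    intro k e
    obtain ⟨-, -, h1, h2, h3⟩ := hσ k
    by_cases h : e = eb
    · subst h; rw [h1, h2, cheb, hw]; simp
    · exact (h3 ⟨e, h⟩).trans (by simp only [← chc])
  have prodn : ∀ k e, (σ k).1 e * (σ k).2 e ≠ 0 := by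
    intro k e; rw [prod]
    exact mul_ne_zero (by exact_mod_cast (Real.exp_pos _).ne') (chn e)
  have xn : ∀ k e, (σ k).1 e ≠ 0 := fun k e => left_ne_zero_of_mul (prodn k e)
  have yn : ∀ k e, (σ k).2 e ≠ 0 := fun k e => right_ne_zero_of_mul (prodn k e)
  let p : ℕ → E → ℝ := fun k e => - Real.log ‖(σ k).1 e‖
  let q : ℕ → E → ℝ := fun k e => - Real.log ‖(σ k).2 e‖
  have pq : ∀ k e, p k e + q k e = k * w e - Real.log ‖ch e‖ := by
    intro k e
    have := congrArg (fun z => Real.log ‖z‖) (prod k e)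
    simp only [norm_mul] at this
    rw [Real.log_mul (by simpa using xn k e) (by simpa using yn k e),
      Real.log_mul (by simp [Complex.exp_ne_zero]) (by simpa using chn e),
      Complex.norm_real, Real.norm_of_nonneg (Real.exp_pos _).le, Real.log_exp] at this
    simp only [p, q]; linarith
  have peb : ∀ k, p k eb = 0 := by
    intro k; obtain ⟨-, -, h1, h2, h3⟩ := hσ k
    simp [p, h1]
  obtain ⟨a0, a1, a2⟩ := exists_rank U p
  obtain ⟨b0, b1, b2⟩ := exists_rank U q
  let g : Unit ⊕ (Bool × E × E) → ℝ := Sum.elim (fun _ => 0) (fun i =>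
    bif i.1 then 0 else if b0 i.2.1 = b0 i.2.2 then (w i.2.1 : ℝ) - w i.2.2 else 0)
  have res : ∀ i, Bd U (fun k => (LinK eb a0 b0 (p k) - (k:ℝ) • g) i) := by
    rintro (i | ⟨_ | _, e, f⟩)
    · simpa [LinK, g, peb] using bd_const U 0
    · by_cases h : b0 e = b0 f
      · have : Bd U (fun k => (Real.log ‖ch f‖ - Real.log ‖ch e‖) - (q k e - q k f)) :=
          (bd_const _ _).sub (b1 e f h)
        convert this using 2 with k
        simp only [LinK, g, Pi.sub_apply, LinearMap.coe_mk, AddHom.coe_mk, Sum.elim_inr, cond_false, h, if_true,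
          LinearMap.sub_apply, LinearMap.proj_apply, Pi.smul_apply, smul_eq_mul]
        have h1 := pq k e
        have h2 := pq k f
        linarith
      · simpa [LinK, g, h] using bd_const U 0
    · by_cases h : a0 e = a0 f
      · simpa [LinK, g, h] using a1 e f h
      · simpa [LinK, g, h] using bd_const U 0
  obtain ⟨C, hC⟩ := Bd.pi res
  obtain ⟨p', hp', D, hD⟩ := correction (LinK eb a0 b0) U hU p g C hC
  have e1 : ∀ k, p' k eb = 0 := by
    intro k
    have := congrFun (hp' k) (Sum.inl ())
    simpa [LinK, g] using this
  have e2 : ∀ e f, a0 e = a0 f → ∀ k, p' k e = p' k f := by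
    intro e f h k
    have := congrFun (hp' k) (Sum.inr (true, e, f))
    simp [LinK, g, h] at this
    linarith
  have e3 : ∀ e f, b0 e = b0 f → ∀ k, p' k e - p' k f = k * (w e - w f) := by
    intro e f h k
    have := congrFun (hp' k) (Sum.inr (false, e, f))
    simpa [LinK, g, h] using this
  have hD' : ∀ e, Bd U (fun k => p' k e - p k e) := by
    intro e
    refine ⟨D, ?_⟩
    filter_upwards [hD] with k hk
    exact (norm_le_pi_norm (p' k - p k) e).trans hk
  let q' : ℕ → E → ℝ := fun k e => k * w e - p' k e
  have hD2 : ∀ e, Bd U (fun k => q' k e - q k e) := by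
    intro e
    have := (hD' e).neg.sub (bd_const U (-Real.log ‖ch e‖))
    convert this using 2 with k
    have := pq k e
    simp only [q']; linarith
  let μ : ℕ → E → ℝ := fun k e => Real.exp (- p' k e)
  let ν : ℕ → E → ℝ := fun k e => Real.exp (- q' k e)
  have scal : ∀ (r r' : ℕ → E → ℝ), (∀ e, Bd U (fun k => r' k e - r k e)) → ∀ a : E → ℚ,
      (∀ e f, a e < a f → Tendsto (fun k => r k f - r k e) U atTop) →
      (∀ e f, a e = a f → ∀ k, r' k e = r' k f) →
      Scales U a (fun k e => Real.exp (- r' k e)) := by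
    intro r r' h a h1 h2
    refine ⟨fun k e => Real.exp_pos _, fun e f h k => by simp only [h2 e f h k], fun e f hef => ?_⟩
    have t : Tendsto (fun k => r' k f - r' k e) U atTop := by
      refine not_bd_top (h1 e f hef) ?_
      convert (h f).sub (h e) using 2 with k
      ring
    refine (Real.tendsto_exp_neg_atTop_nhds_zero.comp t).congr fun k => ?_
    simp only [Function.comp]
    rw [← Real.exp_sub]; congr 1; ring
  have sμ : Scales U a0 μ := scal p p' hD' a0 a2 e2
  have sν : Scales U b0 ν := scal q q' hD2 b0 b2 (fun e f h k => by
    have := e3 e f h k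
    simp only [q']; linarith)
  -- rescaled
  let xs : ℕ → E → ℂ := fun k e => ((Real.exp (p' k e) : ℝ) : ℂ) * (σ k).1 e
  let ys : ℕ → E → ℂ := fun k e => ((Real.exp (q' k e) : ℝ) : ℂ) * (σ k).2 e
  have bdd : ∀ (r' : ℕ → E → ℝ) (s : ℕ → E → ℂ), (∀ k e, s k e ≠ 0) →
      (∀ e, Bd U (fun k => r' k e - - Real.log ‖s k e‖)) →
      ∃ z, Tendsto (fun k e => ((Real.exp (r' k e) : ℝ) : ℂ) * s k e) U (𝓝 z) := by
    intro r' s hs h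
    apply exists_ultra_lim
    obtain ⟨C, hC⟩ := Bd.pi (f := fun k e => r' k e - - Real.log ‖s k e‖) h
    refine ⟨Real.exp C, ?_⟩
    filter_upwards [hC] with k hk e
    have h1 := (norm_le_pi_norm (fun e => r' k e - - Real.log ‖s k e‖) e).trans hk
    rw [Real.norm_eq_abs] at h1
    have h2 := (abs_le.1 h1).2
    rw [norm_mul, Complex.norm_real, Real.norm_of_nonneg (Real.exp_pos _).le]
    have h3 : ‖s k e‖ = Real.exp (Real.log ‖s k e‖) := (Real.exp_log (by simpa using hs k e)).symm
    rw [h3, ← Real.exp_add]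
    apply Real.exp_le_exp.2
    linarith
  obtain ⟨z1, hz1⟩ := bdd p' (fun k => (σ k).1) xn hD'
  obtain ⟨z2, hz2⟩ := bdd q' (fun k => (σ k).2) yn hD2
  have cast1 : ∀ (r : ℝ) (z : ℂ), ((Real.exp (-r) : ℝ) : ℂ) * (((Real.exp r : ℝ) : ℂ) * z) = z := by
    intro r z
    rw [← mul_assoc, ← Complex.ofReal_mul, ← Real.exp_add]; simp
  have hx : ∀ k, (fun e => ((Real.exp (p' k e) : ℝ) : ℂ) * (σ k).1 e) ∈ scaleSet X (μ k) := by
    intro k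
    simp only [scaleSet, Set.mem_setOf_eq, μ, cast1]
    exact (hσ k).1
  have hy : ∀ k, (fun e => ((Real.exp (q' k e) : ℝ) : ℂ) * (σ k).2 e) ∈ scaleSet Y (ν k) := by
    intro k
    simp only [scaleSet, Set.mem_setOf_eq, ν, cast1]
    exact (hσ k).2.1
  have zp : ∀ e, z1 e * z2 e = ch e := by
    intro e
    have t := (tendsto_pi_nhds.1 hz1 e).mul (tendsto_pi_nhds.1 hz2 e)
    refine tendsto_nhds_unique_of_eventuallyEq t tendsto_const_nhds (Eventually.of_forall fun k => ?_)
    simp only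
    rw [mul_mul_mul_comm, prod, ← mul_assoc, ← Complex.ofReal_mul, ← Complex.ofReal_mul,
      ← Real.exp_add, ← Real.exp_add]
    have : p' k e + q' k e + -(k * w e) = 0 := by simp only [q']; ring
    rw [this]; simp
  have z1e : z1 eb = 1 := by
    refine tendsto_nhds_unique_of_eventuallyEq (tendsto_pi_nhds.1 hz1 eb) tendsto_const_nhds
      (Eventually.of_forall fun k => ?_)
    simp [e1, (hσ k).2.2.1]
  have z2e : z2 eb = 1 := by
    have := zp eb
    rwa [z1e, one_mul, cheb] at this
  have z1n : ∀ e, z1 e ≠ 0 := fun e => left_ne_zero_of_mul (by rw [zp]; exact chn e)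
  have m1 := limit_mem X eb a0 U μ sμ _ z1 hz1 (Eventually.of_forall hx)
  have m2 := limit_mem Y eb b0 U ν sν _ z2 hz2 (Eventually.of_forall hy)
  -- rationality
  have rat : ∀ e, ∃ r : ℚ, ∀ k : ℕ, p' k e = k * r := by
    let S : E → Prop := fun e => ∃ r : ℚ, ∀ k : ℕ, p' k e = k * r
    let δ : E → ℝ := fun e => if S e then 0 else 1
    have Seb : S eb := ⟨0, fun k => by simp [e1]⟩
    have Sa : ∀ e f, a0 e = a0 f → S e → S f := by
      rintro e f h ⟨r, hr⟩
      exact ⟨r, fun k => by rw [← e2 e f h, hr]⟩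
    have Sb : ∀ e f, b0 e = b0 f → S e → S f := by
      rintro e f h ⟨r, hr⟩
      refine ⟨r - (w e - w f), fun k => ?_⟩
      have := e3 e f h k
      rw [hr] at this
      push_cast; linarith
    have δa : ∀ e f, a0 e = a0 f → δ e = δ f := by
      intro e f h
      have : S e ↔ S f := ⟨Sa e f h, Sa f e h.symm⟩
      simp only [δ, this]
    have δb : ∀ e f, b0 e = b0 f → δ e = δ f := by
      intro e f h
      have : S e ↔ S f := ⟨Sb e f h, Sb f e h.symm⟩
      simp only [δ, this]
    have sol : ∀ t : ℝ, ((fun e => ((Real.exp (δ e * t) : ℝ) : ℂ) * z1 e,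
        fun e => ((Real.exp (-(δ e * t)) : ℝ) : ℂ) * z2 e) : (E → ℂ) × (E → ℂ)) ∈
        SolS (InSp X a0) (InSp Y b0) eb c := by
      intro t
      refine ⟨InSp_scale X a0 (fun e => ((Real.exp (δ e * t) : ℝ) : ℂ))
        (fun e f h => by simp only [δa e f h]) m1,
        InSp_scale Y b0 (fun e => ((Real.exp (-(δ e * t)) : ℝ) : ℂ))
        (fun e f h => by simp only [δb e f h]) m2, ?_, ?_, ?_⟩
      · simp [δ, Seb, z1e]
      · simp [δ, Seb, z2e]
      · intro e
        simp only
        rw [mul_mul_mul_comm, zp, ← Complex.ofReal_mul, ← Real.exp_add, chc]; simp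
    have sol0 : (z1, z2) ∈ SolS (InSp X a0) (InSp Y b0) eb c := by
      have := sol 0; simpa using this
    have h1 := (hreg a0 b0 (z1, z2) sol0).1 (fun n : ℕ =>
      (fun e => ((Real.exp (δ e * (1 / ((n:ℝ) + 1))) : ℝ) : ℂ) * z1 e,
        fun e => ((Real.exp (-(δ e * (1 / ((n:ℝ) + 1)))) : ℝ) : ℂ) * z2 e)) (by
        have cont : Continuous (fun t : ℝ => ((fun e => ((Real.exp (δ e * t) : ℝ) : ℂ) * z1 e,
          fun e => ((Real.exp (-(δ e * t)) : ℝ) : ℂ) * z2 e) : (E → ℂ) × (E → ℂ))) := by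
          refine Continuous.prodMk (continuous_pi fun e => ?_) (continuous_pi fun e => ?_)
          · exact (Complex.continuous_ofReal.comp (by fun_prop)).mul continuous_const
          · exact (Complex.continuous_ofReal.comp (by fun_prop)).mul continuous_const
        have := (cont.tendsto 0).comp (tendsto_one_div_add_atTop_nhds_zero_nat (𝕜 := ℝ))
        simp only [mul_zero, neg_zero, Real.exp_zero, Complex.ofReal_one, one_mul] at this
        exact this) (Eventually.of_forall fun n => sol _)
    obtain ⟨n, hn⟩ := h1.exists
    intro e
    by_contra hne
    have hδ : δ e = 1 := by simp only [δ]; exact if_neg hne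
    have := congrFun (congrArg Prod.fst hn) e
    simp only [hδ, one_mul] at this
    have h3 : ((Real.exp (1 / ((n:ℝ) + 1)) : ℝ) : ℂ) = 1 := by
      exact mul_right_cancel₀ (z1n e) (this.trans (one_mul _).symm)
    have h4 : Real.exp (1 / ((n:ℝ) + 1)) = 1 := by exact_mod_cast h3
    rw [Real.exp_eq_one_iff] at h4
    have : (0:ℝ) < 1 / ((n:ℝ) + 1) := by positivity
    linarith
  choose r hr using rat
  have hq : ∀ k e, q' k e = k * ((w e - r e : ℚ) : ℝ) := by
    intro k e; simp only [q', hr]; push_cast; ring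
  have rU : U.NeBot := U.neBot
  have reb : r eb = 0 := by
    have := (hr eb 1).symm.trans (e1 1)
    simpa using this
  refine ⟨r, fun e => w e - r e, reb, by simp [hw, reb], fun e => by ring, (z1, z2),
    ⟨?_, ?_, z1e, z2e, fun e => (zp e.1).trans (chc e)⟩, ?_⟩
  · refine limit_mem X eb r U _ (scales_exp U hU r) _ z1 hz1 (Eventually.of_forall fun k => ?_)
    have := hx k
    simp only [μ, hr] at this ⊢
    exact this
  · refine limit_mem Y eb _ U _ (scales_exp U hU (fun e => w e - r e)) _ z2 hz2
      (Eventually.of_forall fun k => ?_)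
    have := hy k
    simp only [ν, hq] at this ⊢
    exact this
  · refine Tendsto.prodMk_nhds ?_ ?_
    · refine hz1.congr fun k => ?_
      funext e; rw [hr]
    · refine hz2.congr fun k => ?_
      funext e; rw [hq]



def DSet {E : Type} (eb : E) (w : E → ℚ) : Set ((E → ℚ) × (E → ℚ)) :=
  {d | d.1 eb = 0 ∧ d.2 eb = 0 ∧ ∀ e, d.1 e + d.2 e = w e}

def OmS {E : Type} (X Y : Submodule ℂ (E → ℂ)) (eb : E) (w : E → ℚ) (c : {e : E // e ≠ eb} → ℂ) :
    Set (((E → ℚ) × (E → ℚ)) × ((E → ℂ) × (E → ℂ))) :=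
  {o | o.1 ∈ DSet eb w ∧ o.2 ∈ SolS (InSp X o.1.1) (InSp Y o.1.2) eb c}

def unsc {E : Type} (d : (E → ℚ) × (E → ℚ)) (k : ℕ) (s : (E → ℂ) × (E → ℂ)) :
    (E → ℂ) × (E → ℂ) :=
  (fun e => ((Real.exp (-((k:ℝ) * d.1 e)) : ℝ) : ℂ) * s.1 e,
   fun e => ((Real.exp (-((k:ℝ) * d.2 e)) : ℝ) : ℂ) * s.2 e)

def lamk {E : Type} {eb : E} (w : E → ℚ) (c : {e : E // e ≠ eb} → ℂ) (k : ℕ) :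
    {e : E // e ≠ eb} → ℂ := fun e => ((Real.exp (-((k:ℝ) * w e.1)) : ℝ) : ℂ) * c e

theorem unsc_mem {E : Type} {X Y : Submodule ℂ (E → ℂ)} {eb : E} {w : E → ℚ}
    {c : {e : E // e ≠ eb} → ℂ} {d : (E → ℚ) × (E → ℚ)} (hd : d ∈ DSet eb w) (k : ℕ)
    (s : (E → ℂ) × (E → ℂ)) :
    unsc d k s ∈ SolS (X : Set (E → ℂ)) (Y : Set (E → ℂ)) eb (lamk w c k) ↔
    s ∈ SolS (scaleSet X (fun e => Real.exp (-((k:ℝ) * d.1 e))))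
      (scaleSet Y (fun e => Real.exp (-((k:ℝ) * d.2 e)))) eb c := by
  obtain ⟨h1, h2, h3⟩ := hd
  refine and_congr Iff.rfl (and_congr Iff.rfl (and_congr ?_ (and_congr ?_ (forall_congr' fun e => ?_))))
  · simp [unsc, h1]
  · simp [unsc, h2]
  · simp only [unsc, lamk]
    rw [mul_mul_mul_comm, ← Complex.ofReal_mul, ← Real.exp_add]
    have : -((k:ℝ) * d.1 e.1) + -((k:ℝ) * d.2 e.1) = -((k:ℝ) * w e.1) := by
      rw [← h3]; push_cast; ring
    rw [this]
    exact mul_right_inj' (by exact_mod_cast (Real.exp_pos _).ne')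

theorem sol_ne {E : Type} {A B : Set (E → ℂ)} {eb : E} {c : {e : E // e ≠ eb} → ℂ}
    (hc : ∀ e, c e ≠ 0) {z : (E → ℂ) × (E → ℂ)} (hz : z ∈ SolS A B eb c) (e : E) :
    z.1 e ≠ 0 ∧ z.2 e ≠ 0 := by
  obtain ⟨-, -, h1, h2, h3⟩ := hz
  by_cases h : e = eb
  · subst h; simp [h1, h2]
  · have := h3 ⟨e, h⟩
    refine ⟨left_ne_zero_of_mul (b := z.2 e) ?_, right_ne_zero_of_mul (a := z.1 e) ?_⟩ <;>
    · have h4 : z.1 e * z.2 e = c ⟨e, h⟩ := this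
      rw [h4]; exact hc _

theorem unsc_inj {E : Type} (d : (E → ℚ) × (E → ℚ)) (k : ℕ) : Function.Injective (unsc d k) := by
  intro s t h
  have h1 := congrArg Prod.fst h
  have h2 := congrArg Prod.snd h
  refine Prod.ext (funext fun e => ?_) (funext fun e => ?_)
  · exact mul_left_cancel₀ (by exact_mod_cast (Real.exp_pos _).ne') (congrFun h1 e)
  · exact mul_left_cancel₀ (by exact_mod_cast (Real.exp_pos _).ne') (congrFun h2 e)

theorem unsc_sep {E : Type} {d d' : (E → ℚ) × (E → ℚ)} {e : E} (h : d.1 e < d'.1 e)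
    {s s' : ℕ → (E → ℂ) × (E → ℂ)} {z z' : (E → ℂ) × (E → ℂ)} (hs : Tendsto s atTop (𝓝 z))
    (hs' : Tendsto s' atTop (𝓝 z')) (hz : z.1 e ≠ 0) :
    ∀ᶠ k in atTop, unsc d k (s k) ≠ unsc d' k (s' k) := by
  have t1 : Tendsto (fun k => (s k).1 e) atTop (𝓝 (z.1 e)) :=
    tendsto_pi_nhds.1 (((continuous_fst.tendsto z)).comp hs) e
  have t2 : Tendsto (fun k => (s' k).1 e) atTop (𝓝 (z'.1 e)) :=
    tendsto_pi_nhds.1 (((continuous_fst.tendsto z')).comp hs') e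
  have h' : (0:ℝ) < (d'.1 e : ℝ) - d.1 e := by
    have : (d.1 e : ℝ) < d'.1 e := by exact_mod_cast h
    linarith
  have t3 : Tendsto (fun k : ℕ => (k:ℝ) * ((d'.1 e : ℝ) - d.1 e)) atTop atTop :=
    (tendsto_natCast_atTop_atTop).atTop_mul_const h'
  have t4 := Real.tendsto_exp_neg_atTop_nhds_zero.comp t3
  have t5 := ((Complex.continuous_ofReal.tendsto 0).comp t4).mul t2
  simp only [Complex.ofReal_zero, zero_mul] at t5
  have t6 := (t1.sub t5)
  rw [sub_zero] at t6
  filter_upwards [t6.eventually_ne hz] with k hk heq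
  apply hk
  have h1 : ((Real.exp (-((k:ℝ) * d.1 e)) : ℝ) : ℂ) * (s k).1 e
    = ((Real.exp (-((k:ℝ) * d'.1 e)) : ℝ) : ℂ) * (s' k).1 e :=
    congrFun (congrArg Prod.fst heq) e
  rw [sub_eq_zero]
  refine mul_left_cancel₀ (a := ((Real.exp (-((k:ℝ) * d.1 e)) : ℝ) : ℂ))
    (by exact_mod_cast (Real.exp_pos _).ne') (h1.trans ?_)
  simp only [Function.comp]
  rw [← mul_assoc, ← Complex.ofReal_mul, ← Real.exp_add]
  congr 3; ring

theorem core_count {E : Type} [Fintype E] (X Y : Submodule ℂ (E → ℂ)) (eb : E)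
    (c : {e : E // e ≠ eb} → ℂ) (hc : ∀ e, c e ≠ 0) (hreg : ∀ a b, RegX X Y eb a b c)
    (w : E → ℚ) (hw : w eb = 0) (N : ℕ)
    (hN : ∀ k, (SolS (X : Set (E → ℂ)) (Y : Set (E → ℂ)) eb (lamk w c k)).Finite ∧
      (SolS (X : Set (E → ℂ)) (Y : Set (E → ℂ)) eb (lamk w c k)).ncard = N) :
    (OmS X Y eb w c).Finite ∧ (OmS X Y eb w c).ncard = N := by
  have key : ∀ o ∈ OmS X Y eb w c, ∃ s : ℕ → (E → ℂ) × (E → ℂ), Tendsto s atTop (𝓝 o.2) ∧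
      (∀ᶠ k : ℕ in atTop, s k ∈ SolS (scaleSet X (fun e => Real.exp (-((k:ℝ) * o.1.1 e))))
        (scaleSet Y (fun e => Real.exp (-((k:ℝ) * o.1.2 e)))) eb c) ∧
      ∀ (l' : Filter ℕ) (σ : ℕ → (E → ℂ) × (E → ℂ)), l' ≤ atTop → Tendsto σ l' (𝓝 o.2) →
        (∀ᶠ k : ℕ in l', σ k ∈ SolS (scaleSet X (fun e => Real.exp (-((k:ℝ) * o.1.1 e))))
        (scaleSet Y (fun e => Real.exp (-((k:ℝ) * o.1.2 e)))) eb c) →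
        ∀ᶠ k in l', σ k = s k := by
    intro o ho
    exact (hreg o.1.1 o.1.2 o.2 ho.2).2 atTop _ _ (scales_exp _ le_rfl _) (scales_exp _ le_rfl _)
  choose! s hs1 hs2 hs3 using key
  have sep : ∀ o ∈ OmS X Y eb w c, ∀ o' ∈ OmS X Y eb w c, o ≠ o' →
      ∀ᶠ k in atTop, unsc o.1 k (s o k) ≠ unsc o'.1 k (s o' k) := by
    intro o ho o' ho' hne
    by_cases hd : o.1 = o'.1
    · have hz : o.2 - o'.2 ≠ 0 := fun h => hne (Prod.ext hd (sub_eq_zero.1 h))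
      filter_upwards [((hs1 o ho).sub (hs1 o' ho')).eventually_ne hz] with k hk h
      rw [hd] at h
      exact hk (sub_eq_zero.2 (unsc_inj _ _ h))
    · have : ∃ e, o.1.1 e ≠ o'.1.1 e := by
        by_contra hcon
        push Not at hcon
        apply hd
        refine Prod.ext (funext hcon) (funext fun e => ?_)
        have h1 := ho.1.2.2 e
        have h2 := ho'.1.2.2 e
        rw [hcon e] at h1
        linarith
      obtain ⟨e, he⟩ := this
      rcases lt_or_gt_of_ne he with h | h
      · exact unsc_sep h (hs1 o ho) (hs1 o' ho') (sol_ne hc ho.2 e).1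
      · filter_upwards [unsc_sep h (hs1 o' ho') (hs1 o ho) (sol_ne hc ho'.2 e).1] with k hk h
        exact hk h.symm
  have fin : ∀ F : Finset (((E → ℚ) × (E → ℚ)) × ((E → ℂ) × (E → ℂ))),
      (F : Set _) ⊆ OmS X Y eb w c → F.card ≤ N := by
    intro F hF
    have h1 : ∀ᶠ k in atTop, ∀ o ∈ F, ∀ o' ∈ F, o ≠ o' →
        unsc o.1 k (s o k) ≠ unsc o'.1 k (s o' k) := by
      rw [Filter.eventually_all_finset]
      intro o ho
      rw [Filter.eventually_all_finset]
      intro o' ho'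
      by_cases h : o = o'
      · exact Eventually.of_forall fun k h' => absurd h h'
      · filter_upwards [sep o (hF ho) o' (hF ho') h] with k hk _ using hk
    have h2 : ∀ᶠ k in atTop, ∀ o ∈ F, unsc o.1 k (s o k) ∈
        SolS (X : Set (E → ℂ)) (Y : Set (E → ℂ)) eb (lamk w c k) := by
      rw [Filter.eventually_all_finset]
      intro o ho
      filter_upwards [hs2 o (hF ho)] with k hk
      exact (unsc_mem (hF ho).1 k _).2 hk
    obtain ⟨k, hk1, hk2⟩ := (h1.and h2).exists
    rw [← (hN k).2, ← Set.ncard_coe_finset]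
    refine Set.ncard_le_ncard_of_injOn (fun o => unsc o.1 k (s o k)) (fun o ho => hk2 o ho) ?_ (hN k).1
    intro o ho o' ho' h
    by_contra hne
    exact hk1 o ho o' ho' hne h
  have hfin : (OmS X Y eb w c).Finite := by
    by_contra hinf
    obtain ⟨F, hF, hcard⟩ := (show (OmS X Y eb w c).Infinite from hinf).exists_subset_card_eq (N + 1)
    have := fin F hF
    omega
  refine ⟨hfin, le_antisymm ?_ ?_⟩
  · rw [Set.ncard_eq_toFinset_card _ hfin]
    exact fin _ (by simp)
  · by_contra hlt
    push Not at hlt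
    have miss : ∀ k, ∃ t ∈ SolS (X : Set (E → ℂ)) (Y : Set (E → ℂ)) eb (lamk w c k),
        t ∉ (fun o => unsc o.1 k (s o k)) '' OmS X Y eb w c := by
      intro k
      refine Set.exists_mem_notMem_of_ncard_lt_ncard ?_ (hfin.image _)
      rw [(hN k).2]
      exact (Set.ncard_image_le hfin).trans_lt hlt
    choose σ hσ1 hσ2 using miss
    have hU : ((hyperfilter ℕ : Ultrafilter ℕ) : Filter ℕ) ≤ atTop := Nat.hyperfilter_le_atTop
    obtain ⟨a, b, ha, hb, hab, z0, hz0, ht⟩ :=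
      compactness X Y eb c hc hreg w hw (hyperfilter ℕ) hU σ hσ1
    have hd : (a, b) ∈ DSet eb w := ⟨ha, hb, hab⟩
    have ho : ((a, b), z0) ∈ OmS X Y eb w c := ⟨hd, hz0⟩
    have hun : ∀ k, unsc (a, b) k ((fun e => ((Real.exp ((k:ℝ) * a e) : ℝ) : ℂ) * (σ k).1 e,
          fun e => ((Real.exp ((k:ℝ) * b e) : ℝ) : ℂ) * (σ k).2 e)) = σ k := by
      intro k
      refine Prod.ext (funext fun e => ?_) (funext fun e => ?_)
      · simp only [unsc]; rw [← mul_assoc, ← Complex.ofReal_mul, ← Real.exp_add]; simp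
      · simp only [unsc]; rw [← mul_assoc, ← Complex.ofReal_mul, ← Real.exp_add]; simp
    have := hs3 _ ho _ _ hU ht (Eventually.of_forall fun k => (unsc_mem hd k _).1 (by
      rw [hun]; exact hσ1 k))
    obtain ⟨k, hk⟩ := this.exists
    refine hσ2 k ⟨_, ho, ?_⟩
    simp only
    rw [← hk, hun]

theorem abstract_count {E : Type} [Fintype E] (X Y : Submodule ℂ (E → ℂ)) (eb : E)
    (hr : Module.finrank ℂ X + Module.finrank ℂ Y = Fintype.card E + 1)
    (w : E → ℚ) (hw : w eb = 0) (N : ℕ)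
    (hN : ∀ᵐ c : {e : E // e ≠ eb} → ℂ,
      (SolS (X : Set (E → ℂ)) (Y : Set (E → ℂ)) eb c).Finite ∧
      (SolS (X : Set (E → ℂ)) (Y : Set (E → ℂ)) eb c).ncard = N)
    (Lf : (E → ℚ) × (E → ℚ) → ℕ)
    (hL : ∀ d ∈ DSet eb w, ∀ᵐ c : {e : E // e ≠ eb} → ℂ,
      (SolS (InSp X d.1) (InSp Y d.2) eb c).Finite ∧
      (SolS (InSp X d.1) (InSp Y d.2) eb c).ncard = Lf d) :
    {d | d ∈ DSet eb w ∧ Lf d ≠ 0}.Finite ∧ N = ∑ᶠ d ∈ DSet eb w, Lf d := by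
  have c1 : ∀ᵐ c : {e : E // e ≠ eb} → ℂ, ∀ e, c e ≠ 0 := by
    rw [ae_all_iff]
    intro e
    have := poly_null (P := (MvPolynomial.X e : MvPolynomial {e : E // e ≠ eb} ℂ))
      (MvPolynomial.X_ne_zero e)
    simpa using this
  have c2 : ∀ᵐ c : {e : E // e ≠ eb} → ℂ, ∀ a b, RegX X Y eb a b c := by
    rw [ae_all_iff]; intro a
    rw [ae_all_iff]; intro b
    exact regX_ae X Y eb hr a b
  have c3 : ∀ᵐ c : {e : E // e ≠ eb} → ℂ, ∀ k,
      (SolS (X : Set (E → ℂ)) (Y : Set (E → ℂ)) eb (lamk w c k)).Finite ∧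
      (SolS (X : Set (E → ℂ)) (Y : Set (E → ℂ)) eb (lamk w c k)).ncard = N := by
    rw [ae_all_iff]; intro k
    exact ae_scale (fun e : {e : E // e ≠ eb} => Real.exp (-((k:ℝ) * w e.1)))
      (fun e => (Real.exp_pos _).ne') hN
  have c4 : ∀ᵐ c : {e : E // e ≠ eb} → ℂ, ∀ d : (E → ℚ) × (E → ℚ), d ∈ DSet eb w →
      (SolS (InSp X d.1) (InSp Y d.2) eb c).Finite ∧
      (SolS (InSp X d.1) (InSp Y d.2) eb c).ncard = Lf d := by
    rw [ae_all_iff]; intro d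
    by_cases hd : d ∈ DSet eb w
    · filter_upwards [hL d hd] with c hc _ using hc
    · exact Eventually.of_forall fun c h => absurd h hd
  obtain ⟨c, ⟨h1, h2⟩, h3, h4⟩ := ((c1.and c2).and (c3.and c4)).exists
  obtain ⟨hfin, hcard⟩ := core_count X Y eb c h1 h2 w hw N h3
  have sub : {d | d ∈ DSet eb w ∧ Lf d ≠ 0} ⊆ Prod.fst '' OmS X Y eb w c := by
    rintro d ⟨hd, hne⟩
    have h5 := h4 d hd
    rw [← h5.2] at hne
    obtain ⟨z, hz⟩ := Set.nonempty_of_ncard_ne_zero hne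
    exact ⟨(d, z), ⟨hd, hz⟩, rfl⟩
  refine ⟨(hfin.image _).subset sub, ?_⟩
  let T := hfin.toFinset
  have e1 : ∑ᶠ d ∈ DSet eb w, Lf d = ∑ d ∈ T.image Prod.fst, Lf d := by
    apply finsum_mem_eq_sum_of_inter_support_eq
    ext d
    simp only [Set.mem_inter_iff, Function.mem_support, Finset.coe_image, T, Set.Finite.coe_toFinset]
    constructor
    · rintro ⟨hd, hne⟩; exact ⟨sub ⟨hd, hne⟩, hne⟩
    · rintro ⟨⟨o, ho, rfl⟩, hne⟩; exact ⟨ho.1, hne⟩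
  rw [e1, ← hcard, Set.ncard_eq_toFinset_card _ hfin,
    Finset.card_eq_sum_card_fiberwise (f := Prod.fst) (t := T.image Prod.fst)
      (fun o ho => by exact Finset.mem_coe.2 (Finset.mem_image_of_mem _ ho))]
  refine Finset.sum_congr rfl fun d hd => ?_
  obtain ⟨o, ho, rfl⟩ := Finset.mem_image.1 hd
  have hd : o.1 ∈ DSet eb w := ((Set.Finite.mem_toFinset _).1 ho).1
  rw [← (h4 o.1 hd).2, ← Set.ncard_coe_finset]
  rw [← Set.ncard_image_of_injective (SolS (InSp X o.1.1) (InSp Y o.1.2) eb c)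
    (Prod.mk_right_injective o.1)]
  congr 1
  ext o'
  simp only [Finset.coe_filter, Set.Finite.mem_toFinset, Set.mem_image]
  constructor
  · rintro ⟨h5, h6⟩
    refine ⟨o'.2, ?_, Prod.ext h6.symm rfl⟩
    have := h5.2
    rwa [h6] at this
  · rintro ⟨z, hz, rfl⟩
    exact ⟨⟨hd, hz⟩, rfl⟩



def potMap {V E : Type} (f s : E → V) : (V → ℂ) →ₗ[ℂ] (E → ℂ) where
  toFun h := fun e => h (f e) - h (s e)
  map_add' h g := by funext e; simp only [Pi.add_apply]; ring
  map_smul' r h := by funext e; simp only [Pi.smul_apply, smul_eq_mul, RingHom.id_apply]; ring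

def potSp {V E : Type} (f s : E → V) : Submodule ℂ (E → ℂ) := LinearMap.range (potMap f s)

theorem mem_potSp {V E : Type} {f s : E → V} {z : E → ℂ} :
    z ∈ potSp f s ↔ ∃ h : V → ℂ, ∀ e, z e = h (f e) - h (s e) := by
  constructor
  · rintro ⟨h, rfl⟩; exact ⟨h, fun e => rfl⟩
  · rintro ⟨h, hh⟩; exact ⟨h, funext fun e => (hh e).symm⟩

theorem eqvGen_const {V β : Type} {r : V → V → Prop} {h : V → β} (hr : ∀ u v, r u v → h u = h v)
    {u v : V} (huv : Relation.EqvGen r u v) : h u = h v := by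
  induction huv with
  | rel u v h => exact hr _ _ h
  | refl => rfl
  | symm _ _ _ ih => exact ih.symm
  | trans _ _ _ _ _ ih1 ih2 => exact ih1.trans ih2

theorem finrank_potSp {V E : Type} [Finite V] (f s : E → V) (ends : E → Sym2 V)
    (hends : ∀ e, ends e = s(f e, s e)) : Module.finrank ℂ (potSp f s) = gDim ends := by
  haveI := Fintype.ofFinite V
  have hk : Module.finrank ℂ (LinearMap.ker (potMap f s)) = numCC ends := by
    let Q := Quotient (ccSetoid ends)
    haveI : Finite Q := Quotient.finite _
    haveI := Fintype.ofFinite Q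
    have hcst : ∀ h : LinearMap.ker (potMap f s), ∀ u v, (ccSetoid ends).r u v → h.1 u = h.1 v := by
      intro h u v huv
      refine eqvGen_const (r := adjRel ends) ?_ huv
      rintro u v ⟨e, he⟩
      have h0 : h.1 (f e) = h.1 (s e) := sub_eq_zero.1 (congrFun (LinearMap.mem_ker.1 h.2) e)
      rw [hends, Sym2.eq_iff] at he
      rcases he with ⟨rfl, rfl⟩ | ⟨rfl, rfl⟩
      · exact h0
      · exact h0.symm
    let φ : LinearMap.ker (potMap f s) ≃ₗ[ℂ] (Q → ℂ) :=
      { toFun := fun h => Quotient.lift h.1 (hcst h)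
        map_add' := by
          intro h g; funext q
          induction q using Quotient.inductionOn
          rfl
        map_smul' := by
          intro r h; funext q
          induction q using Quotient.inductionOn
          rfl
        invFun := fun g => ⟨fun v => g (Quotient.mk _ v), by
          rw [LinearMap.mem_ker]; funext e
          refine sub_eq_zero.2 (congrArg g (Quotient.sound ?_))
          exact Relation.EqvGen.rel _ _ ⟨e, hends e⟩⟩
        left_inv := fun h => rfl
        right_inv := by
          intro g; funext q
          induction q using Quotient.inductionOn
          rfl }
    rw [φ.finrank_eq, Module.finrank_fintype_fun_eq_card, numCC, Nat.card_eq_fintype_card]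
  have := LinearMap.finrank_range_add_finrank_ker (potMap f s)
  rw [hk, Module.finrank_fintype_fun_eq_card, ← Nat.card_eq_fintype_card] at this
  unfold gDim potSp
  omega

/-! walks -/

def PS {V E : Type} (ends : E → Sym2 V) : Set (V × V) := {p | p.1 ≠ p.2 ∧ ∃ e, ends e = s(p.1, p.2)}

def ClosedZero {V : Type} {P : Set (V × V)} (x : ↥P → ℂ) : Prop :=
  ∀ (n : ℕ) (u : ℕ → V) (w : Fin n → ↥P),
      (∀ i : Fin n, (w i : V × V) = (u i.1, u (i.1 + 1))) → u n = u 0 →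
      ∑ i, x (w i) = 0

inductive Wk {V : Type} {P : Set (V × V)} (x : ↥P → ℂ) (a : V) : V → ℂ → Prop
  | nil : Wk x a a 0
  | snoc {b : V} {s : ℂ} (p : ↥P) : Wk x a b s → p.1.1 = b → Wk x a p.1.2 (s + x p)

theorem Wk.trans {V : Type} {P : Set (V × V)} {x : ↥P → ℂ} {a b c : V} {s t : ℂ}
    (h1 : Wk x a b s) (h2 : Wk x b c t) : Wk x a c (s + t) := by
  induction h2 with
  | nil => simpa using h1
  | snoc p _ hp ih => rw [← add_assoc]; exact Wk.snoc p ih hp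

theorem Wk.exists {V : Type} {P : Set (V × V)} {x : ↥P → ℂ} {a b : V} {s : ℂ}
    (h : Wk x a b s) : ∃ (n : ℕ) (u : ℕ → V) (w : Fin n → ↥P),
      (∀ i : Fin n, (w i : V × V) = (u i.1, u (i.1 + 1))) ∧ u 0 = a ∧ u n = b ∧
      ∑ i, x (w i) = s := by
  induction h with
  | nil => exact ⟨0, fun _ => a, Fin.elim0, fun i => i.elim0, rfl, rfl, by simp⟩
  | snoc p _ hp ih =>
    obtain ⟨n, u, w, h1, h2, h3, h4⟩ := ih
    refine ⟨n + 1, fun i => if i ≤ n then u i else p.1.2, Fin.snoc w p, ?_, ?_, ?_, ?_⟩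
    · intro i
      refine Fin.lastCases ?_ (fun i => ?_) i
      · simp only [Fin.snoc_last, Fin.val_last, le_refl, if_true]
        rw [if_neg (by omega), h3]
        exact Prod.ext hp rfl
      · simp only [Fin.snoc_castSucc, Fin.val_castSucc]
        rw [if_pos (by omega), if_pos (by omega)]
        exact h1 i
    · simpa using h2
    · simp
    · rw [Fin.sum_univ_castSucc]; simp [h4]

theorem Wk.closed {V : Type} {P : Set (V × V)} {x : ↥P → ℂ} (hx : ClosedZero x) {a : V} {s : ℂ}
    (h : Wk x a a s) : s = 0 := by
  obtain ⟨n, u, w, h1, h2, h3, h4⟩ := h.exists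
  rw [← h4]
  exact hx n u w h1 (h3.trans h2.symm)

theorem Wk.single {V : Type} {P : Set (V × V)} {x : ↥P → ℂ} (p : ↥P) : Wk x p.1.1 p.1.2 (x p) := by
  simpa using Wk.snoc p (Wk.nil (x := x) (a := p.1.1)) rfl

theorem closed_anti {V : Type} {P : Set (V × V)} {x : ↥P → ℂ} (hx : ClosedZero x) (p q : ↥P)
    (h : q.1 = (p.1.2, p.1.1)) : x q = - x p := by
  have h1 := (Wk.single (x := x) p)
  have h2 := (Wk.single (x := x) q)
  rw [h] at h2
  have := (h1.trans h2).closed hx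
  linear_combination this

theorem Wk.symm {V : Type} {P : Set (V × V)} (hP : ∀ p ∈ P, (p.2, p.1) ∈ P) {x : ↥P → ℂ}
    (hx : ClosedZero x) {a b : V} {s : ℂ} (h : Wk x a b s) : Wk x b a (-s) := by
  induction h with
  | nil => simpa using Wk.nil (x := x) (a := a)
  | snoc p _ hp ih =>
    subst hp
    have := (Wk.single (x := x) ⟨(p.1.2, p.1.1), hP _ p.2⟩)
    rw [closed_anti hx p _ rfl] at this
    rw [neg_add_rev]
    exact this.trans ih

theorem closed_pot {V : Type} {P : Set (V × V)} (hP : ∀ p ∈ P, (p.2, p.1) ∈ P) {x : ↥P → ℂ}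
    (hx : ClosedZero x) : ∃ h : V → ℂ, ∀ p : ↥P, x p = h p.1.1 - h p.1.2 := by
  let S : Setoid V := ⟨fun a b => ∃ s, Wk x a b s, fun a => ⟨0, Wk.nil⟩,
    fun ⟨s, h⟩ => ⟨-s, h.symm hP hx⟩, fun ⟨s, h⟩ ⟨t, h'⟩ => ⟨s + t, h.trans h'⟩⟩
  have : ∀ v, ∃ s, Wk x v (Quotient.mk S v).out s := by
    intro v
    exact S.symm (Quotient.exact (Quotient.out_eq (Quotient.mk S v)))
  choose h hh using this
  refine ⟨h, fun p => ?_⟩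
  have e : (Quotient.mk S p.1.1) = Quotient.mk S p.1.2 := Quotient.sound ⟨_, Wk.single p⟩
  have h1 := hh p.1.1
  have h2 := hh p.1.2
  rw [← e] at h2
  have := (((Wk.single p).trans h2).trans (h1.symm hP hx)).closed hx
  linear_combination this

theorem pot_closed {V : Type} {P : Set (V × V)} (h : V → ℂ) :
    ClosedZero (fun p : ↥P => h p.1.1 - h p.1.2) := by
  intro n u w hw hu
  have : ∀ i : Fin n, h (w i).1.1 - h (w i).1.2 = (fun i => h (u i) - h (u (i + 1))) i.1 := by
    intro i; rw [hw i]
  rw [Finset.sum_congr rfl fun i _ => this i, Fin.sum_univ_eq_sum_range (fun i => h (u i) - h (u (i + 1))), Finset.sum_range_sub' (fun i => h (u i)), hu,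
    sub_self]

theorem PS_symm {V E : Type} (ends : E → Sym2 V) : ∀ p ∈ PS ends, (p.2, p.1) ∈ PS ends := by
  rintro p ⟨h, e, he⟩
  exact ⟨h.symm, e, by rw [he, Sym2.eq_swap]⟩

def resE {V E : Type} {ends : E → Sym2 V} {f s : E → V} (hm : ∀ e, (f e, s e) ∈ PS ends)
    (x : ↥(PS ends) → ℂ) : E → ℂ := fun e => x ⟨(f e, s e), hm e⟩

theorem resE_inj {V E : Type} {ends : E → Sym2 V} {f s : E → V} (hm : ∀ e, (f e, s e) ∈ PS ends)
    (hends : ∀ e, ends e = s(f e, s e)) {x y : ↥(PS ends) → ℂ} (hx : ClosedZero x)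
    (hy : ClosedZero y) (h : resE hm x = resE hm y) : x = y := by
  funext p
  obtain ⟨hp, e, he⟩ := p.2
  have h1 : x ⟨(f e, s e), hm e⟩ = y ⟨(f e, s e), hm e⟩ := congrFun h e
  rw [hends, Sym2.eq_iff] at he
  rcases he with ⟨h2, h3⟩ | ⟨h2, h3⟩
  · have : p = ⟨(f e, s e), hm e⟩ := Subtype.ext (Prod.ext h2.symm h3.symm)
    rw [this, h1]
  · have h4 : p.1 = (s e, f e) := Prod.ext h3.symm h2.symm
    rw [closed_anti hx ⟨(f e, s e), hm e⟩ p h4, closed_anti hy ⟨(f e, s e), hm e⟩ p h4, h1]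

theorem resE_mem {V E : Type} {ends : E → Sym2 V} {f s : E → V} (hm : ∀ e, (f e, s e) ∈ PS ends)
    {x : ↥(PS ends) → ℂ} (hx : ClosedZero x) : resE hm x ∈ potSp f s := by
  obtain ⟨h, hh⟩ := closed_pot (PS_symm ends) hx
  exact mem_potSp.2 ⟨h, fun e => hh _⟩

theorem resE_surj {V E : Type} {ends : E → Sym2 V} {f s : E → V} (hm : ∀ e, (f e, s e) ∈ PS ends)
    {z : E → ℂ} (hz : z ∈ potSp f s) : ∃ x : ↥(PS ends) → ℂ, ClosedZero x ∧ resE hm x = z := by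
  obtain ⟨h, hh⟩ := mem_potSp.1 hz
  exact ⟨_, pot_closed h, funext fun e => (hh e).symm⟩

/-! quotients -/

def gInc {V E : Type} (ends : E → Sym2 V) := {q : E × V // q.2 ∈ ends q.1}

def gRel {V E : Type} (ends : E → Sym2 V) (a : E → ℚ) : gInc ends → gInc ends → Prop := fun p q =>
  a p.1.1 = a q.1.1 ∧
  Relation.EqvGen (fun u v => ∃ e, a p.1.1 < a e ∧ ends e = s(u, v)) p.1.2 q.1.2

def gSet {V E : Type} (ends : E → Sym2 V) (a : E → ℚ) : Setoid (gInc ends) :=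
  ⟨Relation.EqvGen (gRel ends a), Relation.EqvGen.is_equivalence _⟩

def gQ {V E : Type} (ends : E → Sym2 V) (a : E → ℚ) := Quotient (gSet ends a)

theorem gQ_pot {V E : Type} (ends : E → Sym2 V) (a : E → ℚ) (f s : E → V)
    (hf : ∀ e, f e ∈ ends e) (hs : ∀ e, s e ∈ ends e)
    (hends : ∀ e, ends e = s(f e, s e)) :
    (potSp (fun e => (Quotient.mk (gSet ends a) ⟨(e, f e), hf e⟩ : gQ ends a))
      (fun e => (Quotient.mk (gSet ends a) ⟨(e, s e), hs e⟩ : gQ ends a)) : Set (E → ℂ)) =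
    InSp (potSp f s) a := by
  ext z
  constructor
  · intro hz α
    obtain ⟨H, hH⟩ := mem_potSp.1 hz
    let R : V → V → Prop := fun u v => ∃ e, α < a e ∧ ends e = s(u, v)
    let C : V → gInc ends → Prop := fun v i => a i.1.1 = α ∧ Relation.EqvGen R v i.1.2
    let h : V → ℂ := fun v => if hv : ∃ i, C v i then H (Quotient.mk (gSet ends a) hv.choose) else 0
    have hval : ∀ v i, C v i → h v = H (Quotient.mk (gSet ends a) i) := by
      intro v i hi
      have hv : ∃ i, C v i := ⟨i, hi⟩
      simp only [h, dif_pos hv]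
      congr 1
      refine Quotient.sound (Relation.EqvGen.rel _ _ ⟨hv.choose_spec.1.trans hi.1.symm, ?_⟩)
      rw [hv.choose_spec.1]
      exact (hv.choose_spec.2.symm _ _).trans _ _ _ hi.2
    have hcon : ∀ u v, R u v → h u = h v := by
      intro u v huv
      by_cases hv : ∃ i, C v i
      · obtain ⟨i, hi⟩ := hv
        rw [hval v i hi, hval u i ⟨hi.1, (Relation.EqvGen.rel _ _ huv).trans _ _ _ hi.2⟩]
      · have hu : ¬ ∃ i, C u i := by
          rintro ⟨i, hi⟩
          exact hv ⟨i, hi.1, ((Relation.EqvGen.rel _ _ huv).symm _ _).trans _ _ _ hi.2⟩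
        simp only [h, dif_neg hv, dif_neg hu]
    refine ⟨fun e => h (f e) - h (s e), mem_potSp.2 ⟨h, fun e => rfl⟩, fun e he => ?_, fun e he => ?_⟩
    · exact sub_eq_zero.2 (hcon _ _ ⟨e, he, hends e⟩)
    · rw [hH e]
      simp only
      rw [hval (f e) ⟨(e, f e), hf e⟩ ⟨he, Relation.EqvGen.refl _⟩,
        hval (s e) ⟨(e, s e), hs e⟩ ⟨he, Relation.EqvGen.refl _⟩]
  · intro hz
    choose x hx h1 h2 using hz
    choose h hh using fun α => mem_potSp.1 (hx α)
    have hl : ∀ i j : gInc ends, gRel ends a i j → h (a i.1.1) i.1.2 = h (a j.1.1) j.1.2 := by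
      rintro i j ⟨hij, hg⟩
      rw [← hij]
      refine eqvGen_const ?_ hg
      rintro u v ⟨e, he, he'⟩
      have h0 := (hh (a i.1.1) e).symm.trans (h1 _ e he)
      rw [hends, Sym2.eq_iff] at he'
      rcases he' with ⟨rfl, rfl⟩ | ⟨rfl, rfl⟩
      · exact sub_eq_zero.1 h0
      · exact (sub_eq_zero.1 h0).symm
    refine mem_potSp.2 ⟨Quotient.lift (fun i : gInc ends => h (a i.1.1) i.1.2)
      (fun i j hij => eqvGen_const hl hij), fun e => ?_⟩
    rw [← h2 (a e) e rfl, hh]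
    rfl

theorem twist {V E : Type} (f s f' s' : E → V) (h : ∀ e, s(f e, s e) = s(f' e, s' e)) (eb : E) :
    ∃ r : E → ℝ, (∀ e, r e * r e = 1) ∧ r eb = 1 ∧
      ∀ z : E → ℂ, z ∈ potSp f s ↔ (fun e => (r e : ℂ) * z e) ∈ potSp f' s' := by
  let t : E → ℝ := fun e => if f e = f' e then 1 else -1
  have tt : ∀ e, t e * t e = 1 := by
    intro e; simp only [t]; split_ifs <;> norm_num
  have ht : ∀ (g : V → ℂ) e, g (f' e) - g (s' e) = (t e : ℂ) * (g (f e) - g (s e)) := by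
    intro g e
    have := h e
    rw [Sym2.eq_iff] at this
    rcases this with ⟨h1, h2⟩ | ⟨h1, h2⟩
    · simp [t, h1, h2]
    · by_cases h3 : f e = f' e
      · have : s e = s' e := by rw [h2, ← h3, h1]
        simp [t, h3, this]
      · simp only [t, if_neg h3, h1, h2]; push_cast; ring
  refine ⟨fun e => t eb * t e, fun e => ?_, tt eb, fun z => ?_⟩
  · have h1 := tt e
    have h2 := tt eb
    linear_combination h2 * t e * t e + h1
  · rw [mem_potSp, mem_potSp]
    have c1 : ∀ e, ((t e : ℝ) : ℂ) * t e = 1 := by intro e; exact_mod_cast tt e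
    constructor
    · rintro ⟨g, hg⟩
      refine ⟨fun v => t eb * g v, fun e => ?_⟩
      have := ht (fun v => (t eb : ℂ) * g v) e
      rw [this, hg]; push_cast; ring
    · rintro ⟨g, hg⟩
      refine ⟨fun v => t eb * g v, fun e => ?_⟩
      have h1 := hg e
      rw [ht g e] at h1
      push_cast at h1
      have h2 := congrArg (fun y => (t eb : ℂ) * t e * y) h1
      linear_combination h2 - (t eb : ℂ) * t eb * z e * c1 e - z e * c1 eb + (t eb : ℂ) * (g (f e) - g (s e)) * c1 e



def DSymm {V : Type} {P : Set (V × V)} (d : ↥P → ℚ) : Prop :=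
  ∀ p p' : ↥P, (p' : V × V) = ((p : V × V).2, (p : V × V).1) → d p' = d p

def DMin {V : Type} {P : Set (V × V)} (d : ↥P → ℚ) : Prop :=
  ∀ (n : ℕ) (u : ℕ → V) (w : Fin n → ↥P),
    (∀ i : Fin n, (w i : V × V) = (u i.1, u (i.1 + 1))) → u n = u 0 →
    ∀ i : Fin n, (∀ k, d (w i) ≤ d (w k)) → ∃ j, j ≠ i ∧ d (w j) = d (w i)

def gVal {V E : Type} (ends : E → Sym2 V) (d : ↥(PS ends) → ℚ) (e : E) : ℚ :=
  if h : ∃ p : ↥(PS ends), s((p : V × V).1, (p : V × V).2) = ends e then d h.choose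
  else 0

theorem gVal_eq {V E : Type} {ends : E → Sym2 V} {d : ↥(PS ends) → ℚ} (hd : DSymm d)
    (p : ↥(PS ends)) (e : E) (h : s((p : V × V).1, (p : V × V).2) = ends e) : gVal ends d e = d p := by
  have hp : ∃ p : ↥(PS ends), s((p : V × V).1, (p : V × V).2) = ends e := ⟨p, h⟩
  simp only [gVal, dif_pos hp]
  have h1 := hp.choose_spec.trans h.symm
  rw [Sym2.eq_iff] at h1
  rcases h1 with ⟨h2, h3⟩ | ⟨h2, h3⟩
  · congr 1
    exact Subtype.ext (Prod.ext h2 h3)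
  · exact hd _ _ (Prod.ext h2 h3)

theorem exists_dist {V E : Type} {ends : E → Sym2 V} {f s : E → V}
    (hends : ∀ e, ends e = s(f e, s e)) (a : E → ℚ) (z : E → ℂ)
    (hz : z ∈ InSp (potSp f s) a) (hn : ∀ e, z e ≠ 0) :
    ∃ d : ↥(PS ends) → ℚ, DSymm d ∧ DMin d ∧
      ∀ (p : ↥(PS ends)) e, s((p : V × V).1, (p : V × V).2) = ends e → d p = a e := by
  have hpot : ∀ α, ∃ h : V → ℂ, (∀ e u v, ends e = s(u, v) → α < a e → h u = h v) ∧
      ∀ e u v, ends e = s(u, v) → a e = α → h u ≠ h v := by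
    intro α
    obtain ⟨x, hx, h1, h2⟩ := hz α
    obtain ⟨h, hh⟩ := mem_potSp.1 hx
    refine ⟨h, fun e u v he ha => ?_, fun e u v he ha => ?_⟩
    · have h3 := (hh e).symm.trans (h1 e ha)
      rw [hends, Sym2.eq_iff] at he
      rcases he with ⟨rfl, rfl⟩ | ⟨rfl, rfl⟩
      · exact sub_eq_zero.1 h3
      · exact (sub_eq_zero.1 h3).symm
    · have h3 := (hh e).symm.trans (h2 e ha)
      have h4 := hn e
      rw [← h3, sub_ne_zero] at h4
      rw [hends, Sym2.eq_iff] at he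
      rcases he with ⟨rfl, rfl⟩ | ⟨rfl, rfl⟩
      · exact h4
      · exact h4.symm
  have par' : ∀ e e', ends e = ends e' → ¬ a e < a e' := by
    intro e e' h hlt
    obtain ⟨g, h1, h2⟩ := hpot (a e)
    exact h2 e _ _ (hends e) rfl (h1 e' _ _ (h.symm.trans (hends e)) hlt)
  have par : ∀ e e', ends e = ends e' → a e = a e' := fun e e' h =>
    le_antisymm (not_lt.1 (par' e' e h.symm)) (not_lt.1 (par' e e' h))
  let d : ↥(PS ends) → ℚ := fun p => a p.2.2.choose
  have hd : ∀ (p : ↥(PS ends)) e, s((p : V × V).1, (p : V × V).2) = ends e → d p = a e := by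
    intro p e h
    exact par _ _ (p.2.2.choose_spec.trans h)
  refine ⟨d, ?_, ?_, hd⟩
  · intro p p' h
    obtain ⟨e, he⟩ := p.2.2
    rw [hd p e he.symm]
    refine hd p' e ?_
    rw [he, h, Sym2.eq_swap]
  · intro n u w hw hu i hi
    by_contra hcon
    push Not at hcon
    obtain ⟨g, h1, h2⟩ := hpot (d (w i))
    have hsum := pot_closed (P := PS ends) g n u w hw hu
    rw [Finset.sum_eq_single i] at hsum
    · obtain ⟨e, he⟩ := (w i).2.2
      exact h2 e _ _ he (hd _ e he.symm).symm (sub_eq_zero.1 hsum)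
    · intro j _ hj
      obtain ⟨e, he⟩ := (w j).2.2
      refine sub_eq_zero.2 (h1 e _ _ he ?_)
      rw [← hd _ e he.symm]
      exact lt_of_le_of_ne (hi j) (hcon j hj).symm
    · intro h; exact absurd (Finset.mem_univ i) h

theorem sol_twist {E : Type} {A B A' B' : Set (E → ℂ)} {r r' : E → ℝ} {eb : E}
    (hr : ∀ e, r e * r e = 1) (hr' : ∀ e, r' e * r' e = 1) (h1 : r eb = 1) (h1' : r' eb = 1)
    (hA : ∀ z : E → ℂ, z ∈ A ↔ (fun e => (r e : ℂ) * z e) ∈ A')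
    (hB : ∀ z : E → ℂ, z ∈ B ↔ (fun e => (r' e : ℂ) * z e) ∈ B') (c : {e : E // e ≠ eb} → ℂ) :
    Set.InjOn (fun z : (E → ℂ) × (E → ℂ) =>
        ((fun e => (r e : ℂ) * z.1 e, fun e => (r' e : ℂ) * z.2 e) : (E → ℂ) × (E → ℂ)))
      (SolS A B eb c) ∧
    (fun z : (E → ℂ) × (E → ℂ) =>
        ((fun e => (r e : ℂ) * z.1 e, fun e => (r' e : ℂ) * z.2 e) : (E → ℂ) × (E → ℂ))) ''
      (SolS A B eb c) = SolS A' B' eb (fun e => ((r e.1 * r' e.1 : ℝ) : ℂ) * c e) := by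
  have c1 : ∀ e, (r e : ℂ) * r e = 1 := by intro e; exact_mod_cast hr e
  have c2 : ∀ e, (r' e : ℂ) * r' e = 1 := by intro e; exact_mod_cast hr' e
  have inv : ∀ z : (E → ℂ) × (E → ℂ),
      ((fun e => (r e : ℂ) * ((r e : ℂ) * z.1 e), fun e => (r' e : ℂ) * ((r' e : ℂ) * z.2 e)) :
        (E → ℂ) × (E → ℂ)) = z := by
    intro z
    refine Prod.ext (funext fun e => ?_) (funext fun e => ?_)
    · simp only; rw [← mul_assoc, c1, one_mul]
    · simp only; rw [← mul_assoc, c2, one_mul]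
  have mem : ∀ z, z ∈ SolS A B eb c ↔
      ((fun e => (r e : ℂ) * z.1 e, fun e => (r' e : ℂ) * z.2 e) : (E → ℂ) × (E → ℂ)) ∈
        SolS A' B' eb (fun e => ((r e.1 * r' e.1 : ℝ) : ℂ) * c e) := by
    intro z
    refine and_congr (hA _) (and_congr (hB _) (and_congr ?_ (and_congr ?_ (forall_congr' fun e => ?_))))
    · simp [h1]
    · simp [h1']
    · simp only
      rw [mul_mul_mul_comm, Complex.ofReal_mul]
      refine (mul_right_inj' ?_).symm
      intro h0
      have := congrArg (fun y => y * ((r e.1 : ℂ) * r' e.1)) h0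
      simp only [zero_mul] at this
      rw [mul_mul_mul_comm, c1, c2] at this
      simp at this
  refine ⟨fun z _ z' _ h => ?_, ?_⟩
  · rw [← inv z, ← inv z']
    have e1 := congrArg Prod.fst h
    have e2 := congrArg Prod.snd h
    refine Prod.ext (funext fun e => ?_) (funext fun e => ?_)
    · exact congrArg (fun y => (r e : ℂ) * y) (congrFun e1 e)
    · exact congrArg (fun y => (r' e : ℂ) * y) (congrFun e2 e)
  · ext z
    constructor
    · rintro ⟨y, hy, rfl⟩; exact (mem y).1 hy
    · intro hz
      refine ⟨(fun e => (r e : ℂ) * z.1 e, fun e => (r' e : ℂ) * z.2 e), (mem _).2 ?_, inv z⟩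
      have := inv z
      simp only
      rw [this]; exact hz

theorem ends_eq {V : Type} [LinearOrder V] (t : Sym2 V) : t = s(sMin t, sMax t) := by
  induction t using Sym2.ind with
  | _ x y =>
    simp only [sMin, sMax, Sym2.lift_mk]
    rcases le_total x y with h | h
    · simp [h]
    · simp [h]

theorem endsG (B : Bigraph) (e : B.ℰ) : B.τG e = s(B.eFstG e, B.eSndG e) :=
  @ends_eq _ B.ordV _

theorem endsH (B : Bigraph) (e : B.ℰ) : B.τH e = s(B.eFstH e, B.eSndH e) :=
  @ends_eq _ B.ordW _

def XB (B : Bigraph) : Submodule ℂ (B.ℰ → ℂ) := potSp B.eFstG B.eSndG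
def YB (B : Bigraph) : Submodule ℂ (B.ℰ → ℂ) := potSp B.eFstH B.eSndH

theorem hmG {B : Bigraph} (hl : ¬ B.HasLoop) (e : B.ℰ) : (B.eFstG e, B.eSndG e) ∈ PS B.τG := by
  refine ⟨fun h => hl (Or.inl ⟨e, ?_⟩), e, endsG B e⟩
  rw [endsG]; exact h

theorem hmH {B : Bigraph} (hl : ¬ B.HasLoop) (e : B.ℰ) : (B.eFstH e, B.eSndH e) ∈ PS B.τH := by
  refine ⟨fun h => hl (Or.inr ⟨e, ?_⟩), e, endsH B e⟩
  rw [endsH]; exact h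

theorem zset_sol (B : Bigraph) (hl : ¬ B.HasLoop) (ebar : B.ℰ) (lam : {e : B.ℰ // e ≠ ebar} → ℂ)
    (hf : (B.ZSet ebar lam).Finite) :
    (SolS (XB B : Set (B.ℰ → ℂ)) (YB B : Set (B.ℰ → ℂ)) ebar lam).Finite ∧
    (SolS (XB B : Set (B.ℰ → ℂ)) (YB B : Set (B.ℰ → ℂ)) ebar lam).ncard =
      Nat.card ↥(B.ZSet ebar lam) := by
  let F : (↥B.Pset → ℂ) × (↥B.Qset → ℂ) → (B.ℰ → ℂ) × (B.ℰ → ℂ) :=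
    fun xy => (resE (ends := B.τG) (hmG hl) xy.1, resE (ends := B.τH) (hmH hl) xy.2)
  have hinj : Set.InjOn F (B.ZSet ebar lam) := by
    intro x hx y hy h
    exact Prod.ext (resE_inj (hmG hl) (endsG B) hx.2.2.2.1 hy.2.2.2.1 (congrArg Prod.fst h))
      (resE_inj (hmH hl) (endsH B) hx.2.2.2.2 hy.2.2.2.2 (congrArg Prod.snd h))
  have himg : F '' (B.ZSet ebar lam) =
      SolS (XB B : Set (B.ℰ → ℂ)) (YB B : Set (B.ℰ → ℂ)) ebar lam := by
    ext z
    constructor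
    · rintro ⟨x, ⟨h1, h2, h3, h4, h5⟩, rfl⟩
      exact ⟨resE_mem (hmG hl) h4, resE_mem (hmH hl) h5, h1 _ rfl, h2 _ rfl,
        fun e => h3 e _ _ rfl rfl⟩
    · rintro ⟨h1, h2, h3, h4, h5⟩
      obtain ⟨x, hx, hx'⟩ := resE_surj (hmG hl) h1
      obtain ⟨y, hy, hy'⟩ := resE_surj (hmH hl) h2
      refine ⟨(x, y), ⟨fun p hp => ?_, fun q hq => ?_, fun e p q hp hq => ?_, hx, hy⟩,
        Prod.ext hx' hy'⟩
      · have : p = ⟨_, hmG hl ebar⟩ := Subtype.ext hp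
        rw [this, ← h3, ← hx']; rfl
      · have : q = ⟨_, hmH hl ebar⟩ := Subtype.ext hq
        rw [this, ← h4, ← hy']; rfl
      · have e1 : p = ⟨_, hmG hl e.1⟩ := Subtype.ext hp
        have e2 : q = ⟨_, hmH hl e.1⟩ := Subtype.ext hq
        rw [e1, e2, ← h5 e, ← hx', ← hy']; rfl
  rw [← himg]
  exact ⟨hf.image _, Set.ncard_image_of_injOn hinj⟩

theorem ae_ne {E : Type} [Fintype E] (eb : E) : ∀ᵐ c : {e : E // e ≠ eb} → ℂ, ∀ e, c e ≠ 0 := by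
  rw [ae_all_iff]
  intro e
  have := poly_null (P := (MvPolynomial.X e : MvPolynomial {e : E // e ≠ eb} ℂ))
    (MvPolynomial.X_ne_zero e)
  simpa using this

theorem laman_ae (B : Bigraph) [Fintype B.ℰ] (ebar : B.ℰ) (N : ℕ) (h : B.HasLamanNumber ebar N) :
    ∀ᵐ c : {e : B.ℰ // e ≠ ebar} → ℂ,
      (SolS (XB B : Set (B.ℰ → ℂ)) (YB B : Set (B.ℰ → ℂ)) ebar c).Finite ∧
      (SolS (XB B : Set (B.ℰ → ℂ)) (YB B : Set (B.ℰ → ℂ)) ebar c).ncard = N := by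
  rcases h with ⟨h1, rfl⟩ | ⟨h1, P, hP, h2⟩
  · filter_upwards [ae_ne ebar] with c hc
    have : SolS (XB B : Set (B.ℰ → ℂ)) (YB B : Set (B.ℰ → ℂ)) ebar c = ∅ := by
      rw [Set.eq_empty_iff_forall_notMem]
      intro z hz
      rcases h1 with ⟨e, he⟩ | ⟨e, he⟩
      · apply (sol_ne hc hz e).1
        obtain ⟨g, hg⟩ := mem_potSp.1 hz.1
        rw [endsG] at he
        rw [hg, show B.eFstG e = B.eSndG e from he, sub_self]
      · apply (sol_ne hc hz e).2
        obtain ⟨g, hg⟩ := mem_potSp.1 hz.2.1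
        rw [endsH] at he
        rw [hg, show B.eFstH e = B.eSndH e from he, sub_self]
    rw [this]; simp
  · filter_upwards [poly_null P hP] with c hc
    obtain ⟨h3, h4⟩ := h2 c hc
    have := zset_sol B h1 ebar c h3
    rwa [h4] at this

theorem quot_ae (B : Bigraph) [inst : Fintype B.ℰ] (ebar : B.ℰ) (N : ℕ) (dV : ↥B.Pset → ℚ)
    (dW : ↥B.Qset → ℚ) (oV : LinearOrder (B.QVertG dV)) (oW : LinearOrder (B.QVertH dW))
    (h : (B.quotBigraph dV dW oV oW).HasLamanNumber ebar N) :
    ∀ᵐ c : {e : B.ℰ // e ≠ ebar} → ℂ,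
      (SolS (InSp (XB B) (B.gvalG dV)) (InSp (YB B) (B.gvalH dW)) ebar c).Finite ∧
      (SolS (InSp (XB B) (B.gvalG dV)) (InSp (YB B) (B.gvalH dW)) ebar c).ncard = N := by
  have h0 := @laman_ae (B.quotBigraph dV dW oV oW) inst ebar N h
  have hX := gQ_pot B.τG (B.gvalG dV) B.eFstG B.eSndG B.eFstG_mem B.eSndG_mem (endsG B)
  have hY := gQ_pot B.τH (B.gvalH dW) B.eFstH B.eSndH B.eFstH_mem B.eSndH_mem (endsH B)
  obtain ⟨r, r1, r2, r3⟩ := twist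
    (fun e => (Quotient.mk (gSet B.τG (B.gvalG dV)) ⟨(e, B.eFstG e), B.eFstG_mem e⟩ : gQ B.τG (B.gvalG dV)))
    (fun e => (Quotient.mk (gSet B.τG (B.gvalG dV)) ⟨(e, B.eSndG e), B.eSndG_mem e⟩ : gQ B.τG (B.gvalG dV)))
    (B.quotBigraph dV dW oV oW).eFstG (B.quotBigraph dV dW oV oW).eSndG
    (fun e => endsG (B.quotBigraph dV dW oV oW) e) ebar
  obtain ⟨t, t1, t2, t3⟩ := twist
    (fun e => (Quotient.mk (gSet B.τH (B.gvalH dW)) ⟨(e, B.eFstH e), B.eFstH_mem e⟩ : gQ B.τH (B.gvalH dW)))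
    (fun e => (Quotient.mk (gSet B.τH (B.gvalH dW)) ⟨(e, B.eSndH e), B.eSndH_mem e⟩ : gQ B.τH (B.gvalH dW)))
    (B.quotBigraph dV dW oV oW).eFstH (B.quotBigraph dV dW oV oW).eSndH
    (fun e => endsH (B.quotBigraph dV dW oV oW) e) ebar
  have nz : ∀ e : {e : B.ℰ // e ≠ ebar}, r e.1 * t e.1 ≠ 0 := by
    intro e h0
    have h1 := r1 e.1
    have h2 := t1 e.1
    have : (r e.1 * t e.1) * (r e.1 * t e.1) = 1 := by linear_combination t e.1 * t e.1 * h1 + h2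
    rw [h0] at this; simp at this
  have h1 := ae_scale (fun e : {e : B.ℰ // e ≠ ebar} => r e.1 * t e.1) nz h0
  filter_upwards [h1] with c hc
  have hX' : InSp (XB B) (B.gvalG dV) = _ := hX.symm
  have hY' : InSp (YB B) (B.gvalH dW) = _ := hY.symm
  rw [hX', hY']
  obtain ⟨i1, i2⟩ := sol_twist (eb := ebar) r1 t1 r2 t2 r3 t3 c
  obtain ⟨h2, h3⟩ := hc
  have h2' := h2
  have h3' := h3
  replace h2' := (congrArg Set.Finite i2).mpr h2
  replace h3' := (congrArg Set.ncard i2).trans h3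
  rw [Set.finite_image_iff i1] at h2'
  rw [Set.ncard_image_of_injOn i1] at h3'
  exact ⟨h2', h3'⟩



theorem ex_order (α : Type) : Nonempty (LinearOrder α) :=
  ⟨IsWellOrder.linearOrder (WellOrderingRel (α := α))⟩

theorem final (B : Bigraph) (hloop : ¬ B.HasLoop) (hpl : B.PseudoLaman)
    (ebar : B.ℰ) (wt : {e : B.ℰ // e ≠ ebar} → ℚ) (N : ℕ)
    (L : (↥B.Pset → ℚ) × (↥B.Qset → ℚ) → ℕ)
    (hB : B.HasLamanNumber ebar N)
    (hL : ∀ d : (↥B.Pset → ℚ) × (↥B.Qset → ℚ), B.IsBidistance ebar wt d.1 d.2 →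
      ∀ (oV : LinearOrder (B.QVertG d.1)) (oW : LinearOrder (B.QVertH d.2)),
        (B.quotBigraph d.1 d.2 oV oW).HasLamanNumber ebar (L d)) :
    {d : (↥B.Pset → ℚ) × (↥B.Qset → ℚ) |
        B.IsBidistance ebar wt d.1 d.2 ∧ L d ≠ 0}.Finite ∧
    N = ∑ᶠ d ∈ {d : (↥B.Pset → ℚ) × (↥B.Qset → ℚ) |
        B.IsBidistance ebar wt d.1 d.2}, L d := by
  haveI := Fintype.ofFinite B.ℰ
  let w : B.ℰ → ℚ := fun e => if h : e = ebar then 0 else wt ⟨e, h⟩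
  have hw : w ebar = 0 := by simp [w]
  have hr : Module.finrank ℂ (XB B) + Module.finrank ℂ (YB B) = Fintype.card B.ℰ + 1 := by
    have h1 : Module.finrank ℂ (XB B) = gDim B.τG := finrank_potSp _ _ _ (endsG B)
    have h2 : Module.finrank ℂ (YB B) = gDim B.τH := finrank_potSp _ _ _ (endsH B)
    rw [h1, h2, ← Nat.card_eq_fintype_card]
    exact hpl
  let Bid : Set ((↥B.Pset → ℚ) × (↥B.Qset → ℚ)) := {d | B.IsBidistance ebar wt d.1 d.2}
  let Θ : (↥B.Pset → ℚ) × (↥B.Qset → ℚ) → (B.ℰ → ℚ) × (B.ℰ → ℚ) :=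
    fun d => (B.gvalG d.1, B.gvalH d.2)
  have gG : ∀ d : ↥B.Pset → ℚ, B.BidistSymmG d → ∀ (p : ↥B.Pset) (e : B.ℰ),
      s((p : B.V × B.V).1, (p : B.V × B.V).2) = B.τG e → B.gvalG d e = d p :=
    fun d hd p e h => gVal_eq (ends := B.τG) (d := d) hd p e h
  have gH : ∀ d : ↥B.Qset → ℚ, B.BidistSymmH d → ∀ (p : ↥B.Qset) (e : B.ℰ),
      s((p : B.W × B.W).1, (p : B.W × B.W).2) = B.τH e → B.gvalH d e = d p :=
    fun d hd p e h => gVal_eq (ends := B.τH) (d := d) hd p e h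
  let pG : B.ℰ → ↥B.Pset := fun e => ⟨(B.eFstG e, B.eSndG e), hmG hloop e⟩
  let pH : B.ℰ → ↥B.Qset := fun e => ⟨(B.eFstH e, B.eSndH e), hmH hloop e⟩
  have hpG : ∀ e, s((pG e : B.V × B.V).1, (pG e : B.V × B.V).2) = B.τG e :=
    fun e => (endsG B e).symm
  have hpH : ∀ e, s((pH e : B.W × B.W).1, (pH e : B.W × B.W).2) = B.τH e :=
    fun e => (endsH B e).symm
  have hmaps : ∀ d ∈ Bid, Θ d ∈ DSet ebar w := by
    rintro d ⟨s1, s2, s3, s4, s5, s6⟩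
    refine ⟨?_, ?_, fun e => ?_⟩
    · exact (gG _ s1 _ _ (hpG ebar)).trans (s4.1 _ (hpG ebar))
    · exact (gH _ s2 _ _ (hpH ebar)).trans (s4.2 _ (hpH ebar))
    · simp only [Θ]
      rw [gG _ s1 _ _ (hpG e), gH _ s2 _ _ (hpH e)]
      by_cases h : e = ebar
      · subst h
        rw [s4.1 _ (hpG e), s4.2 _ (hpH e), hw, add_zero]
      · rw [s3 ⟨e, h⟩ _ _ (hpG e) (hpH e)]
        simp [w, h]
  have hinj : Set.InjOn Θ Bid := by
    rintro d ⟨s1, s2, -⟩ d' ⟨s1', s2', -⟩ h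
    refine Prod.ext (funext fun p => ?_) (funext fun p => ?_)
    · obtain ⟨e, he⟩ := p.2.2
      rw [← gG _ s1 p e he.symm, ← gG _ s1' p e he.symm]
      exact congrFun (congrArg Prod.fst h) e
    · obtain ⟨e, he⟩ := p.2.2
      rw [← gH _ s2 p e he.symm, ← gH _ s2' p e he.symm]
      exact congrFun (congrArg Prod.snd h) e
  let Lf : (B.ℰ → ℚ) × (B.ℰ → ℚ) → ℕ :=
    fun D => if h : ∃ d, d ∈ Bid ∧ Θ d = D then L h.choose else 0
  have hLf : ∀ d ∈ Bid, Lf (Θ d) = L d := by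
    intro d hd
    have h : ∃ d', d' ∈ Bid ∧ Θ d' = Θ d := ⟨d, hd, rfl⟩
    simp only [Lf, dif_pos h]
    rw [hinj h.choose_spec.1 hd h.choose_spec.2]
  have hLf0 : ∀ D, D ∉ Θ '' Bid → Lf D = 0 := by
    intro D hD
    simp only [Lf]
    rw [dif_neg]
    exact hD
  have hmain : ∀ D ∈ DSet ebar w, ∀ᵐ c : {e : B.ℰ // e ≠ ebar} → ℂ,
      (SolS (InSp (XB B) D.1) (InSp (YB B) D.2) ebar c).Finite ∧
      (SolS (InSp (XB B) D.1) (InSp (YB B) D.2) ebar c).ncard = Lf D := by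
    intro D hD
    by_cases hex : D ∈ Θ '' Bid
    · obtain ⟨d, hd, rfl⟩ := hex
      rw [hLf d hd]
      obtain ⟨oV⟩ := ex_order (B.QVertG d.1)
      obtain ⟨oW⟩ := ex_order (B.QVertH d.2)
      exact quot_ae B ebar (L d) d.1 d.2 oV oW (hL d hd oV oW)
    · rw [hLf0 D hex]
      filter_upwards [ae_ne ebar] with c hc
      have : SolS (InSp (XB B) D.1) (InSp (YB B) D.2) ebar c = ∅ := by
        rw [Set.eq_empty_iff_forall_notMem]
        intro z hz
        obtain ⟨dV, v1, v2, v3⟩ := exists_dist (endsG B) D.1 z.1 hz.1 (fun e => (sol_ne hc hz e).1)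
        obtain ⟨dW, w1, w2, w3⟩ := exists_dist (endsH B) D.2 z.2 hz.2.1 (fun e => (sol_ne hc hz e).2)
        refine hex ⟨(dV, dW), ⟨v1, w1, ?_, ⟨?_, ?_⟩, v2, w2⟩, ?_⟩
        · intro e p q hp hq
          have h1 : dV p = D.1 e.1 := v3 p e.1 hp
          have h2 : dW q = D.2 e.1 := w3 q e.1 hq
          simp only
          rw [h1, h2, hD.2.2 e.1]
          simp [w, e.2]
        · intro p hp
          exact (v3 p _ hp).trans hD.1
        · intro p hp
          exact (w3 p _ hp).trans hD.2.1
        · refine Prod.ext (funext fun e => ?_) (funext fun e => ?_)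
          · exact (gG dV v1 _ _ (hpG e)).trans (v3 (pG e) e (hpG e))
          · exact (gH dW w1 _ _ (hpH e)).trans (w3 (pH e) e (hpH e))
      rw [this]; simp
  obtain ⟨hfin, hsum⟩ := abstract_count (XB B) (YB B) ebar hr w hw N (laman_ae B ebar N hB) Lf hmain
  constructor
  · refine Set.Finite.of_finite_image (f := Θ) (hfin.subset ?_) (hinj.mono fun d hd => hd.1)
    rintro _ ⟨d, ⟨hd, hd'⟩, rfl⟩
    exact ⟨hmaps d hd, by rw [hLf d hd]; exact hd'⟩
  · rw [hsum]
    have e1 : ∑ᶠ D ∈ DSet ebar w, Lf D = ∑ᶠ D ∈ Θ '' Bid, Lf D := by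
      apply finsum_mem_inter_support_eq
      ext D
      constructor
      · rintro ⟨h1, h2⟩
        refine ⟨?_, h2⟩
        by_contra h
        exact h2 (hLf0 D h)
      · rintro ⟨⟨d, hd, rfl⟩, h2⟩
        exact ⟨hmaps d hd, h2⟩
    rw [e1, finsum_mem_image hinj]
    exact finsum_mem_congr rfl hLf


end Aux

/-- `Lam(B) = Σ_d Lam(B_d)`, the sum ranging over all bidistances `d` on
`B` compatible with the weight vector `wt`; moreover only finitely many bidistances
contribute a nonzero term. -/
theorem statement1 (B : Bigraph) (hloop : ¬ B.HasLoop) (hpl : B.PseudoLaman)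
    (ebar : B.ℰ) (wt : {e : B.ℰ // e ≠ ebar} → ℚ) (N : ℕ)
    (L : (↥B.Pset → ℚ) × (↥B.Qset → ℚ) → ℕ)
    (hB : B.HasLamanNumber ebar N)
    (hL : ∀ d : (↥B.Pset → ℚ) × (↥B.Qset → ℚ), B.IsBidistance ebar wt d.1 d.2 →
      ∀ (oV : LinearOrder (B.QVertG d.1)) (oW : LinearOrder (B.QVertH d.2)),
        (B.quotBigraph d.1 d.2 oV oW).HasLamanNumber ebar (L d)) :
    {d : (↥B.Pset → ℚ) × (↥B.Qset → ℚ) |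
        B.IsBidistance ebar wt d.1 d.2 ∧ L d ≠ 0}.Finite ∧
    N = ∑ᶠ d ∈ {d : (↥B.Pset → ℚ) × (↥B.Qset → ℚ) |
        B.IsBidistance ebar wt d.1 d.2}, L d := by
  exact final B hloop hpl ebar wt N L hB hL

end LamanPaper
end
end

section
/- Let G=(V,E) be a graph and fix an edge {ū,v̄}∈E, defining the polynomial map h_G. Then G is generically rigid if and only if h_G is dominant and 2|V|=|E|+3. -/
set_option maxHeartbeats 1000000

noncomputable section
open Classical

namespace LamanGraphs

variable {V : Type} [Fintype V]

/-- The Laman counting conditions for a (connected) simple graph: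
`|E| = 2|V| - 3`, and `|E'| ≤ 2|V'| - 3` for every subgraph with at least two vertices. -/
def LamanCond (G : SimpleGraph V) : Prop :=
  G.edgeSet.ncard + 3 = 2 * Fintype.card V ∧
  ∀ G' : G.Subgraph, 2 ≤ G'.verts.ncard → G'.edgeSet.ncard + 3 ≤ 2 * G'.verts.ncard

/-- The quadratic form `⟨z, z⟩ = z₀² + z₁²` on `ℂ²`. -/
def qf (z : Fin 2 → ℂ) : ℂ := z 0 ^ 2 + z 1 ^ 2

/-- A realization `ρ : V → ℂ²` is compatible with a labeling `lam : E → ℂ` if for every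
edge `e = {u,v}` one has `lam e = ⟨ρ(u) - ρ(v), ρ(u) - ρ(v)⟩`. -/
def Compatible (G : SimpleGraph V) (lam : ↥G.edgeSet → ℂ) (ρ : V → Fin 2 → ℂ) : Prop :=
  ∀ e : ↥G.edgeSet, ∀ u v : V, (e : Sym2 V) = s(u, v) → lam e = qf (ρ u - ρ v)

/-- Two realizations are equivalent if they differ by a direct complex isometry
`z ↦ A z + b` with `Aᵀ A = 1` and `det A = 1`. -/
def Equivalent (ρ₁ ρ₂ : V → Fin 2 → ℂ) : Prop :=
  ∃ (A : Matrix (Fin 2) (Fin 2) ℂ) (b : Fin 2 → ℂ),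
    A.transpose * A = 1 ∧ A.det = 1 ∧ ∀ v, ρ₁ v = A.mulVec (ρ₂ v) + b

/-- A labeled graph `(G, lam)` is rigid if it admits a compatible realization and only
finitely many compatible realizations up to equivalence. -/
def Rigid (G : SimpleGraph V) (lam : ↥G.edgeSet → ℂ) : Prop :=
  (∃ ρ, Compatible G lam ρ) ∧
  ∃ F : Set (V → Fin 2 → ℂ), F.Finite ∧
    ∀ ρ, Compatible G lam ρ → ∃ ρ' ∈ F, Equivalent ρ ρ'

/-- A graph is generically rigid if `(G, lam)` is rigid for all labelings outside the zero
set of some nonzero polynomial. -/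
def GenericallyRigid (G : SimpleGraph V) : Prop :=
  ∃ P : MvPolynomial ↥G.edgeSet ℂ, P ≠ 0 ∧
    ∀ lam : ↥G.edgeSet → ℂ, MvPolynomial.eval lam P ≠ 0 → Rigid G lam

/-- The polynomial map `h_G` on all of `ℂ^{2|V|}`, sending a tuple of points to the vector
of squared edge lengths. -/
def hMap (G : SimpleGraph V) (z : V → Fin 2 → ℂ) : ↥G.edgeSet → ℂ := fun e =>
  Sym2.lift ⟨fun u v => (z u 0 - z v 0) ^ 2 + (z u 1 - z v 1) ^ 2, by intro a b; ring⟩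
    (e : Sym2 V)

/-- Membership in the linear subspace `ℂ^{2|V|-3} ⊆ ℂ^{2|V|}` determined by the chosen edge
`{ubar, vbar}`: the conditions `x_ū = y_ū = 0` and `x_v̄ = 0`. -/
def InDomain (ubar vbar : V) (z : V → Fin 2 → ℂ) : Prop :=
  z ubar 0 = 0 ∧ z ubar 1 = 0 ∧ z vbar 0 = 0

/-- The restriction of `h_G` to `ℂ^{2|V|-3}` is dominant: its image is not contained in the
zero set of any nonzero polynomial. -/
def HDominant (G : SimpleGraph V) (ubar vbar : V) : Prop :=
  ∀ P : MvPolynomial ↥G.edgeSet ℂ,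
    (∀ z, InDomain ubar vbar z → MvPolynomial.eval (hMap G z) P = 0) → P = 0

/-- The fiber of (the restriction of) `h_G` over a labeling `lam`. -/
def HFiber (G : SimpleGraph V) (ubar vbar : V) (lam : ↥G.edgeSet → ℂ) :
    Set (V → Fin 2 → ℂ) :=
  {z | InDomain ubar vbar z ∧ hMap G z = lam}

/-- The quotient `ℂ^V / ⟨(1,…,1)⟩` of `ℂ^V` by the line of constant vectors. -/
abbrev ModV (V : Type) := (V → ℂ) ⧸ (Submodule.span ℂ {(fun _ => 1 : V → ℂ)})

/-- The value on an edge of the product `(x_u - x_v)(y_u - y_v)`, which is well defined on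
unordered edges. -/
def fgVal (x y : V → ℂ) (s : Sym2 V) : ℂ :=
  Sym2.lift ⟨fun u v => (x u - x v) * (y u - y v), by intro a b; ring⟩ s

/-- The fiber of the rational map
`f_G : ℙ(ℂ^V/⟨1⟩) × ℙ(ℂ^V/⟨1⟩) ⇢ ℙ(ℂ^E)` over the projective point `[lam]`:
the set of pairs of projective points at which `f_G` is defined and takes the value `[lam]`. -/
def FFiber (G : SimpleGraph V) (lam : ↥G.edgeSet → ℂ) :
    Set (Projectivization ℂ (ModV V) × Projectivization ℂ (ModV V)) :=
  {XY | ∃ (x y : V → ℂ)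
    (hx : (Submodule.Quotient.mk x : ModV V) ≠ 0)
    (hy : (Submodule.Quotient.mk y : ModV V) ≠ 0),
    XY.1 = Projectivization.mk ℂ (Submodule.Quotient.mk x) hx ∧
    XY.2 = Projectivization.mk ℂ (Submodule.Quotient.mk y) hy ∧
    (fun e : ↥G.edgeSet => fgVal x y (e : Sym2 V)) ≠ 0 ∧
    ∃ c : ℂ, c ≠ 0 ∧ ∀ e : ↥G.edgeSet, fgVal x y (e : Sym2 V) = c * lam e}

/-- Graphs constructible from a single edge by the two Henneberg rules. -/
inductive Henneberg : {n : ℕ} → SimpleGraph (Fin n) → Prop where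
  | base : Henneberg (⊤ : SimpleGraph (Fin 2))
  | rule1 {n : ℕ} {G : SimpleGraph (Fin n)} (u v : Fin n) (huv : u ≠ v)
      (h : Henneberg G) :
      Henneberg (SimpleGraph.fromRel (fun a b =>
        (∃ a₀ b₀ : Fin n, a = a₀.castSucc ∧ b = b₀.castSucc ∧ G.Adj a₀ b₀) ∨
        (a = u.castSucc ∧ b = Fin.last n) ∨ (a = v.castSucc ∧ b = Fin.last n)))
  | rule2 {n : ℕ} {G : SimpleGraph (Fin n)} (u v w : Fin n) (huv : u ≠ v) (huw : u ≠ w)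
      (hvw : v ≠ w) (hadj : G.Adj u v) (h : Henneberg G) :
      Henneberg (SimpleGraph.fromRel (fun a b =>
        (∃ a₀ b₀ : Fin n, a = a₀.castSucc ∧ b = b₀.castSucc ∧ G.Adj a₀ b₀ ∧
          ¬(a₀ = u ∧ b₀ = v) ∧ ¬(a₀ = v ∧ b₀ = u)) ∨
        (a = u.castSucc ∧ b = Fin.last n) ∨ (a = v.castSucc ∧ b = Fin.last n) ∨
        (a = w.castSucc ∧ b = Fin.last n)))


theorem map_ne_top_aux {A S : Type} [CommRing A] [CommRing S] [Algebra A S] (c : A) (m : Ideal A)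
    [m.IsPrime] (hcm : c ∉ m) (hinj : Function.Injective (algebraMap A S))
    (h1 : ∀ s : S, ∃ N : ℕ, IsIntegral A (c ^ N • s)) : Ideal.map (algebraMap A S) m ≠ ⊤ := by
  have h2 : ∀ s ∈ Ideal.map (algebraMap A S) m, ∃ N : ℕ,
      ∃ r ∈ Ideal.map (algebraMap A (integralClosure A S)) m, (r : S) = c ^ N • s := by
    intro s hs
    induction hs using Submodule.span_induction with
    | mem x hx =>
      obtain ⟨y, hy, rfl⟩ := hx
      exact ⟨0, algebraMap A _ y, Ideal.mem_map_of_mem _ hy, by simp⟩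
    | zero => exact ⟨0, 0, by simp, by simp⟩
    | add x y _ _ hx hy =>
      obtain ⟨N, r, hr, hr'⟩ := hx
      obtain ⟨M, t, ht, ht'⟩ := hy
      refine ⟨N + M, c ^ M • r + c ^ N • t, ?_, ?_⟩
      · exact add_mem (Submodule.smul_of_tower_mem _ _ hr) (Submodule.smul_of_tower_mem _ _ ht)
      · push_cast
        rw [hr', ht', smul_smul, smul_smul, smul_add, pow_add, mul_comm (c ^ M)]
    | smul a x _ hx =>
      obtain ⟨N, r, hr, hr'⟩ := hx
      obtain ⟨M, hM⟩ := h1 a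
      refine ⟨M + N, (⟨c ^ M • a, hM⟩ : integralClosure A S) * r, Ideal.mul_mem_left _ _ hr, ?_⟩
      push_cast
      rw [hr', smul_eq_mul, smul_mul_smul_comm, pow_add]
  intro h
  obtain ⟨N, r, hr, hr'⟩ := h2 1 (by rw [h]; trivial)
  obtain ⟨Q, -, hQ, hQm⟩ := Ideal.exists_ideal_over_prime_of_isIntegral
    (S := integralClosure A S) m ⊥ (by
    intro x hx
    have h0 : algebraMap A (integralClosure A S) x = 0 := by simpa using hx
    have h3 : algebraMap A S x = 0 := congrArg Subtype.val h0
    have : x = 0 := hinj (by rw [h3, map_zero])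
    rw [this]; exact zero_mem _)
  have hrQ : r ∈ Q := by
    have : Ideal.map (algebraMap A (integralClosure A S)) m ≤ Q := by
      rw [Ideal.map_le_iff_le_comap, hQm]
    exact this hr
  have : r = algebraMap A (integralClosure A S) (c ^ N) := by
    apply Subtype.ext
    rw [hr', Algebra.smul_def, mul_one]; rfl
  rw [this, ← Ideal.mem_comap, hQm] at hrQ
  exact hcm (‹m.IsPrime›.mem_of_pow_mem _ hrQ)

set_option maxHeartbeats 1000000 in
open MvPolynomial in
theorem fin_of_dom {σ τ : Type} [Finite σ] [Finite τ] (f : τ → MvPolynomial σ ℂ)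
    (hf : AlgebraicIndependent ℂ f) (hc : Nat.card σ = Nat.card τ) :
    ∃ P : MvPolynomial τ ℂ, P ≠ 0 ∧ ∀ l : τ → ℂ, eval l P ≠ 0 →
      (∃ a : σ → ℂ, ∀ e, eval a (f e) = l e) ∧
      {a : σ → ℂ | ∀ e, eval a (f e) = l e}.Finite := by
  have := Fintype.ofFinite σ
  have htb : IsTranscendenceBasis ℂ f := by
    apply hf.isTranscendenceBasis_of_trdeg_le_of_finite
    rw [MvPolynomial.trdeg_of_isDomain, Cardinal.lift_id, ← Nat.cast_card, ← Nat.cast_card, hc]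
  have := htb.isAlgebraic
  set A := Algebra.adjoin ℂ (Set.range f) with hA
  obtain ⟨c, hc0, hint⟩ := Algebra.IsAlgebraic.exists_integral_multiples A
    (Finset.univ.image (fun j : σ => (X j : MvPolynomial σ ℂ)))
  replace hint : ∀ j : σ, IsIntegral A (c • (X j : MvPolynomial σ ℂ)) := fun j =>
    hint _ (by simp)
  refine ⟨hf.aevalEquiv.symm c, by simpa using hc0, fun l hl => ?_⟩
  let φ : A →ₐ[ℂ] ℂ := (aeval l).comp hf.aevalEquiv.symm.toAlgHom
  have hφc : φ c ≠ 0 := by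
    simpa [φ, aeval_eq_eval] using hl
  have hφ : ∀ a : σ → ℂ, (∀ e, eval a (f e) = l e) → ∀ x : A, eval a (x : MvPolynomial σ ℂ) = φ x := by
    intro a ha x
    obtain ⟨y, rfl⟩ := hf.aevalEquiv.surjective x
    simp only [φ, AlgebraicIndependent.aevalEquiv_apply_coe]
    have h0 : hf.aevalEquiv.symm.toAlgHom (hf.aevalEquiv y) = y := hf.aevalEquiv.symm_apply_apply y
    rw [AlgHom.comp_apply, h0]
    have : (aeval a : MvPolynomial σ ℂ →ₐ[ℂ] ℂ).comp (aeval f) = aeval l := by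
      ext e; simp [aeval_eq_eval, ha]
    exact DFunLike.congr_fun this y
  constructor
  · set m : Ideal A := RingHom.ker (φ : A →+* ℂ)
    have : m.IsPrime := RingHom.ker_isPrime _
    have h1 : ∀ s : MvPolynomial σ ℂ, ∃ N : ℕ, IsIntegral A (c ^ N • s) := by
      intro s
      induction s using MvPolynomial.induction_on with
      | C a => exact ⟨0, by
          simpa using (isIntegral_algebraMap (R := A) (A := MvPolynomial σ ℂ) (x := algebraMap ℂ A a))⟩
      | add p q hp hq =>
        obtain ⟨N, hN⟩ := hp
        obtain ⟨M, hM⟩ := hq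
        refine ⟨N + M, ?_⟩
        have := ((hN.smul (c ^ M)).add (hM.smul (c ^ N)))
        rw [smul_smul, smul_smul] at this
        rw [smul_add, pow_add]
        rwa [mul_comm (c ^ M)] at this
      | mul_X p j hp =>
        obtain ⟨N, hN⟩ := hp
        refine ⟨N + 1, ?_⟩
        have := hN.mul (hint j)
        rwa [smul_mul_smul_comm, ← pow_succ] at this
    set J : Ideal (MvPolynomial σ ℂ) := Ideal.span (Set.range fun e => f e - C (l e)) with hJ
    have hJ1 : J ≠ ⊤ := by
      refine ne_top_of_le_ne_top (map_ne_top_aux c m hφc Subtype.val_injective h1) ?_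
      rw [hJ, Ideal.span_le]
      rintro _ ⟨e, rfl⟩
      have h5 : f e - C (l e) = algebraMap A (MvPolynomial σ ℂ)
          (hf.aevalEquiv (X e) - algebraMap ℂ A (l e)) := by
        rw [map_sub, AlgebraicIndependent.algebraMap_aevalEquiv, aeval_X]; rfl
      simp only [SetLike.mem_coe]
      rw [h5]
      apply Ideal.mem_map_of_mem
      rw [RingHom.mem_ker]
      simp [φ]
    obtain ⟨M, hM, hJM⟩ := Ideal.exists_le_maximal J hJ1
    obtain ⟨a, rfl⟩ := isMaximal_iff_eq_vanishingIdeal_singleton.1 hM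
    refine ⟨a, fun e => ?_⟩
    have := hJM (Ideal.subset_span ⟨e, rfl⟩)
    rw [mem_vanishingIdeal_singleton_iff] at this
    simpa [aeval_eq_eval, sub_eq_zero] using this
  · choose p hpm hp using hint
    have hfin : ∀ j : σ, {t : ℂ | ((p j).map (φ : A →+* ℂ)).eval (φ c * t) = 0}.Finite := by
      intro j
      have : ({t : ℂ | ((p j).map (φ : A →+* ℂ)).eval (φ c * t) = 0}) =
        (fun t => φ c * t) ⁻¹' {t | ((p j).map (φ : A →+* ℂ)).IsRoot t} := rfl
      rw [this]
      apply Set.Finite.preimage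
      · intro x _ y _ h
        exact mul_left_cancel₀ hφc h
      · exact Polynomial.finite_setOfPred_isRoot ((hpm j).map _).ne_zero
    refine (Set.Finite.pi' hfin).subset ?_
    intro a ha j
    have h := congrArg (eval a) (hp j)
    rw [Polynomial.hom_eval₂] at h
    have h3 : (eval a).comp (algebraMap A (MvPolynomial σ ℂ)) = (φ : A →+* ℂ) := by
      ext x; exact hφ a ha x
    rw [h3] at h
    have h4 : eval a (c • (X j : MvPolynomial σ ℂ)) = φ c * a j := by
      rw [Algebra.smul_def, map_mul, eval_X]
      congr 1
      exact hφ a ha c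
    rw [h4] at h
    simpa [Polynomial.eval_map] using h

open MvPolynomial in
theorem height_point {σ : Type} [Finite σ] (a : σ → ℂ) :
    (vanishingIdeal ℂ {a} : Ideal (MvPolynomial σ ℂ)).height = Nat.card σ := by
  have key : ∀ b : σ → ℂ, (vanishingIdeal ℂ {b} : Ideal (MvPolynomial σ ℂ)).height
      = (vanishingIdeal ℂ {a} : Ideal (MvPolynomial σ ℂ)).height := by
    intro b
    let e : MvPolynomial σ ℂ ≃ₐ[ℂ] MvPolynomial σ ℂ := AlgEquiv.ofAlgHom
      (aeval fun i => X i + C (a i - b i)) (aeval fun i => X i - C (a i - b i))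
      (by ext i; simp) (by ext i; simp)
    rw [← RingEquiv.height_comap e.toRingEquiv]
    congr 1
    ext p
    rw [Ideal.mem_comap, mem_vanishingIdeal_singleton_iff, mem_vanishingIdeal_singleton_iff]
    have : (aeval b : MvPolynomial σ ℂ →ₐ[ℂ] ℂ).comp e.toAlgHom = aeval a := by
      ext i; simp [e]
    rw [← this]; rfl
  have h := Ideal.sup_isMaximal_height_eq_ringKrullDim (R := MvPolynomial σ ℂ)
  rw [ringKrullDim_of_isNoetherianRing, ringKrullDim_eq_zero_of_field, zero_add] at h
  have h2 : (⨆ I : Ideal (MvPolynomial σ ℂ), ⨆ (_ : I.IsMaximal), I.height) = (vanishingIdeal ℂ {a} : Ideal (MvPolynomial σ ℂ)).height := by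
    apply le_antisymm
    · refine iSup_le fun I => iSup_le fun hI => ?_
      obtain ⟨b, rfl⟩ := isMaximal_iff_eq_vanishingIdeal_singleton.1 hI
      exact (key b).le
    · exact le_iSup₂_of_le (vanishingIdeal ℂ {a}) inferInstance le_rfl
  rw [h2] at h
  exact_mod_cast h

open MvPolynomial in
theorem card_le_of_fin {σ τ : Type} [Finite σ] [Finite τ] (f : τ → MvPolynomial σ ℂ) (l : τ → ℂ)
    (a : σ → ℂ) (ha : ∀ e, eval a (f e) = l e)
    (hfin : {a : σ → ℂ | ∀ e, eval a (f e) = l e}.Finite) : Nat.card σ ≤ Nat.card τ := by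
  set S : Set (MvPolynomial σ ℂ) := Set.range fun e => f e - C (l e) with hS
  have hmin : (vanishingIdeal ℂ {a} : Ideal (MvPolynomial σ ℂ)) ∈ (Ideal.span S).minimalPrimes := by
    refine ⟨⟨inferInstance, ?_⟩, ?_⟩
    · rw [Ideal.span_le]
      rintro _ ⟨e, rfl⟩
      simp [aeval_eq_eval, ha]
    · rintro Q ⟨hQ, hSQ⟩ hQa
      have hz : (zeroLocus ℂ Q).Finite := by
        refine hfin.subset ?_
        intro b hb e
        have := hb _ (hSQ (Ideal.subset_span ⟨e, rfl⟩))
        simpa [aeval_eq_eval, sub_eq_zero] using this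
      have hle : hz.toFinset.inf (fun b => (vanishingIdeal ℂ {b} : Ideal (MvPolynomial σ ℂ))) ≤ Q := by
        intro p hp
        rw [← hQ.radical, ← vanishingIdeal_zeroLocus_eq_radical (K := ℂ)]
        intro b hb
        simp only [Submodule.mem_finsetInf] at hp
        have := hp b (by simpa using hb)
        rwa [mem_vanishingIdeal_singleton_iff] at this
      obtain ⟨b, -, hb⟩ := hQ.inf_le'.1 hle
      have hm : (vanishingIdeal ℂ {b} : Ideal (MvPolynomial σ ℂ)).IsMaximal := inferInstance
      have hm2 : (vanishingIdeal ℂ {a} : Ideal (MvPolynomial σ ℂ)).IsMaximal := inferInstance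
      rw [← hm.eq_of_le hm2.ne_top (hb.trans hQa)]
      exact hb
  have h := Ideal.height_le_card_of_mem_minimalPrimes_span (Set.finite_range _) hmin
  rw [height_point] at h
  have h' : Nat.card σ ≤ S.ncard := by exact_mod_cast h
  refine h'.trans ?_
  rw [hS, ← Set.image_univ, ← Set.ncard_univ]
  exact Set.ncard_image_le Set.finite_univ

theorem Equivalent.symm' {ρ₁ ρ₂ : V → Fin 2 → ℂ} (h : Equivalent ρ₁ ρ₂) : Equivalent ρ₂ ρ₁ := by
  obtain ⟨A, b, hA, hd, h⟩ := h
  refine ⟨A.transpose, -(A.transpose.mulVec b), ?_, by simpa using hd, fun v => ?_⟩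
  · rw [Matrix.transpose_transpose]; exact mul_eq_one_comm.1 hA
  · rw [h v, Matrix.mulVec_add, Matrix.mulVec_mulVec, hA, Matrix.one_mulVec, add_neg_cancel_right]

theorem Equivalent.trans' {ρ₁ ρ₂ ρ₃ : V → Fin 2 → ℂ} (h : Equivalent ρ₁ ρ₂)
    (h' : Equivalent ρ₂ ρ₃) : Equivalent ρ₁ ρ₃ := by
  obtain ⟨A, b, hA, hd, h⟩ := h
  obtain ⟨A', b', hA', hd', h'⟩ := h'
  refine ⟨A * A', A.mulVec b' + b, ?_, by simp [hd, hd'], fun v => ?_⟩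
  · rw [Matrix.transpose_mul, Matrix.mul_assoc, ← Matrix.mul_assoc A.transpose, hA, Matrix.one_mul, hA']
  · rw [h v, h' v, Matrix.mulVec_add, Matrix.mulVec_mulVec, add_assoc]

theorem orth_eqs {A : Matrix (Fin 2) (Fin 2) ℂ} (hA : A.transpose * A = 1) :
    A 0 0 ^ 2 + A 1 0 ^ 2 = 1 ∧ A 0 1 ^ 2 + A 1 1 ^ 2 = 1 ∧ A 0 0 * A 0 1 + A 1 0 * A 1 1 = 0 := by
  have h00 := congrFun (congrFun hA 0) 0
  have h11 := congrFun (congrFun hA 1) 1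
  have h01 := congrFun (congrFun hA 0) 1
  simp [Matrix.mul_apply, Fin.sum_univ_two] at h00 h11 h01
  exact ⟨by linear_combination h00, by linear_combination h11, h01⟩

theorem Equivalent.hMap_eq (G : SimpleGraph V) {ρ₁ ρ₂ : V → Fin 2 → ℂ} (h : Equivalent ρ₁ ρ₂) :
    hMap G ρ₁ = hMap G ρ₂ := by
  obtain ⟨A, b, hA, hd, h⟩ := h
  obtain ⟨h1, h2, h3⟩ := orth_eqs hA
  funext ⟨e, he⟩
  induction e using Sym2.ind with
  | _ u v =>
    simp only [hMap, Sym2.lift_mk, h, Matrix.mulVec, dotProduct, Fin.sum_univ_two, Pi.add_apply]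
    linear_combination (ρ₂ u 0 - ρ₂ v 0) ^ 2 * h1 + (ρ₂ u 1 - ρ₂ v 1) ^ 2 * h2 +
      2 * (ρ₂ u 0 - ρ₂ v 0) * (ρ₂ u 1 - ρ₂ v 1) * h3

theorem compatible_iff (G : SimpleGraph V) (l : ↥G.edgeSet → ℂ) (ρ : V → Fin 2 → ℂ) :
    Compatible G l ρ ↔ hMap G ρ = l := by
  constructor
  · intro h
    funext ⟨e, he⟩
    induction e using Sym2.ind with
    | _ u v => rw [h ⟨s(u, v), he⟩ u v rfl]; simp [hMap, qf]
  · rintro rfl ⟨e, he⟩ u v huv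
    simp only at huv
    subst huv
    simp [hMap, qf]

theorem exists_normal (ubar vbar : V) (ρ : V → Fin 2 → ℂ)
    (hq : (ρ ubar 0 - ρ vbar 0) ^ 2 + (ρ ubar 1 - ρ vbar 1) ^ 2 ≠ 0) :
    ∃ z, InDomain ubar vbar z ∧ Equivalent ρ z := by
  obtain ⟨s, hs⟩ := IsAlgClosed.exists_pow_nat_eq
    ((ρ ubar 0 - ρ vbar 0) ^ 2 + (ρ ubar 1 - ρ vbar 1) ^ 2) (n := 2) (by norm_num)
  have hs0 : s ≠ 0 := by
    rintro rfl
    apply hq; rw [← hs]; simp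
  set w0 := ρ vbar 0 - ρ ubar 0 with hw0
  set w1 := ρ vbar 1 - ρ ubar 1 with hw1
  have hs' : s ^ 2 = w0 ^ 2 + w1 ^ 2 := by rw [hs, hw0, hw1]; ring
  set p := w1 / s with hp
  set r := -w0 / s with hr
  have hpr : p ^ 2 + r ^ 2 = 1 := by
    rw [hp, hr]; field_simp; rw [hs']; ring
  refine ⟨fun v => ![p * (ρ v 0 - ρ ubar 0) + r * (ρ v 1 - ρ ubar 1),
    -r * (ρ v 0 - ρ ubar 0) + p * (ρ v 1 - ρ ubar 1)], ⟨by simp, by simp, ?_⟩, ?_⟩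
  · simp only [Matrix.cons_val_zero]
    rw [← hw0, ← hw1, hp, hr]; ring
  · refine ⟨!![p, -r; r, p], ρ ubar, ?_, ?_, ?_⟩
    · ext i j
      fin_cases i <;> fin_cases j <;> simp [Matrix.mul_apply, Fin.sum_univ_two] <;>
        first | linear_combination hpr | ring | linear_combination hpr
    · rw [Matrix.det_fin_two_of]; linear_combination hpr
    · intro v
      funext i
      fin_cases i
      · simp [Matrix.mulVec, dotProduct, Fin.sum_univ_two]
        linear_combination (-(ρ v 0 - ρ ubar 0)) * hpr
      · simp [Matrix.mulVec, dotProduct, Fin.sum_univ_two]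
        linear_combination (-(ρ v 1 - ρ ubar 1)) * hpr

theorem eq_or_neg (ubar vbar : V) (z z' : V → Fin 2 → ℂ) (hz : InDomain ubar vbar z)
    (hz' : InDomain ubar vbar z') (h : Equivalent z z') (hq : z' vbar 1 ≠ 0) :
    z = z' ∨ z = -z' := by
  obtain ⟨A, b, hA, hd, h⟩ := h
  obtain ⟨h1, h2, h3⟩ := orth_eqs hA
  obtain ⟨a1, a2, a3⟩ := hz
  obtain ⟨b1, b2, b3⟩ := hz'
  have hz : ∀ v i, z v i = A i 0 * z' v 0 + A i 1 * z' v 1 + b i := by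
    intro v i
    rw [h v]; simp only [Matrix.mulVec, dotProduct, Fin.sum_univ_two, Pi.add_apply]
  have hb : ∀ i, b i = 0 := by
    have e0 := hz ubar 0
    have e1 := hz ubar 1
    rw [b1, b2] at e0 e1
    intro i
    fin_cases i
    · simpa [a1] using e0.symm
    · simpa [a2] using e1.symm
  have h01 : A 0 1 = 0 := by
    have := hz vbar 0
    rw [a3, b3, hb] at this
    simpa [hq] using this.symm
  have h11 : A 1 1 = 1 ∨ A 1 1 = -1 := by
    rw [h01] at h2
    have h2' : A 1 1 ^ 2 = 1 := by simpa using h2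
    simpa using h2'
  have h10 : A 1 0 = 0 := by
    rw [h01] at h3
    rcases h11 with h | h <;> simpa [h] using h3
  rw [Matrix.det_fin_two, h01] at hd
  rcases h11 with h | h
  · left
    have h00 : A 0 0 = 1 := by simpa [h] using hd
    funext v i
    rw [hz, hb]
    fin_cases i <;> simp [h, h00, h01, h10]
  · right
    have h00 : A 0 0 = -1 := by rw [h] at hd; linear_combination -hd
    funext v i
    rw [hz, hb]
    fin_cases i <;> simp [h, h00, h01, h10]

/-- Index set of the free coordinates. -/
abbrev FreeIdx (ubar vbar : V) : Type :=
  {p : V × Fin 2 // p ∉ ({(ubar, 0), (ubar, 1), (vbar, 0)} : Finset (V × Fin 2))}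

theorem card_freeIdx (ubar vbar : V) (h : ubar ≠ vbar) :
    Nat.card (FreeIdx ubar vbar) + 3 = 2 * Fintype.card V := by
  have h3 : ({(ubar, 0), (ubar, 1), (vbar, 0)} : Finset (V × Fin 2)).card = 3 := by
    rw [Finset.card_eq_three]
    exact ⟨_, _, _, by simp, by simp [h], by simp, rfl⟩
  have h1 : Nat.card (FreeIdx ubar vbar) =
      (({(ubar, 0), (ubar, 1), (vbar, 0)} : Finset (V × Fin 2))ᶜ).card := by
    rw [Nat.card_eq_fintype_card, Fintype.card_subtype]
    congr 1
    ext p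
    simp
  rw [h1, ← h3, Finset.card_compl_add_card, Fintype.card_prod, Fintype.card_fin, mul_comm]

/-- Extension of free coordinates by zero. -/
def extZ (ubar vbar : V) (a : FreeIdx ubar vbar → ℂ) : V → Fin 2 → ℂ := fun v i =>
  if h : (v, i) ∉ ({(ubar, 0), (ubar, 1), (vbar, 0)} : Finset (V × Fin 2)) then a ⟨(v, i), h⟩ else 0

/-- Coordinate polynomials. -/
def coordP (ubar vbar : V) (v : V) (i : Fin 2) : MvPolynomial (FreeIdx ubar vbar) ℂ :=
  if h : (v, i) ∉ ({(ubar, 0), (ubar, 1), (vbar, 0)} : Finset (V × Fin 2)) then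
    MvPolynomial.X ⟨(v, i), h⟩ else 0

/-- The components of `h_G` as polynomials. -/
def hPoly (G : SimpleGraph V) (ubar vbar : V) (e : ↥G.edgeSet) :
    MvPolynomial (FreeIdx ubar vbar) ℂ :=
  Sym2.lift ⟨fun u v => (coordP ubar vbar u 0 - coordP ubar vbar v 0) ^ 2 +
    (coordP ubar vbar u 1 - coordP ubar vbar v 1) ^ 2, by intro a b; ring⟩ (e : Sym2 V)

theorem eval_coordP (ubar vbar : V) (a : FreeIdx ubar vbar → ℂ) (v : V) (i : Fin 2) :
    MvPolynomial.eval a (coordP ubar vbar v i) = extZ ubar vbar a v i := by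
  unfold coordP extZ
  split_ifs <;> simp

theorem eval_hPoly (G : SimpleGraph V) (ubar vbar : V) (a : FreeIdx ubar vbar → ℂ)
    (e : ↥G.edgeSet) :
    MvPolynomial.eval a (hPoly G ubar vbar e) = hMap G (extZ ubar vbar a) e := by
  obtain ⟨e, he⟩ := e
  induction e using Sym2.ind with
  | _ u v => simp [hPoly, hMap, eval_coordP]

theorem inDomain_extZ (ubar vbar : V) (a : FreeIdx ubar vbar → ℂ) :
    InDomain ubar vbar (extZ ubar vbar a) := by
  refine ⟨?_, ?_, ?_⟩ <;> simp [extZ]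

theorem exists_extZ (ubar vbar : V) (z : V → Fin 2 → ℂ) (hz : InDomain ubar vbar z) :
    ∃ a, extZ ubar vbar a = z := by
  refine ⟨fun p => z p.1.1 p.1.2, ?_⟩
  funext v i
  unfold extZ
  by_cases h : (v, i) ∉ ({(ubar, 0), (ubar, 1), (vbar, 0)} : Finset (V × Fin 2))
  · rw [dif_pos h]
  · rw [dif_neg h]
    rw [not_not] at h
    obtain ⟨h1, h2, h3⟩ := hz
    simp only [Finset.mem_insert, Finset.mem_singleton, Prod.mk.injEq] at h
    rcases h with ⟨rfl, rfl⟩ | ⟨rfl, rfl⟩ | ⟨rfl, rfl⟩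
    · exact h1.symm
    · exact h2.symm
    · exact h3.symm

theorem extZ_injective (ubar vbar : V) : Function.Injective (extZ ubar vbar) := by
  intro a b hab
  funext ⟨⟨v, i⟩, h⟩
  have := congrFun (congrFun hab v) i
  simpa only [extZ, dif_pos h] using this

theorem hDominant_iff (G : SimpleGraph V) (ubar vbar : V) :
    HDominant G ubar vbar ↔ AlgebraicIndependent ℂ (hPoly G ubar vbar) := by
  have key : ∀ (P : MvPolynomial ↥G.edgeSet ℂ) (a : FreeIdx ubar vbar → ℂ),
      MvPolynomial.eval a (MvPolynomial.aeval (hPoly G ubar vbar) P) =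
      MvPolynomial.eval (hMap G (extZ ubar vbar a)) P := by
    intro P a
    have : (MvPolynomial.aeval a : MvPolynomial (FreeIdx ubar vbar) ℂ →ₐ[ℂ] ℂ).comp
        (MvPolynomial.aeval (hPoly G ubar vbar)) =
        MvPolynomial.aeval (hMap G (extZ ubar vbar a)) := by
      ext e; simp [MvPolynomial.aeval_eq_eval, eval_hPoly]
    exact DFunLike.congr_fun this P
  rw [algebraicIndependent_iff]
  refine forall_congr' fun P => ?_
  constructor
  · intro h hP
    apply h
    intro z hz
    obtain ⟨a, rfl⟩ := exists_extZ ubar vbar z hz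
    rw [← key, hP, map_zero]
  · intro h hP
    apply h
    apply MvPolynomial.funext
    intro a
    rw [key, hP _ (inDomain_extZ _ _ _), map_zero]

theorem rigid_fiber (G : SimpleGraph V) (ubar vbar : V) (hadj : G.Adj ubar vbar)
    (l : ↥G.edgeSet → ℂ) (hl : l ⟨s(ubar, vbar), hadj⟩ ≠ 0) :
    Rigid G l ↔ (∃ a, ∀ e, MvPolynomial.eval a (hPoly G ubar vbar e) = l e) ∧
      {a | ∀ e, MvPolynomial.eval a (hPoly G ubar vbar e) = l e}.Finite := by
  have hset : ∀ a, (∀ e, MvPolynomial.eval a (hPoly G ubar vbar e) = l e) ↔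
      hMap G (extZ ubar vbar a) = l := by
    intro a
    rw [funext_iff]
    simp only [eval_hPoly]
  have hnorm : ∀ ρ, hMap G ρ = l → ∃ a, hMap G (extZ ubar vbar a) = l ∧
      Equivalent ρ (extZ ubar vbar a) := by
    intro ρ hρ
    obtain ⟨z, hz, hE⟩ := exists_normal ubar vbar ρ (by
      have := congrFun hρ ⟨s(ubar, vbar), hadj⟩
      simp only [hMap, Sym2.lift_mk] at this
      rwa [this])
    obtain ⟨a, rfl⟩ := exists_extZ ubar vbar z hz
    exact ⟨a, by rw [← hE.hMap_eq G, hρ], hE⟩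
  simp only [hset, Rigid, compatible_iff]
  constructor
  · rintro ⟨⟨ρ, hρ⟩, F, hF, hF'⟩
    refine ⟨?_, ?_⟩
    · obtain ⟨a, ha, -⟩ := hnorm ρ hρ
      exact ⟨a, ha⟩
    · have hsub : {a | hMap G (extZ ubar vbar a) = l} ⊆ ⋃ ρ' ∈ F,
          {a | hMap G (extZ ubar vbar a) = l ∧ Equivalent (extZ ubar vbar a) ρ'} := by
        intro a ha
        obtain ⟨ρ', h1, h2⟩ := hF' _ ha
        simp only [Set.mem_iUnion]
        exact ⟨ρ', h1, ha, h2⟩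
      refine (hF.biUnion fun ρ' _ => ?_).subset hsub
      by_cases hne : ({a | hMap G (extZ ubar vbar a) = l ∧
          Equivalent (extZ ubar vbar a) ρ'}).Nonempty
      · obtain ⟨a0, ha0, hE0⟩ := hne
        have hfin : (extZ ubar vbar ⁻¹' {extZ ubar vbar a0, -extZ ubar vbar a0}).Finite :=
          Set.Finite.preimage (extZ_injective _ _).injOn (by simp)
        refine hfin.subset ?_
        rintro a ⟨ha, hE⟩
        refine eq_or_neg ubar vbar _ _ (inDomain_extZ _ _ a) (inDomain_extZ _ _ a0)
          (hE.trans' hE0.symm') ?_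
        intro h0
        apply hl
        rw [← ha0]
        obtain ⟨h1, h2, h3⟩ := inDomain_extZ ubar vbar a0
        simp [hMap, h0, h1, h2, h3]
      · rw [Set.not_nonempty_iff_eq_empty.1 hne]; exact Set.finite_empty
  · rintro ⟨⟨a, ha⟩, hfin⟩
    refine ⟨⟨_, ha⟩, extZ ubar vbar '' _, hfin.image _, ?_⟩
    intro ρ hρ
    obtain ⟨a, ha, hE⟩ := hnorm ρ hρ
    exact ⟨_, ⟨a, ha, rfl⟩, hE⟩

/-- A (finite connected simple) graph `G` with a fixed edge `{ū, v̄}` is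
generically rigid if and only if the map `h_G` is dominant and `2|V| = |E| + 3`. -/
theorem statement4 {V : Type} [Fintype V] (G : SimpleGraph V) (hconn : G.Connected)
    (ubar vbar : V) (hadj : G.Adj ubar vbar) :
    GenericallyRigid G ↔
      (HDominant G ubar vbar ∧ 2 * Fintype.card V = G.edgeSet.ncard + 3) := by
  have hcard := card_freeIdx ubar vbar hadj.ne
  set e0 : ↥G.edgeSet := ⟨s(ubar, vbar), hadj⟩ with he0
  have hX : (MvPolynomial.X e0 : MvPolynomial ↥G.edgeSet ℂ) ≠ 0 := MvPolynomial.X_ne_zero _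
  rw [hDominant_iff, ← hcard, ← Nat.card_coe_set_eq, add_left_inj]
  constructor
  · rintro ⟨P, hP, hrig⟩
    have hgood : ∀ l, MvPolynomial.eval l (P * MvPolynomial.X e0) ≠ 0 →
        (∃ a, ∀ e, MvPolynomial.eval a (hPoly G ubar vbar e) = l e) ∧
        {a | ∀ e, MvPolynomial.eval a (hPoly G ubar vbar e) = l e}.Finite := by
      intro l hl
      rw [map_mul, MvPolynomial.eval_X] at hl
      exact (rigid_fiber G ubar vbar hadj l (right_ne_zero_of_mul hl)).1
        (hrig l (left_ne_zero_of_mul hl))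
    have hdom : AlgebraicIndependent ℂ (hPoly G ubar vbar) := by
      rw [← hDominant_iff]
      intro Q hQ
      have : Q * (P * MvPolynomial.X e0) = 0 := by
        apply MvPolynomial.funext
        intro l
        rw [map_mul, map_zero]
        by_cases hl : MvPolynomial.eval l (P * MvPolynomial.X e0) = 0
        · rw [hl, mul_zero]
        · obtain ⟨⟨a, ha⟩, -⟩ := hgood l hl
          have : hMap G (extZ ubar vbar a) = l := by
            funext e; rw [← eval_hPoly, ha]
          rw [← this, hQ _ (inDomain_extZ _ _ _), zero_mul]
      exact (mul_eq_zero.1 this).resolve_right (mul_ne_zero hP hX)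
    refine ⟨hdom, le_antisymm ?_ ?_⟩
    · obtain ⟨l, hl⟩ : ∃ l, MvPolynomial.eval l (P * MvPolynomial.X e0) ≠ 0 := by
        by_contra! hcon
        exact mul_ne_zero hP hX (MvPolynomial.funext fun l => by rw [hcon, map_zero])
      obtain ⟨⟨a, ha⟩, hfin⟩ := hgood l hl
      exact card_le_of_fin _ l a ha hfin
    · have := hdom.cardinalMk_le_trdeg
      rw [MvPolynomial.trdeg_of_isDomain, Cardinal.lift_id, ← Nat.cast_card, ← Nat.cast_card] at this
      exact_mod_cast this
  · rintro ⟨hdom, hc⟩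
    obtain ⟨P, hP, h⟩ := fin_of_dom _ hdom hc
    refine ⟨P * MvPolynomial.X e0, mul_ne_zero hP hX, fun l hl => ?_⟩
    rw [map_mul, MvPolynomial.eval_X] at hl
    exact (rigid_fiber G ubar vbar hadj l (right_ne_zero_of_mul hl)).2
      (h l (left_ne_zero_of_mul hl))

end LamanGraphs
end
end

section
/- Let G=(V,E) be a Laman graph and fix an edge {ū,v̄}∈E, defining the map h_G. Then there exists a nonzero polynomial p on ℂ^E such that for every labeling λ∈ℂ^E with p(λ)≠0, the fiber h_G^{-1}(λ) and the fiber f_G^{-1}([λ]) (the set of points of ℙ^{|V|−2}×ℙ^{|V|−2} at which f_G is defined and takes the value [λ]∈ℙ(ℂ^E)) are both finite, and |h_G^{-1}(λ)| = 2·|f_G^{-1}([λ])|. -/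
set_option maxHeartbeats 1000000

noncomputable section
open Classical

namespace LamanGraphs

variable {V : Type} [Fintype V]

lemma gen_finite {J E : Type} [Fintype J] [Fintype E] (h : Fintype.card J ≤ Fintype.card E)
    (F : E → MvPolynomial J ℂ) :
    ∃ P : MvPolynomial E ℂ, P ≠ 0 ∧ ∀ lam : E → ℂ, MvPolynomial.eval lam P ≠ 0 →
      {z : J → ℂ | ∀ e, MvPolynomial.eval z (F e) = lam e}.Finite := by
  have key : ∀ j : J, ∃ P : MvPolynomial E ℂ, P ≠ 0 ∧ ∀ lam : E → ℂ,
      MvPolynomial.eval lam P ≠ 0 →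
      ∃ S : Set ℂ, S.Finite ∧ ∀ z : J → ℂ, (∀ e, MvPolynomial.eval z (F e) = lam e) → z j ∈ S := by
    intro j
    let f : Option E → MvPolynomial J ℂ := fun o => o.elim (MvPolynomial.X j) F
    have hdep : ¬ AlgebraicIndependent ℂ f := by
      intro hi
      have h1 := hi.lift_cardinalMk_le_trdeg
      rw [MvPolynomial.trdeg_of_isDomain] at h1
      simp at h1
      have h2 : Fintype.card E + 1 ≤ Fintype.card J := by exact_mod_cast h1
      omega
    rw [algebraicIndependent_iff] at hdep
    push Not at hdep
    obtain ⟨Q, hQ, hQ0⟩ := hdep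
    let q := MvPolynomial.optionEquivLeft ℂ E Q
    have hq : q ≠ 0 := by
      intro h0
      exact hQ0 ((MvPolynomial.optionEquivLeft ℂ E).injective (by rw [map_zero]; exact h0))
    refine ⟨q.leadingCoeff, Polynomial.leadingCoeff_ne_zero.mpr hq, ?_⟩
    intro lam hlam
    let r := q.map (MvPolynomial.eval lam)
    have hr : r ≠ 0 := by
      intro h0
      apply hlam
      have : r.coeff q.natDegree = 0 := by rw [h0]; simp
      rwa [Polynomial.coeff_map] at this
    refine ⟨{x | r.IsRoot x}, Polynomial.finite_setOfPred_isRoot hr, ?_⟩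
    intro z hz
    change Polynomial.eval (z j) r = 0
    have e1 : ∀ Q : MvPolynomial (Option E) ℂ,
        Polynomial.eval (z j) ((MvPolynomial.optionEquivLeft ℂ E Q).map (MvPolynomial.eval lam))
          = MvPolynomial.eval z (MvPolynomial.aeval f Q) := by
      intro Q
      induction Q using MvPolynomial.induction_on with
      | C a => simp [MvPolynomial.optionEquivLeft_C]
      | add p q hp hq => simp [hp, hq]
      | mul_X p o hp =>
        rw [map_mul, Polynomial.map_mul, Polynomial.eval_mul, hp]
        cases o with
        | none => simp [f, MvPolynomial.optionEquivLeft_X_none]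
        | some e => simp [f, MvPolynomial.optionEquivLeft_X_some, hz]
    rw [e1, hQ, map_zero]
  choose P hP hfin using key
  refine ⟨∏ j, P j, Finset.prod_ne_zero_iff.mpr fun j _ => hP j, ?_⟩
  intro lam hlam
  rw [map_prod, Finset.prod_ne_zero_iff] at hlam
  choose S hS hmem using fun j => hfin j lam (hlam j (Finset.mem_univ j))
  exact (Set.Finite.pi' hS).subset fun z hz j => hmem j z hz

lemma hfiber_gen (G : SimpleGraph V) (hc : G.edgeSet.ncard + 3 = 2 * Fintype.card V)
    (ubar vbar : V) (hne : ubar ≠ vbar) :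
    ∃ P : MvPolynomial ↥G.edgeSet ℂ, P ≠ 0 ∧ ∀ lam : ↥G.edgeSet → ℂ,
      MvPolynomial.eval lam P ≠ 0 → (HFiber G ubar vbar lam).Finite := by
  let T : Finset (V × Fin 2) := {(ubar, 0), (ubar, 1), (vbar, 0)}
  let J := {p : V × Fin 2 // p ∉ T}
  have hT : T.card = 3 := by
    rw [Finset.card_eq_three]
    exact ⟨_, _, _, by simp, by simp [hne], by simp, rfl⟩
  have hJ : Fintype.card J ≤ Fintype.card ↥G.edgeSet := by
    have h1 : Fintype.card J = Fintype.card (V × Fin 2) - T.card := by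
      rw [Fintype.card_subtype_compl, Fintype.card_coe]
    rw [h1, hT, Fintype.card_prod, Fintype.card_fin, ← Nat.card_eq_fintype_card (α := G.edgeSet)]
    rw [← Nat.card_coe_set_eq] at hc
    omega
  let c : V → Fin 2 → MvPolynomial J ℂ := fun v k =>
    if h : (v, k) ∉ T then MvPolynomial.X ⟨(v, k), h⟩ else 0
  let F : ↥G.edgeSet → MvPolynomial J ℂ := fun e =>
    Sym2.lift ⟨fun u v => (c u 0 - c v 0) ^ 2 + (c u 1 - c v 1) ^ 2, by intro a b; ring⟩
      (e : Sym2 V)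
  obtain ⟨P, hP, hfin⟩ := gen_finite hJ F
  refine ⟨P, hP, fun lam hlam => ?_⟩
  let φ : (V → Fin 2 → ℂ) → (J → ℂ) := fun z p => z p.1.1 p.1.2
  have hev : ∀ z, InDomain ubar vbar z → ∀ v k, MvPolynomial.eval (φ z) (c v k) = z v k := by
    intro z hz v k
    obtain ⟨h1, h2, h3⟩ := hz
    by_cases h : (v, k) ∉ T
    · simp [c, h, φ]
    · have h' := h
      simp only [T, not_not, Finset.mem_insert, Finset.mem_singleton, Prod.mk.injEq] at h'
      simp only [c, h, dite_false, map_zero]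
      rcases h' with ⟨rfl, rfl⟩ | ⟨rfl, rfl⟩ | ⟨rfl, rfl⟩ <;> simp [h1, h2, h3]
  refine Set.Finite.of_finite_image (f := φ) ((hfin lam hlam).subset ?_) ?_
  · rintro _ ⟨z, ⟨hz, hzl⟩, rfl⟩
    rintro ⟨e, he⟩
    rw [← hzl]
    induction e using Sym2.ind with
    | _ u v => simp [F, hMap, hev z hz]
  · rintro z ⟨hz, -⟩ z' ⟨hz', -⟩ h
    funext v k
    rw [← hev z hz, ← hev z' hz', h]

lemma mk_ne_zero' (x : V → ℂ) (u v : V) (h : x u ≠ x v) :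
    (Submodule.Quotient.mk x : ModV V) ≠ 0 := by
  intro h0
  rw [Submodule.Quotient.mk_eq_zero, Submodule.mem_span_singleton] at h0
  obtain ⟨a, rfl⟩ := h0
  simp at h

lemma proj_eq (x y : V → ℂ) (hx : (Submodule.Quotient.mk x : ModV V) ≠ 0)
    (hy : (Submodule.Quotient.mk y : ModV V) ≠ 0) :
    Projectivization.mk ℂ (Submodule.Quotient.mk x : ModV V) hx =
      Projectivization.mk ℂ (Submodule.Quotient.mk y : ModV V) hy ↔
      ∃ a b : ℂ, ∀ v, x v = a * y v + b := by
  rw [Projectivization.mk_eq_mk_iff']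
  refine exists_congr fun a => ?_
  rw [← Submodule.Quotient.mk_smul, eq_comm, Submodule.Quotient.eq, Submodule.mem_span_singleton]
  refine exists_congr fun b => ?_
  rw [funext_iff]
  refine forall_congr' fun v => ?_
  simp only [Pi.smul_apply, Pi.sub_apply, smul_eq_mul, mul_one]
  constructor
  · intro h; rw [h]; ring
  · intro h; rw [h]; ring

lemma hplus_equiv (G : SimpleGraph V) (ubar vbar : V) (hadj : G.Adj ubar vbar)
    (lam : ↥G.edgeSet → ℂ) (t : ℂ) (ht : t ≠ 0)
    (htl : lam ⟨s(ubar, vbar), hadj⟩ = t ^ 2) :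
    Nonempty (↥{z | z ∈ HFiber G ubar vbar lam ∧ z vbar 1 = t} ≃ ↥(FFiber G lam)) := by
  have hIt : Complex.I * t ≠ 0 := mul_ne_zero Complex.I_ne_zero ht
  have hI2 : Complex.I ^ 2 = -1 := Complex.I_sq
  let a : (V → Fin 2 → ℂ) → V → ℂ := fun z v => z v 0 + Complex.I * z v 1
  let b : (V → Fin 2 → ℂ) → V → ℂ := fun z v => z v 0 - Complex.I * z v 1
  have hfg : ∀ z (e : ↥G.edgeSet), fgVal (a z) (b z) e = hMap G z e := by
    rintro z ⟨e, he⟩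
    induction e using Sym2.ind with
    | _ u v =>
      simp only [fgVal, hMap, Sym2.lift_mk, a, b]
      linear_combination (-(z u 1 - z v 1) ^ 2) * hI2
  have hval : ∀ z : ↥{z | z ∈ HFiber G ubar vbar lam ∧ z vbar 1 = t},
      a z ubar = 0 ∧ b z ubar = 0 ∧ a z vbar = Complex.I * t ∧ b z vbar = - (Complex.I * t) := by
    rintro ⟨z, ⟨⟨h1, h2, h3⟩, -⟩, h4⟩
    simp [a, b, h1, h2, h3, h4]
  have ha0 : ∀ z : ↥{z | z ∈ HFiber G ubar vbar lam ∧ z vbar 1 = t},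
      (Submodule.Quotient.mk (a z) : ModV V) ≠ 0 := fun z => by
    obtain ⟨h1, h2, h3, h4⟩ := hval z
    refine mk_ne_zero' _ ubar vbar ?_
    rw [h1, h3]; exact hIt.symm
  have hb0 : ∀ z : ↥{z | z ∈ HFiber G ubar vbar lam ∧ z vbar 1 = t},
      (Submodule.Quotient.mk (b z) : ModV V) ≠ 0 := fun z => by
    obtain ⟨h1, h2, h3, h4⟩ := hval z
    refine mk_ne_zero' _ ubar vbar ?_
    rw [h2, h4]; exact (neg_ne_zero.mpr hIt).symm
  have hl0 : lam ⟨s(ubar, vbar), hadj⟩ ≠ 0 := by rw [htl]; exact pow_ne_zero 2 ht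
  let g : ↥{z | z ∈ HFiber G ubar vbar lam ∧ z vbar 1 = t} → ↥(FFiber G lam) := fun z =>
    ⟨(Projectivization.mk ℂ _ (ha0 z), Projectivization.mk ℂ _ (hb0 z)), by
      refine ⟨a z, b z, ha0 z, hb0 z, rfl, rfl, ?_, 1, one_ne_zero, ?_⟩
      · intro h
        apply hl0
        have := congrFun h ⟨s(ubar, vbar), hadj⟩
        rw [hfg, z.2.1.2] at this
        exact this
      · intro e
        rw [hfg, z.2.1.2, one_mul]⟩
  refine ⟨Equiv.ofBijective g ⟨?_, ?_⟩⟩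
  · intro z z' h
    have h' := congrArg Subtype.val h
    simp only [g, Prod.mk.injEq] at h'
    obtain ⟨h1, h2⟩ := h'
    rw [proj_eq] at h1 h2
    obtain ⟨p, q, hpq⟩ := h1
    obtain ⟨r, s, hrs⟩ := h2
    obtain ⟨e1, e2, e3, e4⟩ := hval z
    obtain ⟨f1, f2, f3, f4⟩ := hval z'
    have hq : q = 0 := by have := hpq ubar; rw [e1, f1] at this; simpa using this.symm
    have hs : s = 0 := by have := hrs ubar; rw [e2, f2] at this; simpa using this.symm
    have hp : p = 1 := by
      have := hpq vbar; rw [e3, f3, hq] at this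
      apply mul_right_cancel₀ hIt; linear_combination -this
    have hr : r = 1 := by
      have := hrs vbar; rw [e4, f4, hs] at this
      apply mul_right_cancel₀ hIt; linear_combination this
    subst hq hs hp hr
    apply Subtype.ext
    funext v
    have k1 := hpq v
    have k2 := hrs v
    simp only [a, b] at k1 k2
    have m0 : z.1 v 0 = z'.1 v 0 := by linear_combination (k1 + k2) / 2
    have m1 : z.1 v 1 = z'.1 v 1 := by
      apply mul_left_cancel₀ Complex.I_ne_zero
      linear_combination (k1 - k2) / 2
    funext k
    fin_cases k
    · exact m0
    · exact m1
  · rintro ⟨⟨X, Y⟩, x, y, hx, hy, hX, hY, -, c, hc, hxy⟩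
    simp only at hX hY
    have h0 := hxy ⟨s(ubar, vbar), hadj⟩
    rw [htl] at h0
    simp only [fgVal, Sym2.lift_mk] at h0
    have hne : (x ubar - x vbar) * (y ubar - y vbar) ≠ 0 := by
      rw [h0]; exact mul_ne_zero hc (pow_ne_zero 2 ht)
    have hxn : x ubar - x vbar ≠ 0 := left_ne_zero_of_mul hne
    have hyn : y ubar - y vbar ≠ 0 := right_ne_zero_of_mul hne
    let α := - (Complex.I * t) / (x ubar - x vbar)
    let β := (Complex.I * t) / (y ubar - y vbar)
    have hα : α ≠ 0 := div_ne_zero (neg_ne_zero.mpr hIt) hxn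
    have hβ : β ≠ 0 := div_ne_zero hIt hyn
    have hα1 : α * (x ubar - x vbar) = - (Complex.I * t) := div_mul_cancel₀ _ hxn
    have hβ1 : β * (y ubar - y vbar) = Complex.I * t := div_mul_cancel₀ _ hyn
    let z : V → Fin 2 → ℂ := fun v =>
      ![(α * (x v - x ubar) + β * (y v - y ubar)) / 2,
        -Complex.I * (α * (x v - x ubar) - β * (y v - y ubar)) / 2]
    have haz : ∀ v, a z v = α * (x v - x ubar) := by
      intro v; simp only [a, z, Matrix.cons_val_zero, Matrix.cons_val_one]
      linear_combination (-(α * (x v - x ubar) - β * (y v - y ubar)) / 2) * hI2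
    have hbz : ∀ v, b z v = β * (y v - y ubar) := by
      intro v; simp only [b, z, Matrix.cons_val_zero, Matrix.cons_val_one]
      linear_combination ((α * (x v - x ubar) - β * (y v - y ubar)) / 2) * hI2
    have hαβ : α * β * c = 1 := by
      apply mul_right_cancel₀ (pow_ne_zero 2 ht)
      linear_combination (-α * β) * h0 + β * (y ubar - y vbar) * hα1 -
        (Complex.I * t) * hβ1 - t ^ 2 * hI2
    have hz : z ∈ {z | z ∈ HFiber G ubar vbar lam ∧ z vbar 1 = t} := by
      refine ⟨⟨⟨by simp [z], by simp [z], ?_⟩, ?_⟩, ?_⟩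
      · simp only [z, Matrix.cons_val_zero]
        linear_combination (-hα1 - hβ1) / 2
      · funext e
        rw [← hfg]
        have he := hxy e
        obtain ⟨e, hee⟩ := e
        induction e using Sym2.ind with
        | _ u v =>
          simp only [fgVal, Sym2.lift_mk] at he ⊢
          rw [haz, haz, hbz, hbz]
          linear_combination α * β * he + lam ⟨s(u, v), hee⟩ * hαβ
      · change -Complex.I * (α * (x vbar - x ubar) - β * (y vbar - y ubar)) / 2 = t
        linear_combination (Complex.I / 2) * (hα1 - hβ1) - t * hI2
    refine ⟨⟨z, hz⟩, ?_⟩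
    apply Subtype.ext
    simp only [g]
    rw [hX, hY]
    refine Prod.ext ?_ ?_
    · exact (proj_eq _ _ _ _).mpr ⟨α, - α * x ubar, fun v => by rw [haz]; ring⟩
    · exact (proj_eq _ _ _ _).mpr ⟨β, - β * y ubar, fun v => by rw [hbz]; ring⟩

/-- For a Laman graph `G` with a fixed edge `{ū, v̄}`, there is a nonzero
polynomial `p` such that for every labeling `λ` with `p(λ) ≠ 0`, the fibers `h_G⁻¹(λ)` and
`f_G⁻¹([λ])` are finite and `|h_G⁻¹(λ)| = 2 · |f_G⁻¹([λ])|`. -/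
theorem statement5 {V : Type} [Fintype V] (G : SimpleGraph V) (hconn : G.Connected)
    (hlaman : LamanCond G) (ubar vbar : V) (hadj : G.Adj ubar vbar) :
    ∃ P : MvPolynomial ↥G.edgeSet ℂ, P ≠ 0 ∧
      ∀ lam : ↥G.edgeSet → ℂ, MvPolynomial.eval lam P ≠ 0 →
        (HFiber G ubar vbar lam).Finite ∧ (FFiber G lam).Finite ∧
        (HFiber G ubar vbar lam).ncard = 2 * (FFiber G lam).ncard := by
  obtain ⟨P, hP, hfin⟩ := hfiber_gen G hlaman.1 ubar vbar hadj.ne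
  refine ⟨MvPolynomial.X ⟨s(ubar, vbar), hadj⟩ * P, mul_ne_zero (MvPolynomial.X_ne_zero _) hP, ?_⟩
  intro lam hlam
  rw [map_mul, MvPolynomial.eval_X] at hlam
  have hH := hfin lam (right_ne_zero_of_mul hlam)
  have hl0 := left_ne_zero_of_mul hlam
  obtain ⟨t, ht⟩ := IsAlgClosed.exists_pow_nat_eq (lam ⟨s(ubar, vbar), hadj⟩) (n := 2) (by norm_num)
  have ht0 : t ≠ 0 := by
    rintro rfl
    apply hl0
    rw [← ht]; simp
  obtain ⟨e⟩ := hplus_equiv G ubar vbar hadj lam t ht0 ht.symm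
  let A : Set (V → Fin 2 → ℂ) := {z | z ∈ HFiber G ubar vbar lam ∧ z vbar 1 = t}
  have hA : A.Finite := hH.subset fun z hz => hz.1
  have hneg : ∀ z, z ∈ HFiber G ubar vbar lam → -z ∈ HFiber G ubar vbar lam := by
    rintro z ⟨⟨h1, h2, h3⟩, h4⟩
    refine ⟨⟨by simp [h1], by simp [h2], by simp [h3]⟩, ?_⟩
    rw [← h4]
    funext ⟨e, he⟩
    induction e using Sym2.ind with
    | _ u v =>
      simp only [hMap, Sym2.lift_mk, Pi.neg_apply]
      ring
  have hun : HFiber G ubar vbar lam = A ∪ Neg.neg '' A := by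
    apply Set.Subset.antisymm
    · intro z hz
      have h1 := congrFun hz.2 ⟨s(ubar, vbar), hadj⟩
      obtain ⟨d1, d2, d3⟩ := hz.1
      simp only [hMap, Sym2.lift_mk, d1, d2, d3] at h1
      have h2 : z vbar 1 ^ 2 = t ^ 2 := by rw [ht, ← h1]; ring
      rcases sq_eq_sq_iff_eq_or_eq_neg.mp h2 with h | h
      · exact Or.inl ⟨hz, h⟩
      · exact Or.inr ⟨-z, ⟨hneg z hz, by simp [h]⟩, by simp⟩
    · rintro z (hz | ⟨w, hw, rfl⟩)
      · exact hz.1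
      · exact hneg w hw.1
  have hdis : Disjoint A (Neg.neg '' A) := by
    rw [Set.disjoint_left]
    rintro _ hz ⟨w, hw, rfl⟩
    have h1 := hz.2
    have h2 := hw.2
    simp only [Pi.neg_apply, h2] at h1
    apply ht0
    linear_combination (-h1) / 2
  have hcard : A.ncard = (FFiber G lam).ncard := by
    rw [← Nat.card_coe_set_eq, ← Nat.card_coe_set_eq]
    exact Nat.card_congr e
  refine ⟨hH, ?_, ?_⟩
  · have : Finite ↥A := hA
    exact Finite.of_equiv _ e
  · rw [hun, Set.ncard_union_eq hdis hA (hA.image _), Set.ncard_image_of_injective _ neg_injective,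
      hcard]
    ring

end LamanGraphs
end
end
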